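/- (Peter's formula) As N → ∞, Σ_{2 < n ≤ N} A(n)² ~ κ·N, where κ = (1015/864)·∏_{p odd prime} (1 + (p⁴ − 2p³ + 1)/(p² − 1)³) = 1.328…. -/

import Mathlib

open Filter

/-- Value of the integral binary quadratic form `(a,b,c)` at `(x,y)`. -/
def formVal (f : ℤ × ℤ × ℤ) (x y : ℤ) : ℤ := f.1 * x ^ 2 + f.2.1 * x * y + f.2.2 * y ^ 2

/-- A form `ax² + bxy + cy²` is primitive if `gcd(a,b,c) = 1`. -/
def IsPrimitiveForm (f : ℤ × ℤ × ℤ) : Prop := Int.gcd f.1 (Int.gcd f.2.1 f.2.2) = 1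

/-- Discriminant `b² − 4ac` of the form `(a,b,c)`. -/
def formDisc (f : ℤ × ℤ × ℤ) : ℤ := f.2.1 ^ 2 - 4 * f.1 * f.2.2

/-- `SL(2,ℤ)`-equivalence of binary quadratic forms:
`Q'(x,y) = Q(αx + βy, γx + δy)` for some `[[α,β],[γ,δ]] ∈ SL(2,ℤ)`. -/
def formEquiv (f g : ℤ × ℤ × ℤ) : Prop :=
  ∃ M : Matrix.SpecialLinearGroup (Fin 2) ℤ,
    ∀ x y : ℤ, formVal g x y =
      formVal f (M.1 0 0 * x + M.1 0 1 * y) (M.1 1 0 * x + M.1 1 1 * y)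

/-- The class number `h(d)`: the number of `SL(2,ℤ)`-equivalence classes of
primitive integral binary quadratic forms of discriminant `d`. -/
noncomputable def classNumber (d : ℤ) : ℕ :=
  Nat.card (Quot (fun f g : {f : ℤ × ℤ × ℤ // IsPrimitiveForm f ∧ formDisc f = d} =>
    formEquiv f.1 g.1))
/-- `t_d`: the least `t ≥ 1` such that `t² − d u² = 4` has a solution with `u ≥ 1`. -/
noncomputable def td (d : ℤ) : ℕ :=
  sInf {t : ℕ | 0 < t ∧ ∃ u : ℕ, 0 < u ∧ (t : ℤ) ^ 2 - d * (u : ℤ) ^ 2 = 4}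

/-- `u_d`: the positive `u` corresponding to `t_d`. -/
noncomputable def ud (d : ℤ) : ℕ :=
  sInf {u : ℕ | 0 < u ∧ (td d : ℤ) ^ 2 - d * (u : ℤ) ^ 2 = 4}

/-- `ε_d = (t_d + u_d √d)/2`, the fundamental solution of `t² − d u² = 4`. -/
noncomputable def eps (d : ℤ) : ℝ := ((td d : ℝ) + (ud d : ℝ) * Real.sqrt (d : ℝ)) / 2
/-- `A(n) = Σ h(d)·log(ε_d)/(u·√d)`, summed over pairs `(d,u)` of positive integers with
`d ≡ 0, 1 (mod 4)` and `d·u² = n² − 4`. -/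
noncomputable def ampA (n : ℕ) : ℝ :=
  ∑ p ∈ (Finset.range (n ^ 2) ×ˢ Finset.range (n ^ 2)).filter
      (fun p => 0 < p.1 ∧ 0 < p.2 ∧ (p.1 % 4 = 0 ∨ p.1 % 4 = 1) ∧ p.1 * p.2 ^ 2 = n ^ 2 - 4),
    (classNumber (p.1 : ℤ) : ℝ) * Real.log (eps (p.1 : ℤ)) /
      ((p.2 : ℝ) * Real.sqrt (p.1 : ℝ))
/-- `κ = (1015/864)·∏_{p ≠ 2 prime} (1 + (p⁴ − 2p³ + 1)/(p² − 1)³)`. -/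
noncomputable def kappa : ℝ :=
  (1015 / 864) * ∏' p : {p : ℕ // p.Prime ∧ p ≠ 2},
    (1 + ((p.1 : ℝ) ^ 4 - 2 * (p.1 : ℝ) ^ 3 + 1) / ((p.1 : ℝ) ^ 2 - 1) ^ 3)

namespace PF

/-- Jacobi symbol, set to zero at even arguments. -/
noncomputable def chi (a : ℤ) (m : ℕ) : ℤ := if Odd m then jacobiSym a m else 0

lemma chi_mul_right (a : ℤ) (m n : ℕ) : chi a (m * n) = chi a m * chi a n := by
  unfold chi
  by_cases hm : Odd m <;> by_cases hn : Odd n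
  · have : Odd (m * n) := hm.mul hn
    rw [if_pos hm, if_pos hn, if_pos this]
    exact jacobiSym.mul_right' a (by rintro rfl; simp at hm) (by rintro rfl; simp at hn)
  all_goals
    have : ¬ Odd (m * n) := by rw [Nat.odd_mul]; tauto
    rw [if_neg this]; simp [hm, hn]

lemma chi_mul_left (a b : ℤ) (m : ℕ) : chi (a * b) m = chi a m * chi b m := by
  unfold chi
  split_ifs
  · exact jacobiSym.mul_left a b m
  · simp

lemma chi_abs_le (a : ℤ) (m : ℕ) : |chi a m| ≤ 1 := by
  unfold chi
  split_ifs
  · rcases jacobiSym.trichotomy a m with h | h | h <;> simp [h]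
  · simp

lemma chi_one (a : ℤ) : chi a 1 = 1 := by simp [chi]

lemma chi_zero (a : ℤ) : chi a 0 = 0 := by simp [chi]

lemma chi_mod (a : ℤ) (m : ℕ) : chi a (m % (4 * a.natAbs)) = chi a m := by
  unfold chi
  have h : Odd (m % (4 * a.natAbs)) ↔ Odd m := by
    rw [Nat.odd_iff, Nat.odd_iff, Nat.mod_mod_of_dvd]
    exact ⟨2 * a.natAbs, by ring⟩
  by_cases hm : Odd m
  · rw [if_pos hm, if_pos (h.2 hm)]; exact (jacobiSym.mod_right a hm).symm
  · rw [if_neg hm, if_neg (fun h' => hm (h.1 h'))]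

lemma exists_chi_neg (c : ℕ) (hc : ¬ IsSquare c) : ∃ m, chi c m = -1 := by
  have hc0 : c ≠ 0 := by rintro rfl; exact hc ⟨0, rfl⟩
  by_cases h : ∃ p, p.Prime ∧ p ≠ 2 ∧ Odd (c.factorization p)
  · obtain ⟨p, hp, hp2, hodd⟩ := h
    have : Fact p.Prime := ⟨hp⟩
    set v := c.factorization p
    set c' := c / p ^ v with hc'
    have hcc : c = p ^ v * c' := (Nat.ordProj_mul_ordCompl_eq_self c p).symm
    have hcop : Nat.Coprime p c' := Nat.coprime_ordCompl hp hc0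
    have hpodd : Odd p := hp.odd_of_ne_two hp2
    obtain ⟨r, hr⟩ : ∃ r : ℕ, legendreSym p r = -1 := by
      obtain ⟨x, hx⟩ := FiniteField.exists_nonsquare (F := ZMod p) (by rwa [ZMod.ringChar_zmod_n])
      refine ⟨x.val, ?_⟩
      rw [legendreSym.eq_neg_one_iff]
      simpa using hx
    have hcop2 : Nat.Coprime p (8 * c') := by
      refine Nat.Coprime.mul_right ?_ hcop
      have : Nat.Coprime p 2 := (Nat.coprime_primes hp Nat.prime_two).2 hp2
      exact this.pow_right 3
    obtain ⟨m, hm1, hm2⟩ := Nat.chineseRemainder hcop2 r 1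
    have h8 : m % 8 = 1 := by
      have := hm2.of_mul_right c'
      simpa [Nat.ModEq] using this
    have h4 : m % 4 = 1 := by omega
    have hmo : Odd m := Nat.odd_iff.2 (by omega)
    have hc'0 : c' ≠ 0 := by rintro h0; rw [h0] at hcc; simp at hcc; exact hc0 hcc
    have h4c : m % (4 * c') = 1 := by
      have h1 : m ≡ 1 [MOD 4 * c'] := hm2.of_dvd ⟨2, by ring⟩
      rw [h1, Nat.mod_eq_of_lt]
      omega
    refine ⟨m, ?_⟩
    rw [chi, if_pos hmo, hcc]
    push_cast
    rw [jacobiSym.mul_left, jacobiSym.pow_left, jacobiSym.mod_right' c' hmo, h4c,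
      jacobiSym.one_right, mul_one, jacobiSym.quadratic_reciprocity_one_mod_four' hpodd h4,
      ← jacobiSym.legendreSym.to_jacobiSym]
    have : legendreSym p m = legendreSym p r := by
      rw [legendreSym.mod p m, legendreSym.mod p r]
      congr 1
      exact_mod_cast hm1
    rw [this, hr]
    exact Odd.neg_one_pow hodd
  · push Not at h
    have hev : ∀ p, p.Prime → p ≠ 2 → Even (c.factorization p) := fun p hp h2 => by
      have := h p hp h2
      rwa [Nat.not_odd_iff_even] at this
    set v := c.factorization 2
    set c' := c / 2 ^ v with hc'
    have hcc : c = 2 ^ v * c' := (Nat.ordProj_mul_ordCompl_eq_self c 2).symm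
    have hcop : Nat.Coprime 2 c' := Nat.coprime_ordCompl Nat.prime_two hc0
    have hc'0 : c' ≠ 0 := by rintro h0; rw [h0] at hcc; simp at hcc; exact hc0 hcc
    have hsq : IsSquare c' := by
      rw [← Nat.prod_factorization_pow_eq_self hc'0]
      apply Finset.isSquare_prod
      intro p hp
      have hpp := Nat.prime_of_mem_primeFactors hp
      apply Even.isSquare_pow
      rw [hc', Nat.factorization_ordCompl]
      by_cases h2 : p = 2
      · subst h2; simp
      · rw [Finsupp.erase_ne h2]; exact hev p hpp h2
    obtain ⟨w, hw⟩ := hsq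
    have hvo : Odd v := by
      by_contra hve
      rw [Nat.not_odd_iff_even] at hve
      exact hc (by rw [hcc, hw]; exact (Even.isSquare_pow hve 2).mul ⟨w, rfl⟩)
    have hw2 : Nat.Coprime 8 w := by
      have : Nat.Coprime 2 w := by
        rw [hw] at hcop; exact hcop.coprime_mul_left_right
      exact this.pow_left 3
    obtain ⟨m, hm1, hm2⟩ := Nat.chineseRemainder hw2 5 1
    have h8 : m % 8 = 5 := hm1
    have hmo : Odd m := Nat.odd_iff.2 (by omega)
    refine ⟨m, ?_⟩
    rw [chi, if_pos hmo, hcc, hw]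
    push_cast
    rw [jacobiSym.mul_left, jacobiSym.pow_left, jacobiSym.at_two hmo, ← pow_two,
      jacobiSym.sq_one']
    · have : ZMod.χ₈ (m : ZMod 8) = -1 := by
        have : (m : ZMod 8) = 5 := by
          have := (ZMod.natCast_eq_natCast_iff m 5 8).2 hm1
          exact_mod_cast this
        rw [this]; decide
      rw [this, mul_one]; exact Odd.neg_one_pow hvo
    · have : Nat.Coprime w m := by
        have := hm2.gcd_eq
        rw [Nat.gcd_one_left] at this
        exact Nat.Coprime.symm this
      exact_mod_cast this

lemma chi_sum_period (c : ℕ) (hc : ¬ IsSquare c) :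
    ∑ m ∈ Finset.range (4 * c), chi c m = 0 := by
  obtain ⟨m0, hm0⟩ := exists_chi_neg c hc
  have hc0 : 0 < c := Nat.pos_of_ne_zero (by rintro rfl; exact hc ⟨0, rfl⟩)
  have hodd : Odd m0 := by by_contra h; simp [chi, h] at hm0
  have hcop : Nat.Coprime m0 (4 * c) := by
    refine Nat.Coprime.mul_right ?_ ?_
    · exact (Nat.coprime_two_right.2 hodd).pow_right 2
    · rw [chi, if_pos hodd] at hm0
      by_contra hh
      have : jacobiSym c m0 = 0 := by
        rw [jacobiSym.eq_zero_iff]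
        refine ⟨by rintro rfl; simp at hodd, ?_⟩
        intro h; apply hh; rw [Nat.Coprime, Nat.gcd_comm]; exact_mod_cast h
      omega
  have hinj : Set.InjOn (fun m => (m * m0) % (4 * c)) (Finset.range (4 * c) : Set ℕ) := by
    intro x hx y hy hxy
    have h1 : x * m0 ≡ y * m0 [MOD 4 * c] := hxy
    have h2 := Nat.ModEq.cancel_right_of_coprime (by rw [Nat.gcd_comm]; exact hcop) h1
    exact Nat.ModEq.eq_of_lt_of_lt h2 (by simpa using hx) (by simpa using hy)
  have himg : (Finset.range (4 * c)).image (fun m => (m * m0) % (4 * c)) = Finset.range (4 * c) := by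
    apply Finset.eq_of_subset_of_card_le
    · intro x hx
      simp only [Finset.mem_image] at hx
      obtain ⟨y, _, rfl⟩ := hx
      exact Finset.mem_range.2 (Nat.mod_lt _ (by omega))
    · rw [Finset.card_image_of_injOn hinj]
  have key : ∑ m ∈ Finset.range (4 * c), chi c m = - ∑ m ∈ Finset.range (4 * c), chi c m := by
    conv_lhs => rw [← himg]
    rw [Finset.sum_image hinj, ← Finset.sum_neg_distrib]
    refine Finset.sum_congr rfl fun m _ => ?_
    have := chi_mod c (m * m0)
    rw [Int.natAbs_natCast] at this
    rw [this, chi_mul_right, hm0]; ring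
  omega

lemma chi_prefix (c : ℕ) (hc : ¬ IsSquare c) (k : ℕ) :
    |∑ m ∈ Finset.range k, chi c m| ≤ 4 * c := by
  have hc0 : 0 < c := Nat.pos_of_ne_zero (by rintro rfl; exact hc ⟨0, rfl⟩)
  have hper : ∀ q r, ∑ m ∈ Finset.range (4 * c * q + r), chi c m = ∑ m ∈ Finset.range r, chi c m := by
    intro q
    induction q with
    | zero => simp
    | succ q ih =>
      intro r
      have : 4 * c * (q + 1) + r = 4 * c + (4 * c * q + r) := by ring
      rw [this, Finset.sum_range_add, chi_sum_period c hc, zero_add, ← ih r]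
      refine Finset.sum_congr rfl fun m _ => ?_
      rw [← chi_mod, ← chi_mod c m]; simp
  rw [← Nat.div_add_mod k (4 * c), hper]
  calc |∑ m ∈ Finset.range (k % (4 * c)), chi c m| ≤ ∑ m ∈ Finset.range (k % (4 * c)), |chi c m| :=
        Finset.abs_sum_le_sum_abs _ _
    _ ≤ ∑ m ∈ Finset.range (k % (4 * c)), 1 := Finset.sum_le_sum fun m _ => chi_abs_le _ _
    _ = (k % (4 * c) : ℕ) := by simp
    _ ≤ 4 * c := by
      have : k % (4 * c) < 4 * c := Nat.mod_lt _ (by omega)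
      exact_mod_cast this.le

end PF

namespace PF

lemma abel_bound (f : ℕ → ℝ) (B : ℝ) (hB : ∀ k, |∑ m ∈ Finset.range k, f m| ≤ B) (u v : ℕ) :
    |∑ m ∈ Finset.Ioc u v, f m / m| ≤ 2 * B / (u + 1) := by
  have hB0 : 0 ≤ B := (abs_nonneg _).trans (hB 0)
  set S : ℕ → ℝ := fun k => ∑ m ∈ Finset.range k, f m with hS
  have key : ∀ k, |∑ m ∈ Finset.Ioc u (u + k), f m / m - S (u + k + 1) / ((u + k : ℕ) + 1 : ℝ)| ≤
      B / (u + 1) + B * (1 / (u + 1) - 1 / ((u + k : ℕ) + 1 : ℝ)) := by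
    intro k
    induction k with
    | zero =>
      simp only [add_zero, Finset.Ioc_self, Finset.sum_empty, zero_sub, abs_neg, sub_self, mul_zero]
      rw [abs_div, abs_of_pos (by positivity : (0 : ℝ) < (u : ℝ) + 1)]
      gcongr
      exact hB _
    | succ k ih =>
      have h1 : ∑ m ∈ Finset.Ioc u (u + (k + 1)), f m / m =
          ∑ m ∈ Finset.Ioc u (u + k), f m / m + f (u + k + 1) / ((u + k : ℕ) + 1 : ℝ) := by
        rw [← add_assoc, Finset.sum_Ioc_succ_top (by omega)]
        push_cast; rfl
      have h2 : f (u + k + 1) = S (u + k + 1 + 1) - S (u + k + 1) := by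
        simp only [hS]; rw [Finset.sum_range_succ _ (u + k + 1)]; ring
      set x : ℝ := ((u + k : ℕ) + 1 : ℝ) with hx
      have hx0 : 0 < x := by positivity
      have h3 : (((u + (k + 1) : ℕ) : ℝ) + 1) = x + 1 := by rw [hx]; push_cast; ring
      rw [h1, h3, h2]
      have h4 : ∑ m ∈ Finset.Ioc u (u + k), f m / m + (S (u + k + 1 + 1) - S (u + k + 1)) / x -
          S (u + (k + 1) + 1) / (x + 1) =
          (∑ m ∈ Finset.Ioc u (u + k), f m / m - S (u + k + 1) / x) +
            S (u + k + 1 + 1) * (1 / x - 1 / (x + 1)) := by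
        have : u + (k + 1) + 1 = u + k + 1 + 1 := by ring
        rw [this]; ring
      rw [h4]
      have h5 : 0 ≤ 1 / x - 1 / (x + 1) := by
        rw [sub_nonneg]; apply one_div_le_one_div_of_le hx0; linarith
      have h6 : |S (u + k + 1 + 1) * (1 / x - 1 / (x + 1))| ≤ B * (1 / x - 1 / (x + 1)) := by
        rw [abs_mul, abs_of_nonneg h5]; gcongr; exact hB _
      have := abs_add_le (∑ m ∈ Finset.Ioc u (u + k), f m / m - S (u + k + 1) / x)
        (S (u + k + 1 + 1) * (1 / x - 1 / (x + 1)))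
      linarith
  rcases le_or_gt u v with huv | huv
  · obtain ⟨k, rfl⟩ := Nat.exists_eq_add_of_le huv
    have h := key k
    set x : ℝ := ((u + k : ℕ) + 1 : ℝ) with hx
    have hx0 : 0 < x := by positivity
    have h7 : |S (u + k + 1) / x| ≤ B * (1 / x) := by
      rw [abs_div, abs_of_pos hx0, mul_one_div]; gcongr; exact hB _
    have h8 := abs_add_le (∑ m ∈ Finset.Ioc u (u + k), f m / m - S (u + k + 1) / x) (S (u + k + 1) / x)
    rw [sub_add_cancel] at h8
    have : 2 * B / ((u : ℝ) + 1) = B / (u + 1) + B * (1 / (u + 1)) := by ring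
    rw [this]; linarith
  · rw [Finset.Ioc_eq_empty (by omega)]; simp; positivity

lemma exists_lval (f : ℕ → ℝ) (B : ℝ) (hB : ∀ k, |∑ m ∈ Finset.range k, f m| ≤ B) :
    ∃ L : ℝ, ∀ X : ℕ, |L - ∑ m ∈ Finset.Ioc 0 X, f m / m| ≤ 2 * B / (X + 1) := by
  set s : ℕ → ℝ := fun X => ∑ m ∈ Finset.Ioc 0 X, f m / m with hs
  have hdiff : ∀ X Y, X ≤ Y → |s Y - s X| ≤ 2 * B / (X + 1) := by
    intro X Y h
    have : s Y - s X = ∑ m ∈ Finset.Ioc X Y, f m / m := by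
      simp only [hs]
      rw [← Finset.sum_Ioc_consecutive _ (Nat.zero_le X) h]; ring
    rw [this]; exact abel_bound f B hB X Y
  have hlim : Tendsto (fun X : ℕ => 2 * B / ((X : ℝ) + 1)) atTop (nhds 0) := by
    have := (tendsto_one_div_add_atTop_nhds_zero_nat (𝕜 := ℝ)).const_mul (2 * B)
    simpa [div_eq_mul_inv] using this
  have hc : CauchySeq s := by
    refine cauchySeq_of_le_tendsto_0 (fun X : ℕ => 2 * (2 * B / ((X : ℝ) + 1))) ?_ (by simpa using hlim.const_mul 2)
    intro n m N hn hm
    have h1 := hdiff N n hn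
    have h2 := hdiff N m hm
    rw [Real.dist_eq]
    have := abs_sub_le (s n) (s N) (s m)
    rw [abs_sub_comm (s N) (s m)] at this
    linarith
  obtain ⟨L, hL⟩ := cauchySeq_tendsto_of_complete hc
  refine ⟨L, fun X => ?_⟩
  have : Tendsto (fun Y => |s Y - s X|) atTop (nhds |L - s X|) := (hL.sub_const _).abs
  exact le_of_tendsto this (eventually_atTop.2 ⟨X, fun Y hY => hdiff X Y hY⟩)

lemma mates_double (a b : ℕ) (ha : 3 ≤ a) (hab : a < b) (h : IsSquare ((a ^ 2 - 4) * (b ^ 2 - 4))) :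
    2 * a ≤ b := by
  obtain ⟨s, hs⟩ := h
  have h1 : ((a : ℤ) ^ 2 - 4) * ((b : ℤ) ^ 2 - 4) = (s : ℤ) * s := by
    have h4 : 4 ≤ a ^ 2 := by nlinarith
    have h5 : 4 ≤ b ^ 2 := by nlinarith
    have := congrArg (Nat.cast : ℕ → ℤ) hs
    push_cast [h4, h5] at this
    exact this
  have ha' : (3 : ℤ) ≤ a := by exact_mod_cast ha
  have hab' : (a : ℤ) < b := by exact_mod_cast hab
  have hs0 : (0 : ℤ) ≤ s := by positivity
  by_contra hcon
  have hcon' : (b : ℤ) ≤ 2 * a - 1 := by push Not at hcon; omega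
  generalize (a : ℤ) = A at *
  generalize (b : ℤ) = B at *
  generalize (s : ℤ) = S at *
  have hAB : 9 ≤ A * B := by nlinarith
  have h2 : S < A * B - 4 := by
    by_contra hh
    push Not at hh
    have : (A * B - 4) * (A * B - 4) ≤ S * S := by nlinarith
    nlinarith [mul_pos (sub_pos.2 hab') (sub_pos.2 hab')]
  have h3 : S * S ≤ (A * B - 5) * (A * B - 5) := by nlinarith
  have h4 : 0 ≤ (2 * B - A) * (2 * B - 4 * A) + 9 := by nlinarith
  have h5 : (A + 2) * 2 ≤ (2 * B - A) * (4 * A - 2 * B) :=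
    mul_le_mul (by linarith) (by linarith) (by norm_num) (by linarith)
  nlinarith

lemma isSquare_of_mul_sq (x a : ℕ) (ha : a ≠ 0) (h : IsSquare (a ^ 2 * x)) : IsSquare x := by
  obtain ⟨s, hs⟩ := h
  have : a ^ 2 ∣ s ^ 2 := ⟨x, by rw [pow_two s, ← hs]⟩
  obtain ⟨k, rfl⟩ := (Nat.pow_dvd_pow_iff two_ne_zero).1 this
  refine ⟨k, ?_⟩
  have : a ^ 2 * x = a ^ 2 * (k * k) := by rw [hs]; ring
  exact Nat.eq_of_mul_eq_mul_left (by positivity) this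

lemma mates_card (N n : ℕ) (hn : 3 ≤ n) :
    ((Finset.Icc 3 N).filter (fun b => IsSquare ((n ^ 2 - 4) * (b ^ 2 - 4)))).card ≤ Nat.log 2 N + 1 := by
  rw [← Finset.card_range (Nat.log 2 N + 1)]
  apply Finset.card_le_card_of_injOn (fun b => Nat.log 2 b)
  · intro b hb
    simp only [Finset.coe_filter, Finset.mem_Icc, Set.mem_ofPred_eq] at hb
    simp only [Finset.coe_range, Set.mem_Iio]
    exact Nat.lt_succ_of_le (Nat.log_mono_right hb.1.2)
  · have main : ∀ b ∈ ((Finset.Icc 3 N).filter (fun b => IsSquare ((n ^ 2 - 4) * (b ^ 2 - 4)))),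
        ∀ b' ∈ ((Finset.Icc 3 N).filter (fun b => IsSquare ((n ^ 2 - 4) * (b ^ 2 - 4)))),
        b < b' → Nat.log 2 b < Nat.log 2 b' := by
      intro b hb b' hb' hlt
      simp only [Finset.mem_filter, Finset.mem_Icc] at hb hb'
      have h1 : IsSquare ((n ^ 2 - 4) ^ 2 * ((b ^ 2 - 4) * (b' ^ 2 - 4))) := by
        have := hb.2.mul hb'.2
        have e : (n ^ 2 - 4) * (b ^ 2 - 4) * ((n ^ 2 - 4) * (b' ^ 2 - 4)) =
          (n ^ 2 - 4) ^ 2 * ((b ^ 2 - 4) * (b' ^ 2 - 4)) := by ring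
        rwa [e] at this
      have h0 : n ^ 2 - 4 ≠ 0 := by
        have : 9 ≤ n ^ 2 := by nlinarith
        omega
      have h2 := isSquare_of_mul_sq _ _ h0 h1
      have h3 := mates_double b b' hb.1.1 hlt h2
      have h4 : Nat.log 2 (b * 2) = Nat.log 2 b + 1 := Nat.log_mul_base (by norm_num) (by omega)
      have h5 : Nat.log 2 (b * 2) ≤ Nat.log 2 b' := Nat.log_mono_right (by omega)
      omega
    intro b hb b' hb' h
    simp only at h
    rcases lt_trichotomy b b' with hl | hl | hl
    · have := main b hb b' hb' hl; omega
    · exact hl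
    · have := main b' hb' b hb hl; omega

/-- The quadratic character attached to `n² - 4`. -/
noncomputable def psi (n m : ℕ) : ℝ := (chi ((n ^ 2 - 4 : ℕ) : ℤ) m : ℝ)

lemma psi_mul (n a b : ℕ) : psi n (a * b) = psi n a * psi n b := by
  simp [psi, chi_mul_right]

lemma psi_abs_le (n m : ℕ) : |psi n m| ≤ 1 := by
  unfold psi; exact_mod_cast chi_abs_le _ m

lemma kernel_bound (c : ℕ) (hc : ¬ IsSquare c) (u v : ℕ) :
    |∑ m ∈ Finset.Ioc u v, (chi c m : ℝ) / m| ≤ 8 * c / (u + 1) := by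
  have := abel_bound (fun m => (chi c m : ℝ)) (4 * c) (fun k => by exact_mod_cast chi_prefix c hc k) u v
  refine this.trans (le_of_eq ?_); ring

lemma large_sieve (N M1 M2 : ℕ) (b : ℕ → ℝ) :
    ∑ n ∈ Finset.Icc 3 N, (∑ m ∈ Finset.Ioc M1 M2, b m * psi n m) ^ 2 ≤
      (∑ m ∈ Finset.Ioc M1 M2, m * b m ^ 2) *
      ((Nat.log 2 N + 1) * (∑ m ∈ Finset.Ioc M1 M2, (1 : ℝ) / m) + N * (8 * N ^ 4 / (M1 + 1))) := by
  set I := Finset.Icc 3 N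
  set J := Finset.Ioc M1 M2
  set x : ℕ → ℝ := fun n => ∑ m ∈ J, b m * psi n m with hx
  set H : ℝ := ∑ m ∈ J, (1 : ℝ) / m with hH
  set Δ : ℝ := (Nat.log 2 N + 1) * H + N * (8 * N ^ 4 / (M1 + 1)) with hΔ
  have hH0 : 0 ≤ H := Finset.sum_nonneg fun m _ => by positivity
  have hΔ0 : 0 ≤ Δ := by positivity
  set K : ℕ → ℕ → ℝ := fun n n' => ∑ m ∈ J, psi n m * psi n' m / m with hK
  have hKsym : ∀ n n', K n n' = K n' n := fun n n' => by
    simp only [hK]; exact Finset.sum_congr rfl fun m _ => by ring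
  have hrow : ∀ n ∈ I, ∑ n' ∈ I, |K n n'| ≤ Δ := by
    intro n hn
    have hnI := Finset.mem_Icc.1 hn
    rw [← Finset.sum_filter_add_sum_filter_not I (fun b => IsSquare ((n ^ 2 - 4) * (b ^ 2 - 4)))]
    apply add_le_add
    · calc _ ≤ ∑ n' ∈ I.filter (fun b => IsSquare ((n ^ 2 - 4) * (b ^ 2 - 4))), H := by
            apply Finset.sum_le_sum
            intro n' _
            refine (Finset.abs_sum_le_sum_abs _ _).trans ?_
            refine Finset.sum_le_sum fun m _ => ?_
            rw [abs_div, abs_mul, Nat.abs_cast]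
            gcongr
            have h1 := psi_abs_le n m
            have h2 := psi_abs_le n' m
            exact mul_le_one₀ h1 (abs_nonneg _) h2
        _ = ((I.filter (fun b => IsSquare ((n ^ 2 - 4) * (b ^ 2 - 4)))).card : ℝ) * H := by simp
        _ ≤ _ := by
            gcongr
            exact_mod_cast mates_card N n hnI.1
    · calc _ ≤ ∑ n' ∈ I.filter (fun b => ¬ IsSquare ((n ^ 2 - 4) * (b ^ 2 - 4))), (8 * (N : ℝ) ^ 4 / (M1 + 1)) := by
            apply Finset.sum_le_sum
            intro n' hn'
            rw [Finset.mem_filter] at hn'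
            have hn'I := Finset.mem_Icc.1 hn'.1
            have h1 := kernel_bound _ hn'.2 M1 M2
            have h2 : K n n' = ∑ m ∈ J, (chi (((n ^ 2 - 4) * (n' ^ 2 - 4) : ℕ) : ℤ) m : ℝ) / m := by
              simp only [hK]
              refine Finset.sum_congr rfl fun m _ => ?_
              rw [Nat.cast_mul, chi_mul_left]; simp [psi]
            rw [h2]
            refine h1.trans ?_
            gcongr
            have h3 : (n ^ 2 - 4) * (n' ^ 2 - 4) ≤ N ^ 2 * N ^ 2 := by
              apply Nat.mul_le_mul
              · exact (Nat.sub_le _ _).trans (Nat.pow_le_pow_left hnI.2 2)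
              · exact (Nat.sub_le _ _).trans (Nat.pow_le_pow_left hn'I.2 2)
            have h4 : (((n ^ 2 - 4) * (n' ^ 2 - 4) : ℕ) : ℝ) ≤ ((N ^ 2 * N ^ 2 : ℕ) : ℝ) := by exact_mod_cast h3
            refine h4.trans (le_of_eq ?_); push_cast; ring
        _ = ((I.filter (fun b => ¬ IsSquare ((n ^ 2 - 4) * (b ^ 2 - 4)))).card : ℝ) * (8 * (N : ℝ) ^ 4 / (M1 + 1)) := by simp
        _ ≤ _ := by
            gcongr
            refine (Finset.card_filter_le _ _).trans ?_
            simp [I]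
  set Q : ℝ := ∑ n ∈ I, x n ^ 2 with hQ
  have hQ0 : 0 ≤ Q := Finset.sum_nonneg fun n _ => sq_nonneg _
  set V : ℝ := ∑ m ∈ J, (m : ℝ) * b m ^ 2 with hV
  have hV0 : 0 ≤ V := Finset.sum_nonneg fun n _ => by positivity
  have h1 : Q = ∑ m ∈ J, (Real.sqrt m * b m) * ((∑ n ∈ I, x n * psi n m) / Real.sqrt m) := by
    have : Q = ∑ n ∈ I, x n * ∑ m ∈ J, b m * psi n m := Finset.sum_congr rfl fun n _ => by
      rw [pow_two]
    rw [this]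
    simp_rw [Finset.mul_sum]
    rw [Finset.sum_comm]
    refine Finset.sum_congr rfl fun m hm => ?_
    have hm0 : 0 < Real.sqrt m := by
      apply Real.sqrt_pos.2
      have := (Finset.mem_Ioc.1 hm).1
      exact_mod_cast (by omega : 0 < m)
    field_simp
    rw [Finset.mul_sum]
    exact Finset.sum_congr rfl fun n _ => by ring
  have h2 : Q ^ 2 ≤ V * ∑ m ∈ J, (∑ n ∈ I, x n * psi n m) ^ 2 / m := by
    rw [h1]
    refine (Finset.sum_mul_sq_le_sq_mul_sq _ _ _).trans (le_of_eq ?_)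
    congr 1
    · exact Finset.sum_congr rfl fun m _ => by rw [mul_pow, Real.sq_sqrt (by positivity)]
    · exact Finset.sum_congr rfl fun m _ => by rw [div_pow, Real.sq_sqrt (by positivity)]
  have h3 : ∑ m ∈ J, (∑ n ∈ I, x n * psi n m) ^ 2 / m = ∑ n ∈ I, ∑ n' ∈ I, x n * x n' * K n n' := by
    simp only [hK, Finset.mul_sum]
    have : ∀ m ∈ J, (∑ n ∈ I, x n * psi n m) ^ 2 / m =
        ∑ n ∈ I, ∑ n' ∈ I, x n * x n' * (psi n m * psi n' m / m) := by
      intro m _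
      rw [pow_two, Finset.sum_mul_sum, Finset.sum_div]
      refine Finset.sum_congr rfl fun n _ => ?_
      rw [Finset.sum_div]
      exact Finset.sum_congr rfl fun n' _ => by ring
    rw [Finset.sum_congr rfl this, Finset.sum_comm]
    refine Finset.sum_congr rfl fun n _ => ?_
    rw [Finset.sum_comm]
  have h4 : ∑ n ∈ I, ∑ n' ∈ I, x n * x n' * K n n' ≤ Q * Δ := by
    have e1 : ∀ n ∈ I, ∀ n' ∈ I, x n * x n' * K n n' ≤
        (x n ^ 2 * |K n n'|) / 2 + (x n' ^ 2 * |K n' n|) / 2 := by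
      intro n _ n' _
      rw [hKsym n' n]
      have a1 : x n * x n' * K n n' ≤ |x n * x n'| * |K n n'| := by
        rw [← abs_mul]; exact le_abs_self _
      have a2 : |x n * x n'| ≤ (x n ^ 2 + x n' ^ 2) / 2 := by
        rw [abs_le]; constructor <;> nlinarith [sq_nonneg (x n + x n'), sq_nonneg (x n - x n')]
      have a3 := mul_le_mul_of_nonneg_right a2 (abs_nonneg (K n n'))
      linarith
    have e2 : ∑ n ∈ I, ∑ n' ∈ I, x n ^ 2 * |K n n'| ≤ Q * Δ := by
      rw [hQ, Finset.sum_mul]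
      refine Finset.sum_le_sum fun n hn => ?_
      rw [← Finset.mul_sum]
      exact mul_le_mul_of_nonneg_left (hrow n hn) (sq_nonneg _)
    calc _ ≤ ∑ n ∈ I, ∑ n' ∈ I, ((x n ^ 2 * |K n n'|) / 2 + (x n' ^ 2 * |K n' n|) / 2) :=
          Finset.sum_le_sum fun n hn => Finset.sum_le_sum fun n' hn' => e1 n hn n' hn'
      _ = (∑ n ∈ I, ∑ n' ∈ I, x n ^ 2 * |K n n'|) / 2 + (∑ n ∈ I, ∑ n' ∈ I, x n' ^ 2 * |K n' n|) / 2 := by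
          simp only [Finset.sum_add_distrib, Finset.sum_div]
      _ = ∑ n ∈ I, ∑ n' ∈ I, x n ^ 2 * |K n n'| := by
          rw [Finset.sum_comm (f := fun n n' => x n' ^ 2 * |K n' n|)]; ring
      _ ≤ _ := e2
  have h5 : Q * Q ≤ Q * (V * Δ) := by
    calc Q * Q = Q ^ 2 := by ring
      _ ≤ V * (Q * Δ) := by
        refine h2.trans ?_
        rw [h3]; exact mul_le_mul_of_nonneg_left h4 hV0
      _ = _ := by ring
  rcases hQ0.eq_or_lt with h | h
  · rw [← h]; positivity
  · exact le_of_mul_le_mul_left h5 h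

end PF

namespace PF

lemma exists_pow_le_two_pow (k : ℕ) : ∃ C : ℕ, 1 ≤ C ∧ ∀ a : ℕ, (a + 1) ^ k ≤ C * 2 ^ a := by
  have h := tendsto_pow_const_div_const_pow_of_one_lt k (show (1 : ℝ) < 2 by norm_num)
  have h' : Tendsto (fun n : ℕ => (((n + 1 : ℕ) : ℝ)) ^ k / 2 ^ (n + 1)) atTop (nhds 0) :=
    h.comp (tendsto_add_atTop_nat 1)
  obtain ⟨B, hB⟩ := h'.bddAbove_range
  obtain ⟨C, hC⟩ := exists_nat_ge (2 * B)
  refine ⟨C + 1, by omega, fun a => ?_⟩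
  have h1 : (((a + 1 : ℕ) : ℝ)) ^ k / 2 ^ (a + 1) ≤ B := hB ⟨a, rfl⟩
  rw [div_le_iff₀ (by positivity), pow_succ] at h1
  have h2 : (((a + 1 : ℕ) : ℝ)) ^ k ≤ (C + 1) * 2 ^ a := by
    have : (0 : ℝ) < 2 ^ a := by positivity
    nlinarith
  exact_mod_cast h2

lemma divisor_pow_bound (k : ℕ) : ∃ C : ℕ, 1 ≤ C ∧ ∀ m : ℕ, m ≠ 0 → m.divisors.card ^ k ≤ C * m := by
  obtain ⟨C, hC1, hC⟩ := exists_pow_le_two_pow k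
  refine ⟨C ^ (2 ^ k), Nat.one_le_pow _ _ hC1, fun m hm => ?_⟩
  rw [Nat.card_divisors hm, ← Finset.prod_pow]
  have h1 : ∀ p ∈ m.primeFactors, (m.factorization p + 1) ^ k ≤
      (if p < 2 ^ k then C else 1) * p ^ m.factorization p := by
    intro p hp
    have hpp := Nat.prime_of_mem_primeFactors hp
    split_ifs with hlt
    · exact (hC _).trans (Nat.mul_le_mul_left _ (Nat.pow_le_pow_left hpp.two_le _))
    · rw [one_mul]
      push Not at hlt
      calc (m.factorization p + 1) ^ k ≤ (2 ^ m.factorization p) ^ k :=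
            Nat.pow_le_pow_left (Nat.lt_two_pow_self) k
        _ = (2 ^ k) ^ m.factorization p := by rw [← pow_mul, ← pow_mul, mul_comm]
        _ ≤ _ := Nat.pow_le_pow_left hlt _
  refine (Finset.prod_le_prod' h1).trans ?_
  rw [Finset.prod_mul_distrib]
  have h2 : ∏ p ∈ m.primeFactors, p ^ m.factorization p = m := Nat.prod_factorization_pow_eq_self hm
  rw [h2]
  apply Nat.mul_le_mul_right
  rw [← Finset.prod_filter, Finset.prod_const]
  apply Nat.pow_le_pow_right hC1
  calc _ ≤ (Finset.range (2 ^ k)).card := by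
        apply Finset.card_le_card
        intro p hp
        simp only [Finset.mem_filter] at hp
        exact Finset.mem_range.2 hp.2
    _ = _ := by simp

lemma divisor_bound (ε : ℝ) (hε : 0 < ε) : ∃ C : ℝ, 1 ≤ C ∧ ∀ m : ℕ, m ≠ 0 →
    (m.divisors.card : ℝ) ≤ C * (m : ℝ) ^ ε := by
  obtain ⟨k, hk⟩ := exists_nat_ge (1 / ε)
  have hk' : 0 < (k : ℝ) := lt_of_lt_of_le (by positivity) hk
  have hk0 : k ≠ 0 := by rintro rfl; simp at hk'
  obtain ⟨C, hC1, hC⟩ := divisor_pow_bound k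
  refine ⟨C, by exact_mod_cast hC1, fun m hm => ?_⟩
  have h1 : ((m.divisors.card : ℝ)) ^ k ≤ C * m := by exact_mod_cast hC m hm
  have hm1 : (1 : ℝ) ≤ m := by exact_mod_cast Nat.one_le_iff_ne_zero.2 hm
  have hC1' : (1 : ℝ) ≤ C := by exact_mod_cast hC1
  have h2 : (C : ℝ) * m ≤ (C * (m : ℝ) ^ ε) ^ k := by
    rw [mul_pow]
    apply mul_le_mul
    · exact le_self_pow₀ hC1' hk0
    · rw [← Real.rpow_natCast, ← Real.rpow_mul (by positivity)]
      conv_lhs => rw [← Real.rpow_one (m : ℝ)]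
      apply Real.rpow_le_rpow_of_exponent_le hm1
      rw [div_le_iff₀ hε] at hk; linarith
    · positivity
    · positivity
  exact le_of_pow_le_pow_left₀ hk0 (by positivity) (h1.trans h2)

/-- tail of the `L`-series -/
noncomputable def tailT (W X n : ℕ) : ℝ := ∑ q ∈ Finset.Ioc W X, psi n q / q

lemma tail_pow (W X k : ℕ) : ∃ b : ℕ → ℝ,
    (∀ m, 0 ≤ b m ∧ m * b m ≤ (m.divisors.card : ℝ) ^ k) ∧
    ∀ n, tailT W X n ^ k = ∑ m ∈ Finset.Icc ((W + 1) ^ k) (X ^ k), b m * psi n m := by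
  induction k with
  | zero =>
    refine ⟨fun m => if m = 1 then 1 else 0, fun m => ?_, fun n => ?_⟩
    · dsimp only
      split_ifs with h <;> simp [h]
    · simp [psi, chi_one]
  | succ k ih =>
    obtain ⟨b, hb, hT⟩ := ih
    set I := Finset.Icc ((W + 1) ^ k) (X ^ k)
    set J := Finset.Ioc W X
    set I' := Finset.Icc ((W + 1) ^ (k + 1)) (X ^ (k + 1))
    refine ⟨fun l => ∑ x ∈ (I ×ˢ J).filter (fun x => x.1 * x.2 = l), b x.1 / x.2, fun l => ⟨?_, ?_⟩, fun n => ?_⟩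
    · exact Finset.sum_nonneg fun x _ => div_nonneg (hb _).1 (by positivity)
    · rcases eq_or_ne l 0 with rfl | hl
      · simp
      rw [Finset.mul_sum]
      have h1 : ∀ x ∈ (I ×ˢ J).filter (fun x => x.1 * x.2 = l),
          (l : ℝ) * (b x.1 / x.2) ≤ (l.divisors.card : ℝ) ^ k := by
        intro x hx
        rw [Finset.mem_filter, Finset.mem_product] at hx
        have hx2 : (0 : ℝ) < x.2 := by
          have := (Finset.mem_Ioc.1 hx.1.2).1
          exact_mod_cast (by omega : 0 < x.2)
        have e : (l : ℝ) * (b x.1 / x.2) = x.1 * b x.1 := by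
          rw [← hx.2]; push_cast; field_simp
        rw [e]
        refine (hb x.1).2.trans ?_
        gcongr
        exact Dvd.intro _ hx.2
      refine (Finset.sum_le_card_nsmul _ _ _ h1).trans ?_
      rw [nsmul_eq_mul, pow_succ']
      gcongr
      apply Finset.card_le_card_of_injOn (fun x => x.1)
      · intro x hx
        simp only [Finset.coe_filter, Set.mem_ofPred_eq] at hx
        simp only [Finset.mem_coe, Nat.mem_divisors]
        exact ⟨Dvd.intro _ hx.2, hl⟩
      · intro x hx y hy hxy
        simp only [Finset.coe_filter, Set.mem_ofPred_eq] at hx hy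
        simp only at hxy
        have hx0 : 0 < x.1 := by
          rcases Nat.eq_zero_or_pos x.1 with h | h
          · exfalso; apply hl; rw [← hx.2, h, zero_mul]
          · exact h
        refine Prod.ext hxy ?_
        apply Nat.eq_of_mul_eq_mul_left hx0
        rw [hx.2, ← hy.2, hxy]
    · rw [pow_succ, hT n, tailT, Finset.sum_mul_sum, ← Finset.sum_product']
      have hmap : ∀ x ∈ I ×ˢ J, x.1 * x.2 ∈ I' := by
        intro x hx
        rw [Finset.mem_product, Finset.mem_Icc, Finset.mem_Ioc] at hx
        rw [Finset.mem_Icc, pow_succ, pow_succ]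
        exact ⟨Nat.mul_le_mul hx.1.1 hx.2.1, Nat.mul_le_mul hx.1.2 hx.2.2⟩
      rw [← Finset.sum_fiberwise_of_maps_to hmap]
      refine Finset.sum_congr rfl fun l _ => ?_
      rw [Finset.sum_mul]
      refine Finset.sum_congr rfl fun x hx => ?_
      rw [Finset.mem_filter] at hx
      rw [← hx.2, psi_mul]; ring

lemma sum_inv_le (M : ℕ) : ∑ m ∈ Finset.Icc 1 M, (1 : ℝ) / m ≤ 1 + Real.log M := by
  have := harmonic_le_one_add_log M
  rw [harmonic_eq_sum_Icc] at this
  push_cast at this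
  simpa using this

lemma log_le_rpow (ε : ℝ) (hε : 0 < ε) (x : ℝ) (hx : 1 ≤ x) : 1 + Real.log x ≤ (1 + 1 / ε) * x ^ ε := by
  have h1 := Real.log_le_rpow_div (by linarith : 0 ≤ x) hε
  have h2 : 1 ≤ x ^ ε := Real.one_le_rpow hx hε.le
  have : (1 + 1 / ε) * x ^ ε = x ^ ε + x ^ ε / ε := by ring
  linarith

lemma moment_bound (k : ℕ) (ε : ℝ) (hε : 0 < ε) : ∃ C : ℝ, 0 < C ∧ ∀ N W : ℕ, 1 ≤ N →
    N ^ 5 ≤ (W + 1) ^ k →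
    ∑ n ∈ Finset.Icc 3 N, (tailT W (N ^ 3) n) ^ (2 * k) ≤ C * (N : ℝ) ^ ε := by
  set η : ℝ := ε / (6 * k ^ 2 + 6 * k + 3) with hη
  have hden : (0 : ℝ) < 6 * k ^ 2 + 6 * k + 3 := by positivity
  have hη0 : 0 < η := by positivity
  obtain ⟨D, hD1, hD⟩ := divisor_bound η hη0
  set D' : ℝ := 1 + 1 / η with hD'
  have hD'1 : 1 ≤ D' := by rw [hD']; linarith [show 0 < 1 / η by positivity]
  refine ⟨D ^ (2 * k) * D' * (2 * D' * D' + 8), by positivity, fun N W hN hW => ?_⟩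
  obtain ⟨b, hb, hT⟩ := tail_pow W (N ^ 3) k
  have hN1 : (1 : ℝ) ≤ N := by exact_mod_cast hN
  set M2 := (N ^ 3) ^ k with hM2
  have hM1 : 1 ≤ (W + 1) ^ k := Nat.one_le_pow _ _ (by omega)
  have hM2' : 1 ≤ M2 := Nat.one_le_pow _ _ (Nat.one_le_pow _ _ hN)
  have hIcc : Finset.Icc ((W + 1) ^ k) M2 = Finset.Ioc ((W + 1) ^ k - 1) M2 := by
    ext m; simp only [Finset.mem_Icc, Finset.mem_Ioc]; omega
  have hsub : Finset.Ioc ((W + 1) ^ k - 1) M2 ⊆ Finset.Icc 1 M2 := by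
    intro m; simp only [Finset.mem_Icc, Finset.mem_Ioc]; omega
  have hls := large_sieve N ((W + 1) ^ k - 1) M2 b
  have e1 : ∀ n, (tailT W (N ^ 3) n) ^ (2 * k) = (∑ m ∈ Finset.Ioc ((W + 1) ^ k - 1) M2, b m * psi n m) ^ 2 := by
    intro n; rw [mul_comm, pow_mul, hT n, hIcc]
  simp_rw [e1]
  refine hls.trans ?_
  have hM2r : (M2 : ℝ) = (N : ℝ) ^ ((3 * k : ℕ) : ℝ) := by rw [hM2, Real.rpow_natCast]; push_cast; ring
  have hM2η : (M2 : ℝ) ^ η = (N : ℝ) ^ ((3 * k) * η) := by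
    rw [hM2r, ← Real.rpow_mul (by positivity)]; push_cast; rfl
  have hH : ∑ m ∈ Finset.Ioc ((W + 1) ^ k - 1) M2, (1 : ℝ) / m ≤ D' * (N : ℝ) ^ ((3 * k) * η) := by
    calc _ ≤ ∑ m ∈ Finset.Icc 1 M2, (1 : ℝ) / m :=
          Finset.sum_le_sum_of_subset_of_nonneg hsub fun _ _ _ => by positivity
      _ ≤ 1 + Real.log M2 := sum_inv_le M2
      _ ≤ D' * (M2 : ℝ) ^ η := log_le_rpow η hη0 _ (by exact_mod_cast hM2')
      _ = _ := by rw [hM2η]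
  have hV : ∑ m ∈ Finset.Ioc ((W + 1) ^ k - 1) M2, (m : ℝ) * b m ^ 2 ≤
      D ^ (2 * k) * (N : ℝ) ^ ((6 * k ^ 2) * η) * (D' * (N : ℝ) ^ ((3 * k) * η)) := by
    calc _ ≤ ∑ m ∈ Finset.Ioc ((W + 1) ^ k - 1) M2, D ^ (2 * k) * (N : ℝ) ^ ((6 * k ^ 2) * η) * (1 / m) := by
          refine Finset.sum_le_sum fun m hm => ?_
          have hm' := Finset.mem_Icc.1 (hsub hm)
          have hm0 : (0 : ℝ) < m := by exact_mod_cast hm'.1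
          have h1 : m * b m ≤ (D * (m : ℝ) ^ η) ^ k :=
            (hb m).2.trans (by gcongr; exact hD m (by omega))
          have h2 : (m : ℝ) * b m ^ 2 = (m * b m) ^ 2 * (1 / m) := by field_simp
          rw [h2]
          gcongr
          have h3 : 0 ≤ m * b m := mul_nonneg hm0.le (hb m).1
          calc (m * b m) ^ 2 ≤ ((D * (M2 : ℝ) ^ η) ^ k) ^ 2 := by
                gcongr
                refine h1.trans ?_
                gcongr
                exact hm'.2
            _ = D ^ (2 * k) * ((N : ℝ) ^ ((3 * k) * η)) ^ (2 * k) := by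
                rw [hM2η, ← pow_mul, mul_pow, mul_comm k 2]
            _ = _ := by
                rw [← Real.rpow_natCast ((N : ℝ) ^ ((3 * k) * η)), ← Real.rpow_mul (by positivity)]
                congr 2; push_cast; ring
      _ = D ^ (2 * k) * (N : ℝ) ^ ((6 * k ^ 2) * η) * ∑ m ∈ Finset.Ioc ((W + 1) ^ k - 1) M2, ((1 : ℝ) / m) := by
          rw [Finset.mul_sum]
      _ ≤ _ := by gcongr
  have hlog : ((Nat.log 2 N : ℕ) : ℝ) + 1 ≤ 2 * D' * (N : ℝ) ^ η := by
    have h1 : ((Nat.log 2 N : ℕ) : ℝ) ≤ Real.logb 2 N := Real.natLog_le_logb N 2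
    have h2 : Real.logb 2 N ≤ 2 * Real.log N := by
      rw [Real.logb, div_le_iff₀ (Real.log_pos (by norm_num))]
      have : Real.log 2 > 1 / 2 := by linarith [Real.log_two_gt_d9]
      nlinarith [Real.log_nonneg hN1]
    have h3 := log_le_rpow η hη0 N hN1
    rw [← hD'] at h3
    linarith
  have hE : (N : ℝ) * (8 * (N : ℝ) ^ 4 / (((W + 1) ^ k - 1 : ℕ) + 1)) ≤ 8 := by
    have : ((((W + 1) ^ k - 1 : ℕ) : ℝ) + 1) = ((W + 1 : ℕ) : ℝ) ^ k := by
      push_cast [hM1]; ring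
    rw [this, mul_div_assoc', div_le_iff₀ (by positivity)]
    have h5 : ((N : ℝ)) ^ 5 ≤ ((W + 1 : ℕ) : ℝ) ^ k := by exact_mod_cast hW
    nlinarith
  have hNp : ∀ x : ℝ, 0 ≤ x → 1 ≤ (N : ℝ) ^ x := fun x hx => Real.one_le_rpow hN1 hx
  have hΔ : ((Nat.log 2 N : ℕ) + 1 : ℝ) * (∑ m ∈ Finset.Ioc ((W + 1) ^ k - 1) M2, (1 : ℝ) / m) +
      N * (8 * (N : ℝ) ^ 4 / (((W + 1) ^ k - 1 : ℕ) + 1)) ≤ (2 * D' * D' + 8) * (N : ℝ) ^ ((3 * k + 1) * η) := by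
    have h1 : ((Nat.log 2 N : ℕ) + 1 : ℝ) * (∑ m ∈ Finset.Ioc ((W + 1) ^ k - 1) M2, (1 : ℝ) / m) ≤
        (2 * D' * (N : ℝ) ^ η) * (D' * (N : ℝ) ^ ((3 * k) * η)) := by
      gcongr
    have h2 : (2 * D' * (N : ℝ) ^ η) * (D' * (N : ℝ) ^ ((3 * k) * η)) = 2 * D' * D' * (N : ℝ) ^ ((3 * k + 1) * η) := by
      rw [show ((3 * k + 1) * η : ℝ) = η + 3 * k * η by ring, Real.rpow_add (by linarith)]; ring
    have h3 := hNp ((3 * k + 1) * η) (by positivity)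
    nlinarith
  calc _ ≤ (D ^ (2 * k) * (N : ℝ) ^ ((6 * k ^ 2) * η) * (D' * (N : ℝ) ^ ((3 * k) * η))) *
        ((2 * D' * D' + 8) * (N : ℝ) ^ ((3 * k + 1) * η)) := by
        apply mul_le_mul hV hΔ
        · positivity
        · positivity
    _ = D ^ (2 * k) * D' * (2 * D' * D' + 8) * (N : ℝ) ^ (6 * k ^ 2 * η + 3 * k * η + (3 * k + 1) * η) := by
        rw [Real.rpow_add (by linarith), Real.rpow_add (by linarith)]; ring
    _ ≤ _ := by
        gcongr
        · rw [hη]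
          have : 6 * (k : ℝ) ^ 2 * (ε / (6 * k ^ 2 + 6 * k + 3)) + 3 * k * (ε / (6 * k ^ 2 + 6 * k + 3)) +
            (3 * k + 1) * (ε / (6 * k ^ 2 + 6 * k + 3)) = ε * ((6 * k ^ 2 + 6 * k + 1) / (6 * k ^ 2 + 6 * k + 3)) := by
            field_simp; ring
          rw [this]
          apply mul_le_of_le_one_right hε.le
          rw [div_le_one hden]; linarith

end PF

namespace PF

/-- number of roots of `x² - n x + 1` modulo `q` -/
noncomputable def rho (n q : ℕ) : ℕ := Nat.card {x : ZMod q // x ^ 2 - n * x + 1 = 0}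

lemma fiber_card (q d : ℕ) [NeZero q] [NeZero d] (h : d ∣ q) (z : ZMod d) :
    (Finset.univ.filter (fun x : ZMod q => ZMod.castHom h (ZMod d) x = z)).card = q / d := by
  set φ := ZMod.castHom h (ZMod d)
  have hs : Function.Surjective φ := ZMod.castHom_surjective h
  have h1 : ∀ z' ∈ (Finset.univ : Finset (ZMod d)),
      (Finset.univ.filter (fun x : ZMod q => φ x = z')).card =
      (Finset.univ.filter (fun x : ZMod q => φ x = z)).card := by
    intro z' _
    obtain ⟨w, hw⟩ := hs (z - z')
    apply Finset.card_bij (fun x _ => x + w)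
    · intro x hx
      simp only [Finset.mem_filter, Finset.mem_univ, true_and] at hx ⊢
      rw [map_add, hx, hw]; ring
    · intro x _ y _ hxy
      exact add_right_cancel hxy
    · intro y hy
      simp only [Finset.mem_filter, Finset.mem_univ, true_and] at hy
      refine ⟨y - w, ?_, by ring⟩
      simp only [Finset.mem_filter, Finset.mem_univ, true_and]
      rw [map_sub, hy, hw]; ring
  have h2 := Finset.card_eq_sum_card_fiberwise (f := φ) (s := Finset.univ) (t := Finset.univ)
    (fun _ _ => Finset.mem_coe.2 (Finset.mem_univ _))
  rw [Finset.sum_congr rfl h1, Finset.sum_const, Finset.card_univ, Finset.card_univ, ZMod.card, ZMod.card] at h2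
  rw [smul_eq_mul] at h2
  exact (Nat.div_eq_of_eq_mul_right (NeZero.pos d) h2).symm

lemma rho_eq_card (n q : ℕ) [NeZero q] :
    rho n q = (Finset.univ.filter (fun x : ZMod q => x ^ 2 - n * x + 1 = 0)).card := by
  rw [rho, Nat.card_eq_fintype_card, Fintype.card_subtype]

lemma rho_le (n q : ℕ) (hq : q ≠ 0) : rho n q ≤ q := by
  have : NeZero q := ⟨hq⟩
  rw [rho_eq_card]
  exact (Finset.card_le_univ _).trans (by rw [ZMod.card])

lemma rho_one (n : ℕ) : rho n 1 = 1 := by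
  rw [rho, Nat.card_eq_one_iff_unique]
  exact ⟨⟨fun a b => Subsingleton.elim _ _⟩, ⟨⟨0, Subsingleton.elim _ _⟩⟩⟩

lemma rho_mul (n a b : ℕ) (h : a.Coprime b) : rho n (a * b) = rho n a * rho n b := by
  rw [rho, rho, rho, ← Nat.card_prod]
  let e := ZMod.chineseRemainder h
  have key : ∀ x : ZMod (a * b), x ^ 2 - n * x + 1 = 0 ↔
      ((e x).1 ^ 2 - n * (e x).1 + 1 = 0 ∧ (e x).2 ^ 2 - n * (e x).2 + 1 = 0) := by
    intro x
    rw [← e.map_eq_zero_iff, Prod.ext_iff]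
    simp
  refine Nat.card_congr ⟨fun x => (⟨(e x.1).1, ((key x.1).1 x.2).1⟩, ⟨(e x.1).2, ((key x.1).1 x.2).2⟩),
    fun y => ⟨e.symm (y.1.1, y.2.1), (key _).2 ?_⟩, fun x => ?_, fun y => ?_⟩
  · simp [y.1.2, y.2.2]
  · ext; simp
  · ext <;> simp

lemma rho_congr (n m q : ℕ) (h : n ≡ m [MOD q]) : rho n q = rho m q := by
  rw [rho, rho, (ZMod.natCast_eq_natCast_iff n m q).2 h]

lemma pow_dvd_or (p k : ℕ) (A B : ℤ) (hp : p.Prime) (h : (p : ℤ) ^ k ∣ A * B) :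
    (p : ℤ) ^ ((k + 1) / 2) ∣ A ∨ (p : ℤ) ^ ((k + 1) / 2) ∣ B := by
  have h' : p ^ k ∣ A.natAbs * B.natAbs := by
    rw [← Int.natAbs_mul]
    have := Int.natAbs_dvd_natAbs.2 h
    simpa [Int.natAbs_pow] using this
  obtain ⟨d1, d2, h1, h2, h3⟩ := exists_dvd_and_dvd_of_dvd_mul h'
  obtain ⟨i, _, rfl⟩ := (Nat.dvd_prime_pow hp).1 (⟨d2, h3⟩ : d1 ∣ p ^ k)
  obtain ⟨j, _, rfl⟩ := (Nat.dvd_prime_pow hp).1 (⟨p ^ i, by rw [h3, mul_comm]⟩ : d2 ∣ p ^ k)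
  rw [← pow_add] at h3
  have h4 := Nat.pow_right_injective hp.two_le h3
  have key : ∀ (C : ℤ) (l : ℕ), (k + 1) / 2 ≤ l → p ^ l ∣ C.natAbs → (p : ℤ) ^ ((k + 1) / 2) ∣ C := by
    intro C l hl hC
    have : (((p ^ ((k + 1) / 2) : ℕ)) : ℤ) ∣ C := Int.natCast_dvd.2 ((pow_dvd_pow p hl).trans hC)
    simpa using this
  rcases le_or_gt ((k + 1) / 2) i with hi | hi
  · exact Or.inl (key A i hi h1)
  · exact Or.inr (key B j (by omega) h2)

lemma rho_pow_le (n p k : ℕ) (hp : p.Prime) : rho n (p ^ k) ≤ 2 * p ^ (k / 2) := by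
  have : NeZero p := ⟨hp.ne_zero⟩
  set c := (k + 1) / 2 with hc
  have hck : c ≤ k := by omega
  have hdvd : p ^ c ∣ p ^ k := pow_dvd_pow p hck
  rw [rho_eq_card]
  by_cases hne : ∃ x0 : ZMod (p ^ k), x0 ^ 2 - n * x0 + 1 = 0
  · obtain ⟨x0, hx0⟩ := hne
    set φ := ZMod.castHom hdvd (ZMod (p ^ c)) with hφ
    have hsub : Finset.univ.filter (fun x : ZMod (p ^ k) => x ^ 2 - n * x + 1 = 0) ⊆
        Finset.univ.filter (fun x : ZMod (p ^ k) => φ x = φ x0) ∪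
        Finset.univ.filter (fun x : ZMod (p ^ k) => φ x = φ ((n : ZMod (p ^ k)) - x0)) := by
      intro x hx
      simp only [Finset.mem_filter, Finset.mem_univ, true_and, Finset.mem_union] at hx ⊢
      have h0 : (x - x0) * (x - (n - x0)) = 0 := by linear_combination hx - hx0
      obtain ⟨A, hA⟩ := ZMod.intCast_surjective (x - x0)
      obtain ⟨B, hB⟩ := ZMod.intCast_surjective (x - ((n : ZMod (p ^ k)) - x0))
      rw [← hA, ← hB, ← Int.cast_mul, ZMod.intCast_zmod_eq_zero_iff_dvd] at h0
      rcases pow_dvd_or p k A B hp (by exact_mod_cast h0) with h | h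
      · left
        have : φ (x - x0) = 0 := by
          rw [← hA, map_intCast, ZMod.intCast_zmod_eq_zero_iff_dvd]; exact_mod_cast h
        rwa [map_sub, sub_eq_zero] at this
      · right
        have : φ (x - ((n : ZMod (p ^ k)) - x0)) = 0 := by
          rw [← hB, map_intCast, ZMod.intCast_zmod_eq_zero_iff_dvd]; exact_mod_cast h
        rwa [map_sub, sub_eq_zero] at this
    refine (Finset.card_le_card hsub).trans ((Finset.card_union_le _ _).trans ?_)
    rw [fiber_card, fiber_card, Nat.pow_div hck hp.pos]
    rw [show k - c = k / 2 by omega]; omega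
  · push Not at hne
    rw [Finset.filter_false_of_mem (fun x _ => hne x)]; simp

lemma ker_sq (p k : ℕ) (hk : 1 ≤ k) (e : ZMod (p ^ (k + 1)))
    (he : ZMod.castHom (pow_dvd_pow p k.le_succ) (ZMod (p ^ k)) e = 0) : e ^ 2 = 0 := by
  obtain ⟨A, rfl⟩ := ZMod.intCast_surjective e
  rw [map_intCast, ZMod.intCast_zmod_eq_zero_iff_dvd] at he
  rw [← Int.cast_pow, ZMod.intCast_zmod_eq_zero_iff_dvd]
  have h1 := pow_dvd_pow_of_dvd he 2
  refine dvd_trans ?_ h1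
  push_cast
  rw [← pow_mul]
  exact pow_dvd_pow _ (by omega)

lemma rho_pow_succ (n p k : ℕ) (hn : 2 ≤ n) (hp : p.Prime) (hk : 1 ≤ k) (h2 : ¬ p ∣ 2 * (n ^ 2 - 4)) :
    rho n (p ^ (k + 1)) = rho n (p ^ k) := by
  have hδ : ∀ j, IsUnit ((n : ZMod (p ^ j)) ^ 2 - 4) := by
    intro j
    have h4 : 4 ≤ n ^ 2 := by nlinarith
    have : ((n : ZMod (p ^ j)) ^ 2 - 4) = ((n ^ 2 - 4 : ℕ) : ZMod (p ^ j)) := by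
      push_cast [h4]; ring
    rw [this, ZMod.isUnit_iff_coprime]
    apply Nat.Coprime.pow_right
    rw [Nat.coprime_comm, hp.coprime_iff_not_dvd]
    exact fun h => h2 (h.mul_left 2)
  set φ := ZMod.castHom (pow_dvd_pow p k.le_succ) (ZMod (p ^ k)) with hφ
  have hs : Function.Surjective φ := ZMod.castHom_surjective _
  have hun : ∀ u e : ZMod (p ^ (k + 1)), IsUnit u → e ^ 2 = 0 → IsUnit (u + e) := by
    intro u e hu he
    exact IsNilpotent.isUnit_add_left_of_commute ⟨2, he⟩ hu (Commute.all _ _)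
  have hsqu : ∀ w : ZMod (p ^ (k + 1)), (w ^ 2 - n * w + 1) ^ 2 = 0 → IsUnit (2 * w - n) := by
    intro w hw
    have : IsUnit ((2 * w - n) ^ 2) := by
      have e : (2 * w - n) ^ 2 = ((n : ZMod (p ^ (k + 1))) ^ 2 - 4) + 4 * (w ^ 2 - n * w + 1) := by ring
      rw [e]
      refine hun _ _ (hδ _) ?_
      rw [mul_pow, hw, mul_zero]
    exact (isUnit_pow_iff two_ne_zero).1 this
  rw [rho, rho]
  refine Nat.card_eq_of_bijective (fun x => ⟨φ x.1, ?_⟩) ⟨?_, ?_⟩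
  · have := congrArg φ x.2
    simpa using this
  · rintro ⟨x, hx⟩ ⟨y, hy⟩ hxy
    simp only [Subtype.mk.injEq] at hxy ⊢
    have he : (y - x) ^ 2 = 0 := ker_sq p k hk _ (by rw [← hφ, map_sub, hxy, sub_self])
    have hu : IsUnit ((2 * x - n) + (y - x)) := hun _ _ (hsqu x (by rw [hx]; ring)) he
    have h0 : ((2 * x - n) + (y - x)) * (x - y) = 0 := by linear_combination hx - hy
    exact sub_eq_zero.1 ((hu.mul_right_eq_zero).1 h0)
  · rintro ⟨z, hz⟩
    obtain ⟨w, rfl⟩ := hs z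
    have hker : φ (w ^ 2 - n * w + 1) = 0 := by simpa using hz
    have he := ker_sq p k hk _ hker
    obtain ⟨u, hu⟩ := (hsqu w he).exists_right_inv
    refine ⟨⟨w - (w ^ 2 - n * w + 1) * u, ?_⟩, ?_⟩
    · linear_combination (- (w ^ 2 - n * w + 1)) * hu + u ^ 2 * he
    · simp only [Subtype.mk.injEq]
      rw [map_sub, map_mul, hker]; ring

lemma rho_prime (n p : ℕ) (hn : 2 ≤ n) (hp : p.Prime) (h2 : ¬ p ∣ 2 * (n ^ 2 - 4)) :
    (rho n p : ℤ) = 1 + chi ((n ^ 2 - 4 : ℕ) : ℤ) p := by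
  have : Fact p.Prime := ⟨hp⟩
  have hp2 : p ≠ 2 := by rintro rfl; exact h2 (dvd_mul_right _ _)
  have hodd := hp.odd_of_ne_two hp2
  rw [chi, if_pos hodd, ← jacobiSym.legendreSym.to_jacobiSym, add_comm, ← legendreSym.card_sqrts p hp2, rho_eq_card]
  congr 1
  have h4 : 4 ≤ n ^ 2 := by nlinarith
  have h20 : (2 : ZMod p) ≠ 0 := by
    have : ((2 : ℕ) : ZMod p) ≠ 0 := by
      rw [Ne, ZMod.natCast_eq_zero_iff]
      intro h; exact hp2 ((Nat.prime_dvd_prime_iff_eq hp Nat.prime_two).1 h)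
    simpa using this
  apply Finset.card_bij (fun (x : ZMod p) _ => 2 * x - (n : ZMod p))
  · intro x hx
    simp only [Finset.mem_filter, Finset.mem_univ, true_and, Set.mem_toFinset, Set.mem_ofPred_eq] at hx ⊢
    push_cast [h4]
    linear_combination 4 * hx
  · intro x _ y _ hxy
    have : (2 : ZMod p) * (x - y) = 0 := by linear_combination hxy
    exact sub_eq_zero.1 ((mul_eq_zero.1 this).resolve_left h20)
  · intro y hy
    simp only [Set.mem_toFinset, Set.mem_ofPred_eq] at hy
    push_cast [h4] at hy
    refine ⟨(y + n) / 2, ?_, by field_simp; ring⟩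
    simp only [Finset.mem_filter, Finset.mem_univ, true_and]
    field_simp
    linear_combination hy

end PF

namespace PF

/-- `rho` as an arithmetic function -/
noncomputable def rhoA (n : ℕ) : ArithmeticFunction ℤ :=
  ⟨fun q => if q = 0 then 0 else (rho n q : ℤ), by simp⟩

lemma rhoA_apply (n q : ℕ) (hq : q ≠ 0) : rhoA n q = rho n q := if_neg hq

/-- `λ_n = liouville * ρ_n` -/
noncomputable def lam (n : ℕ) : ArithmeticFunction ℤ := ArithmeticFunction.liouville * rhoA n

lemma rhoA_mult (n : ℕ) : (rhoA n).IsMultiplicative := by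
  refine ⟨?_, ?_⟩
  · rw [rhoA_apply _ _ one_ne_zero, rho_one]; rfl
  · intro a b h
    rcases eq_or_ne a 0 with rfl | ha
    · simp
    rcases eq_or_ne b 0 with rfl | hb
    · simp
    rw [rhoA_apply _ _ (mul_ne_zero ha hb), rhoA_apply _ _ ha, rhoA_apply _ _ hb, rho_mul _ _ _ h]
    push_cast; rfl

lemma lam_mult (n : ℕ) : (lam n).IsMultiplicative :=
  ArithmeticFunction.isMultiplicative_liouville.mul (rhoA_mult n)

lemma lam_one (n : ℕ) : lam n 1 = 1 := (lam_mult n).1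

lemma lam_prime_pow (n p k : ℕ) (hp : p.Prime) :
    lam n (p ^ k) = ∑ i ∈ Finset.range (k + 1), (-1) ^ (k - i) * (rho n (p ^ i) : ℤ) := by
  rw [lam, ArithmeticFunction.mul_apply,
    Nat.sum_divisorsAntidiagonal' (fun a b => ArithmeticFunction.liouville a * rhoA n b),
    Nat.sum_divisors_prime_pow hp]
  apply Finset.sum_congr rfl
  intro i hi
  have hi' : i ≤ k := by simpa [Nat.lt_succ_iff] using hi
  rw [Nat.pow_div hi' hp.pos, ArithmeticFunction.liouville_apply (pow_ne_zero _ hp.ne_zero),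
    ArithmeticFunction.cardFactors_apply_prime_pow hp, rhoA_apply _ _ (pow_ne_zero _ hp.ne_zero)]

lemma lam_succ (n p k : ℕ) (hp : p.Prime) :
    lam n (p ^ (k + 1)) = rho n (p ^ (k + 1)) - lam n (p ^ k) := by
  rw [lam_prime_pow n p _ hp, Finset.sum_range_succ, lam_prime_pow n p _ hp]
  have : ∑ i ∈ Finset.range (k + 1), (-1) ^ (k + 1 - i) * (rho n (p ^ i) : ℤ) =
      - ∑ i ∈ Finset.range (k + 1), (-1) ^ (k - i) * (rho n (p ^ i) : ℤ) := by
    rw [← Finset.sum_neg_distrib]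
    apply Finset.sum_congr rfl
    intro i hi
    have hi' : i ≤ k := by simpa [Nat.lt_succ_iff] using hi
    rw [Nat.succ_sub hi', pow_succ]; ring
  rw [this]; simp; ring

lemma lam_pow_abs_le (n p k : ℕ) (hp : p.Prime) :
    |lam n (p ^ k)| ≤ (k + 1) * (2 * p ^ (k / 2)) := by
  rw [lam_prime_pow n p k hp]
  refine (Finset.abs_sum_le_sum_abs _ _).trans ?_
  have : ∀ i ∈ Finset.range (k + 1), |(-1) ^ (k - i) * (rho n (p ^ i) : ℤ)| ≤ 2 * p ^ (k / 2) := by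
    intro i hi
    have hi' : i ≤ k := by simpa [Nat.lt_succ_iff] using hi
    rw [abs_mul, abs_pow, abs_neg, abs_one, one_pow, one_mul, Nat.abs_cast]
    have h1 := rho_pow_le n p i hp
    have h2 : p ^ (i / 2) ≤ p ^ (k / 2) := Nat.pow_le_pow_right hp.pos (by omega)
    exact_mod_cast h1.trans (by omega)
  refine (Finset.sum_le_sum this).trans ?_
  rw [Finset.sum_const, Finset.card_range, nsmul_eq_mul]; push_cast; rfl

lemma lam_abs_le (n q : ℕ) : |lam n q| ≤ (q : ℤ) ^ 2 := by
  rcases eq_or_ne q 0 with rfl | hq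
  · simp
  rw [lam, ArithmeticFunction.mul_apply,
    Nat.sum_divisorsAntidiagonal' (fun a b => ArithmeticFunction.liouville a * rhoA n b)]
  refine (Finset.abs_sum_le_sum_abs _ _).trans ?_
  have : ∀ d ∈ q.divisors, |ArithmeticFunction.liouville (q / d) * rhoA n d| ≤ (q : ℤ) := by
    intro d hd
    have hd' := Nat.dvd_of_mem_divisors hd
    have hd0 : d ≠ 0 := by rintro rfl; exact hq (zero_dvd_iff.1 hd')
    have hqd : q / d ≠ 0 := (Nat.div_pos (Nat.le_of_dvd (by omega) hd') (by omega)).ne'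
    rw [abs_mul, ArithmeticFunction.liouville_apply hqd, abs_pow, abs_neg, abs_one, one_pow, one_mul,
      rhoA_apply _ _ hd0, Nat.abs_cast]
    exact_mod_cast (rho_le n d hd0).trans (Nat.le_of_dvd (by omega) hd')
  refine (Finset.sum_le_sum this).trans ?_
  rw [Finset.sum_const, nsmul_eq_mul, sq]
  have := Nat.card_divisors_le_self q
  gcongr

lemma lam_congr (n m q : ℕ) (h : n ≡ m [MOD q]) : lam n q = lam m q := by
  rw [lam, lam, ArithmeticFunction.mul_apply, ArithmeticFunction.mul_apply]
  apply Finset.sum_congr rfl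
  intro x hx
  rw [Nat.mem_divisorsAntidiagonal] at hx
  have : x.2 ≠ 0 := by rintro h0; rw [h0] at hx; exact hx.2 (by rw [← hx.1]; simp)
  rw [rhoA_apply _ _ this, rhoA_apply _ _ this]
  rw [rho_congr n m x.2 (h.of_dvd ⟨x.1, by rw [← hx.1]; ring⟩)]

lemma lam_good (n p k : ℕ) (hn : 2 ≤ n) (hp : p.Prime) (h2 : ¬ p ∣ 2 * (n ^ 2 - 4)) :
    lam n (p ^ k) = chi ((n ^ 2 - 4 : ℕ) : ℤ) p ^ k := by
  have hr : ∀ k, 1 ≤ k → (rho n (p ^ k) : ℤ) = 1 + chi ((n ^ 2 - 4 : ℕ) : ℤ) p := by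
    intro k hk
    induction k, hk using Nat.le_induction with
    | base => rw [pow_one, rho_prime n p hn hp h2]
    | succ k hk ih => rw [rho_pow_succ n p k hn hp hk h2, ih]
  have hchi : chi ((n ^ 2 - 4 : ℕ) : ℤ) p = 1 ∨ chi ((n ^ 2 - 4 : ℕ) : ℤ) p = -1 := by
    have hp2 : p ≠ 2 := by rintro rfl; exact h2 (dvd_mul_right _ _)
    rw [chi, if_pos (hp.odd_of_ne_two hp2)]
    apply jacobiSym.eq_one_or_neg_one
    rw [Int.gcd_natCast_natCast]
    rw [← Nat.coprime_iff_gcd_eq_one, Nat.coprime_comm, hp.coprime_iff_not_dvd]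
    exact fun h => h2 (h.mul_left 2)
  induction k with
  | zero => simp [lam_one]
  | succ k ih =>
    rw [lam_succ n p k hp, hr (k + 1) (by omega), ih]
    rcases hchi with h | h <;> rw [h]
    · simp
    · rw [pow_succ]; ring

open Classical in
/-- part of `lam` supported on integers all of whose prime factors divide `2(n²-4)` -/
noncomputable def lam1 (n : ℕ) : ArithmeticFunction ℤ :=
  ⟨fun q => if q ≠ 0 ∧ ∀ p, p.Prime → p ∣ q → p ∣ 2 * (n ^ 2 - 4) then lam n q else 0, by simp⟩

open Classical in
lemma lam1_apply (n q : ℕ) : lam1 n q =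
  if q ≠ 0 ∧ ∀ p, p.Prime → p ∣ q → p ∣ 2 * (n ^ 2 - 4) then lam n q else 0 := rfl

lemma lam1_abs_le (n q : ℕ) : |lam1 n q| ≤ |lam n q| := by
  rw [lam1_apply]; split_ifs <;> simp

lemma lam1_mult (n : ℕ) : (lam1 n).IsMultiplicative := by
  refine ⟨?_, ?_⟩
  · rw [lam1_apply, if_pos, lam_one]
    refine ⟨one_ne_zero, fun p hp h => ?_⟩
    exact absurd (Nat.dvd_one.1 h) hp.one_lt.ne'
  · intro a b h
    rcases eq_or_ne a 0 with rfl | ha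
    · simp
    rcases eq_or_ne b 0 with rfl | hb
    · simp
    rw [lam1_apply, lam1_apply, lam1_apply]
    by_cases h1 : ∀ p, p.Prime → p ∣ a → p ∣ 2 * (n ^ 2 - 4)
    · by_cases h2 : ∀ p, p.Prime → p ∣ b → p ∣ 2 * (n ^ 2 - 4)
      · rw [if_pos, if_pos ⟨ha, h1⟩, if_pos ⟨hb, h2⟩, (lam_mult n).map_mul_of_coprime h]
        refine ⟨mul_ne_zero ha hb, fun p hp hd => ?_⟩
        rcases (hp.dvd_mul).1 hd with hd | hd
        · exact h1 p hp hd
        · exact h2 p hp hd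
      · rw [if_neg, if_neg (c := b ≠ 0 ∧ _), mul_zero]
        · exact fun h => h2 h.2
        · exact fun h => h2 fun p hp hd => h.2 p hp (hd.mul_left a)
    · rw [if_neg, if_neg (c := a ≠ 0 ∧ _), zero_mul]
      · exact fun h => h1 h.2
      · exact fun h => h1 fun p hp hd => h.2 p hp (hd.mul_right b)

/-- the character as an arithmetic function -/
noncomputable def psiA (n : ℕ) : ArithmeticFunction ℤ :=
  ⟨fun m => chi ((n ^ 2 - 4 : ℕ) : ℤ) m, chi_zero _⟩

lemma psiA_apply (n m : ℕ) : psiA n m = chi ((n ^ 2 - 4 : ℕ) : ℤ) m := rfl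

lemma psiA_cast (n m : ℕ) : ((psiA n m : ℤ) : ℝ) = psi n m := rfl

lemma psiA_mult (n : ℕ) : (psiA n).IsMultiplicative :=
  ⟨chi_one _, fun {a b} _ => chi_mul_right _ a b⟩

lemma psiA_pow (n p k : ℕ) : psiA n (p ^ k) = psiA n p ^ k := by
  induction k with
  | zero => simp [psiA_apply, chi_one]
  | succ k ih => rw [pow_succ, pow_succ, ← ih, psiA_apply, chi_mul_right]; rfl

lemma lam_eq (n : ℕ) (hn : 2 ≤ n) : lam n = lam1 n * psiA n := by
  rw [((lam_mult n).eq_iff_eq_on_prime_powers _ _ ((lam1_mult n).mul (psiA_mult n)))]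
  intro p k hp
  rw [ArithmeticFunction.mul_apply, Nat.sum_divisorsAntidiagonal (fun a b => lam1 n a * psiA n b),
    Nat.sum_divisors_prime_pow hp]
  have hpk : ∀ i, p ^ i ≠ 0 := fun i => pow_ne_zero _ hp.ne_zero
  by_cases h2 : p ∣ 2 * (n ^ 2 - 4)
  · rw [Finset.sum_eq_single k]
    · rw [Nat.div_self (Nat.pos_of_ne_zero (hpk k)), (psiA_mult n).1, mul_one, lam1_apply, if_pos]
      exact ⟨hpk k, fun r hr hd => by rwa [(Nat.prime_dvd_prime_iff_eq hr hp).1 (hr.dvd_of_dvd_pow hd)]⟩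
    · intro i hi hne
      have hi' : i ≤ k := by simpa [Nat.lt_succ_iff] using hi
      rw [Nat.pow_div hi' hp.pos, psiA_pow]
      have : psiA n p = 0 := by
        rw [psiA_apply, chi]
        split_ifs with ho
        · rw [jacobiSym.eq_zero_iff]
          refine ⟨hp.ne_zero, ?_⟩
          rw [Int.gcd_natCast_natCast]
          have hd : p ∣ n ^ 2 - 4 := by
            rcases (hp.dvd_mul).1 h2 with h | h
            · rw [(Nat.prime_dvd_prime_iff_eq hp Nat.prime_two).1 h] at ho
              exact absurd ho (by decide)
            · exact h
          rw [Nat.gcd_eq_right hd]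
          exact hp.one_lt.ne'
        · rfl
      rw [this, zero_pow (by omega), mul_zero]
    · intro h; simp at h
  · rw [Finset.sum_eq_single 0]
    · rw [pow_zero, (lam1_mult n).1, one_mul, Nat.div_one, psiA_pow, lam_good n p k hn hp h2]; rfl
    · intro i hi hne
      rw [lam1_apply, if_neg, zero_mul]
      exact fun h => h2 (h.2 p hp (dvd_pow_self p hne))
    · intro h; simp at h

open Classical in
/-- indicator of nonzero squares -/
noncomputable def sqA : ArithmeticFunction ℤ := ⟨fun m => if m ≠ 0 ∧ IsSquare m then 1 else 0, by simp⟩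

open Classical in
lemma sqA_apply (m : ℕ) : sqA m = if m ≠ 0 ∧ IsSquare m then 1 else 0 := rfl

lemma sqA_mult : sqA.IsMultiplicative := by
  refine ⟨by rw [sqA_apply, if_pos ⟨one_ne_zero, ⟨1, rfl⟩⟩], ?_⟩
  intro a b h
  rcases eq_or_ne a 0 with rfl | ha
  · simp
  rcases eq_or_ne b 0 with rfl | hb
  · simp
  rw [sqA_apply, sqA_apply, sqA_apply]
  have key : IsSquare (a * b) ↔ IsSquare a ∧ IsSquare b := by
    constructor
    · rintro ⟨c, hc⟩
      rw [← sq] at hc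
      have hu : IsUnit (gcd a b) := by
        rw [Nat.isUnit_iff]; exact h
      have hu' : IsUnit (gcd b a) := by
        rw [Nat.isUnit_iff]; exact h.symm
      obtain ⟨d, hd⟩ := exists_eq_pow_of_mul_eq_pow hu hc
      obtain ⟨e, he⟩ := exists_eq_pow_of_mul_eq_pow hu' ((mul_comm b a).trans hc)
      exact ⟨⟨d, by rw [hd, sq]⟩, ⟨e, by rw [he, sq]⟩⟩
    · rintro ⟨h1, h2⟩; exact h1.mul h2
  by_cases h1 : IsSquare a <;> by_cases h2 : IsSquare b <;> simp [ha, hb, h1, h2, key]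

lemma zeta_liouville : (ArithmeticFunction.zeta : ArithmeticFunction ℤ) * ArithmeticFunction.liouville = sqA := by
  rw [(ArithmeticFunction.isMultiplicative_zeta.natCast.mul
    ArithmeticFunction.isMultiplicative_liouville).eq_iff_eq_on_prime_powers _ _ sqA_mult]
  intro p k hp
  rw [ArithmeticFunction.coe_zeta_mul_apply, Nat.sum_divisors_prime_pow hp]
  have h1 : ∀ i ∈ Finset.range (k + 1), ArithmeticFunction.liouville (p ^ i) = (-1) ^ i := by
    intro i _
    rw [ArithmeticFunction.liouville_apply (pow_ne_zero _ hp.ne_zero), ArithmeticFunction.cardFactors_apply_prime_pow hp]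
  rw [Finset.sum_congr rfl h1, neg_one_geom_sum, sqA_apply]
  have h2 : IsSquare (p ^ k) ↔ Even k := by
    constructor
    · rintro ⟨c, hc⟩
      obtain ⟨i, _, rfl⟩ := (Nat.dvd_prime_pow hp).1 (⟨c, hc⟩ : c ∣ p ^ k)
      rw [← pow_add] at hc
      exact ⟨i, Nat.pow_right_injective hp.two_le hc⟩
    · rintro ⟨i, rfl⟩; exact ⟨p ^ i, by rw [pow_add]⟩
  by_cases hk : Even k
  · simp [hk, h2, hp.ne_zero, Nat.even_add_one]
  · simp [hk, h2, Nat.even_add_one]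

lemma zeta_lam (n : ℕ) : (ArithmeticFunction.zeta : ArithmeticFunction ℤ) * lam n = sqA * rhoA n := by
  rw [lam, ← mul_assoc, zeta_liouville]

end PF

namespace PF

/-- Rankin weight -/
noncomputable def rw1 (n q : ℕ) : ℝ := |(lam1 n q : ℝ)| * (q : ℝ) ^ (-(3 / 4 : ℝ))

lemma rw1_nonneg (n q : ℕ) : 0 ≤ rw1 n q := by unfold rw1; positivity

/-- majorant series -/
noncomputable def maj (k : ℕ) : ℝ := 2 * (k + 1) * ((2 : ℝ) ^ (-(1 / 4 : ℝ))) ^ k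

lemma maj_summable : Summable maj := by
  have h1 : ‖(2 : ℝ) ^ (-(1 / 4 : ℝ))‖ < 1 := by
    rw [Real.norm_of_nonneg (by positivity)]
    exact Real.rpow_lt_one_of_one_lt_of_neg (by norm_num) (by norm_num)
  have h2 := summable_pow_mul_geometric_of_norm_lt_one 1 h1
  have h3 := summable_geometric_of_norm_lt_one h1
  refine ((h2.add h3).mul_left 2).congr fun k => ?_
  unfold maj; ring

lemma rw1_pow_le (n p k : ℕ) (hp : p.Prime) : rw1 n (p ^ k) ≤ maj k := by
  have hp1 : (1 : ℝ) ≤ p := by exact_mod_cast hp.one_lt.le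
  have hp2 : (2 : ℝ) ≤ p := by exact_mod_cast hp.two_le
  have h1 : |(lam1 n (p ^ k) : ℝ)| ≤ (k + 1) * (2 * (p : ℝ) ^ (k / 2)) := by
    have := (lam1_abs_le n (p ^ k)).trans (lam_pow_abs_le n p k hp)
    exact_mod_cast this
  have h2 : (p : ℝ) ^ (k / 2) ≤ (p : ℝ) ^ ((k : ℝ) / 2) := by
    rw [← Real.rpow_natCast]
    apply Real.rpow_le_rpow_of_exponent_le hp1
    rw [le_div_iff₀ (by norm_num)]
    exact_mod_cast Nat.div_mul_le_self k 2
  unfold rw1 maj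
  have e : ((p ^ k : ℕ) : ℝ) ^ (-(3 / 4 : ℝ)) = (p : ℝ) ^ (-(3 / 4 : ℝ) * k) := by
    push_cast
    rw [← Real.rpow_natCast, ← Real.rpow_mul (by positivity)]; ring_nf
  rw [e]
  calc _ ≤ ((k + 1) * (2 * (p : ℝ) ^ ((k : ℝ) / 2))) * (p : ℝ) ^ (-(3 / 4 : ℝ) * k) := by
        gcongr; exact h1.trans (by gcongr)
    _ = 2 * (k + 1) * (p : ℝ) ^ (-(1 / 4 : ℝ) * k) := by
        rw [show (-(1 / 4 : ℝ) * k) = (k : ℝ) / 2 + (-(3 / 4 : ℝ) * k) by ring, Real.rpow_add (by positivity)]; ring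
    _ = 2 * (k + 1) * ((p : ℝ) ^ (-(1 / 4 : ℝ))) ^ k := by
        rw [Real.rpow_mul (by positivity), Real.rpow_natCast]
    _ ≤ _ := by
        have := Real.rpow_le_rpow_of_nonpos (by norm_num) hp2 (by norm_num : -(1 / 4 : ℝ) ≤ 0)
        gcongr

lemma rw1_sum (n : ℕ) (hn : 3 ≤ n) : Summable (rw1 n) ∧
    ∑' q, rw1 n q ≤ (∑' k, maj k) ^ (2 * (n ^ 2 - 4)).primeFactors.card := by
  have hm0 : 2 * (n ^ 2 - 4) ≠ 0 := by
    have : 9 ≤ n ^ 2 := by nlinarith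
    omega
  have hsum : ∀ {p : ℕ}, p.Prime → Summable (fun k : ℕ => ‖rw1 n (p ^ k)‖) := by
    intro p hp
    refine Summable.of_nonneg_of_le (fun k => norm_nonneg _) (fun k => ?_) maj_summable
    rw [Real.norm_of_nonneg (rw1_nonneg _ _)]
    exact rw1_pow_le n p k hp
  have h := EulerProduct.summable_and_hasSum_factoredNumbers_prod_filter_prime_tsum (f := rw1 n)
    (by simp [rw1, (lam1_mult n).1]) (by
      intro a b hab
      simp only [rw1]
      rw [(lam1_mult n).map_mul_of_coprime hab]
      push_cast
      rw [abs_mul, Real.mul_rpow (by positivity) (by positivity)]; ring) hsum (2 * (n ^ 2 - 4)).primeFactors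
  have hsupp : Function.support (rw1 n) ⊆ Nat.factoredNumbers (2 * (n ^ 2 - 4)).primeFactors := by
    intro q hq
    rw [Function.mem_support] at hq
    have h1 : lam1 n q ≠ 0 := by
      intro h0; apply hq; simp [rw1, h0]
    rw [lam1_apply] at h1
    split_ifs at h1 with h2
    · rw [Nat.mem_factoredNumbers']
      intro p hp hd
      rw [Nat.mem_primeFactors]
      exact ⟨hp, h2.2 p hp hd, hm0⟩
    · exact absurd rfl h1
  have hs := (hasSum_subtype_iff_of_support_subset hsupp).1 h.2
  refine ⟨hs.summable, ?_⟩
  rw [hs.tsum_eq, Finset.filter_true_of_mem (fun p hp => (Nat.mem_primeFactors.1 hp).1), ← Finset.prod_const]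
  apply Finset.prod_le_prod
  · intro p _; exact tsum_nonneg fun k => rw1_nonneg _ _
  · intro p hp
    have hp' := (Nat.mem_primeFactors.1 hp).1
    exact Summable.tsum_le_tsum (fun k => rw1_pow_le n p k hp') (by simpa using (hsum hp').of_norm) maj_summable

lemma two_pow_omega_le (m : ℕ) (hm : m ≠ 0) : 2 ^ m.primeFactors.card ≤ m.divisors.card := by
  rw [Nat.card_divisors hm, ← Finset.prod_const]
  apply Finset.prod_le_prod' 
  intro p hp
  have := Nat.mem_primeFactors.1 hp
  have h1 := this.1.factorization_pos_of_dvd hm this.2.1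
  omega

lemma rankin (ε : ℝ) (hε : 0 < ε) : ∃ C : ℝ, 1 ≤ C ∧ ∀ n N : ℕ, 3 ≤ n → n ≤ N →
    Summable (rw1 n) ∧ ∑' q, rw1 n q ≤ C * (N : ℝ) ^ ε := by
  obtain ⟨a, ha⟩ := pow_unbounded_of_one_lt (∑' k, maj k) (one_lt_two)
  set η := ε / (3 * (a + 1)) with hη
  have hη0 : 0 < η := by positivity
  obtain ⟨C, hC1, hC⟩ := divisor_bound η hη0
  refine ⟨C ^ a, one_le_pow₀ hC1, fun n N hn hN => ⟨(rw1_sum n hn).1, (rw1_sum n hn).2.trans ?_⟩⟩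
  set m := 2 * (n ^ 2 - 4) with hmdef
  have hm0 : m ≠ 0 := by
    have : 9 ≤ n ^ 2 := by nlinarith
    omega
  have hmaj0 : 0 ≤ ∑' k, maj k := tsum_nonneg fun k => by unfold maj; positivity
  have hN1 : (1 : ℝ) ≤ N := by exact_mod_cast (by omega : 1 ≤ N)
  have hmN : (m : ℝ) ≤ (N : ℝ) ^ 3 := by
    have h1 : n ^ 2 ≤ N ^ 2 := Nat.pow_le_pow_left hN 2
    have h2 : m ≤ N ^ 3 := by
      have : 2 * N ^ 2 ≤ N ^ 3 := by nlinarith [Nat.zero_le (N ^ 2)]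
      omega
    exact_mod_cast h2
  calc (∑' k, maj k) ^ m.primeFactors.card ≤ ((2 : ℝ) ^ a) ^ m.primeFactors.card := by gcongr
    _ = ((2 : ℝ) ^ m.primeFactors.card) ^ a := by rw [← pow_mul, ← pow_mul, mul_comm]
    _ ≤ ((m.divisors.card : ℝ)) ^ a := by
        gcongr; exact_mod_cast two_pow_omega_le m hm0
    _ ≤ (C * (m : ℝ) ^ η) ^ a := by gcongr; exact hC m hm0
    _ = C ^ a * (m : ℝ) ^ (η * a) := by
        rw [mul_pow, Real.rpow_mul (by positivity), Real.rpow_natCast]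
    _ ≤ C ^ a * ((N : ℝ) ^ 3) ^ (η * a) := by gcongr
    _ = C ^ a * (N : ℝ) ^ (3 * (η * a)) := by
        rw [← Real.rpow_natCast (N : ℝ) 3, ← Real.rpow_mul (by positivity)]; norm_num
    _ ≤ _ := by
        gcongr
        · rw [hη]
          have : 3 * (ε / (3 * (a + 1)) * a) = ε * (a / (a + 1)) := by field_simp
          rw [this]
          apply mul_le_of_le_one_right hε.le
          rw [div_le_one (by positivity)]; linarith

end PF

namespace PF

lemma abel_gen (f : ℕ → ℝ) (B : ℝ) (hB : ∀ k, |∑ m ∈ Finset.range k, f m| ≤ B) (w : ℕ → ℝ)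
    (hw : ∀ m, 1 ≤ m → w (m + 1) ≤ w m) (hw0 : ∀ m, 0 ≤ w m) (u v : ℕ) :
    |∑ m ∈ Finset.Ioc u v, f m * w m| ≤ 2 * B * w (u + 1) := by
  have hB0 : 0 ≤ B := (abs_nonneg _).trans (hB 0)
  set S : ℕ → ℝ := fun k => ∑ m ∈ Finset.range k, f m with hS
  have key : ∀ k, |∑ m ∈ Finset.Ioc u (u + k), f m * w m - S (u + k + 1) * w (u + k + 1)| ≤
      B * w (u + 1) + B * (w (u + 1) - w (u + k + 1)) := by
    intro k
    induction k with
    | zero =>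
      simp only [add_zero, Finset.Ioc_self, Finset.sum_empty, zero_sub, abs_neg, sub_self, mul_zero]
      rw [abs_mul, abs_of_nonneg (hw0 _)]
      exact mul_le_mul_of_nonneg_right (hB _) (hw0 _)
    | succ k ih =>
      have h1 : ∑ m ∈ Finset.Ioc u (u + (k + 1)), f m * w m =
          ∑ m ∈ Finset.Ioc u (u + k), f m * w m + f (u + k + 1) * w (u + k + 1) := by
        rw [← add_assoc, Finset.sum_Ioc_succ_top (by omega)]
      have h2 : f (u + k + 1) = S (u + k + 1 + 1) - S (u + k + 1) := by
        simp only [hS]; rw [Finset.sum_range_succ _ (u + k + 1)]; ring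
      rw [h1, h2, show u + (k + 1) + 1 = u + k + 1 + 1 by ring]
      have h5 : 0 ≤ w (u + k + 1) - w (u + k + 1 + 1) := sub_nonneg.2 (hw _ (by omega))
      have h6 : |S (u + k + 1 + 1) * (w (u + k + 1) - w (u + k + 1 + 1))| ≤
          B * (w (u + k + 1) - w (u + k + 1 + 1)) := by
        rw [abs_mul, abs_of_nonneg h5]; exact mul_le_mul_of_nonneg_right (hB _) h5
      have h7 := abs_add_le (∑ m ∈ Finset.Ioc u (u + k), f m * w m - S (u + k + 1) * w (u + k + 1))
        (S (u + k + 1 + 1) * (w (u + k + 1) - w (u + k + 1 + 1)))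
      refine le_trans (le_of_eq (congrArg _ ?_)) (h7.trans ?_)
      · ring
      · linarith
  rcases le_or_gt u v with huv | huv
  · obtain ⟨k, rfl⟩ := Nat.exists_eq_add_of_le huv
    have h := key k
    have h7 : |S (u + k + 1) * w (u + k + 1)| ≤ B * w (u + k + 1) := by
      rw [abs_mul, abs_of_nonneg (hw0 _)]; exact mul_le_mul_of_nonneg_right (hB _) (hw0 _)
    have h8 := abs_add_le (∑ m ∈ Finset.Ioc u (u + k), f m * w m - S (u + k + 1) * w (u + k + 1))
      (S (u + k + 1) * w (u + k + 1))
    rw [sub_add_cancel] at h8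
    linarith
  · rw [Finset.Ioc_eq_empty (by omega)]
    simp only [Finset.sum_empty, abs_zero]
    have := hw0 (u + 1); positivity

lemma not_sq (n : ℕ) (hn : 3 ≤ n) : ¬ IsSquare (n ^ 2 - 4) := by
  rintro ⟨c, hc⟩
  have h9 : 9 ≤ n ^ 2 := by nlinarith
  have h1 : n ^ 2 = c * c + 4 := by omega
  have h2 : c < n := by nlinarith
  rcases Nat.lt_or_ge c (n - 1) with h | h
  · have : c + 2 ≤ n := by omega
    nlinarith
  · have : c + 1 = n := by omega
    subst this
    have : c ^ 2 + 2 * c + 1 = c * c + 4 := by rw [← h1]; ring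
    have : 2 * c = 3 := by nlinarith
    omega

lemma psi_prefix (n : ℕ) (hn : 3 ≤ n) (k : ℕ) :
    |∑ m ∈ Finset.range k, psi n m| ≤ 4 * ((n ^ 2 - 4 : ℕ) : ℝ) := by
  have h := chi_prefix (n ^ 2 - 4) (not_sq n hn) k
  have : ((|∑ m ∈ Finset.range k, chi ((n ^ 2 - 4 : ℕ) : ℤ) m| : ℤ) : ℝ) ≤ ((4 * (n ^ 2 - 4 : ℕ) : ℤ) : ℝ) := by
    exact_mod_cast h
  push_cast at this
  simpa [psi] using this

open Classical in
/-- value of the `L`-function at `1` -/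
noncomputable def Lval (n : ℕ) : ℝ :=
  if hn : 3 ≤ n then (exists_lval (psi n) _ (psi_prefix n hn)).choose else 0

lemma Lval_spec (n : ℕ) (hn : 3 ≤ n) (X : ℕ) :
    |Lval n - ∑ m ∈ Finset.Ioc 0 X, psi n m / m| ≤ 2 * (4 * ((n ^ 2 - 4 : ℕ) : ℝ)) / (X + 1) := by
  rw [Lval, dif_pos hn]
  exact (exists_lval (psi n) _ (psi_prefix n hn)).choose_spec X

/-- finite factor -/
noncomputable def Fval (n : ℕ) : ℝ := ∑' q, (lam1 n q : ℝ) / q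

lemma lam1_div_le (n q : ℕ) : |(lam1 n q : ℝ)| / q ≤ rw1 n q := by
  rcases Nat.eq_zero_or_pos q with rfl | hq
  · simp [rw1]
  unfold rw1
  rw [div_eq_mul_inv]
  gcongr
  rw [← Real.rpow_neg_one]
  exact Real.rpow_le_rpow_of_exponent_le (by exact_mod_cast hq) (by norm_num)

lemma lam1_div_summable (n : ℕ) (hn : 3 ≤ n) : Summable (fun q : ℕ => |(lam1 n q : ℝ)| / q) :=
  Summable.of_nonneg_of_le (fun q => by positivity) (lam1_div_le n) (rw1_sum n hn).1

/-- summatory function of `1 * ψ` -/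
noncomputable def Ssum (n y : ℕ) : ℝ := ∑ q ∈ Finset.Ioc 0 y, psi n q * ((y / q : ℕ) : ℝ)

lemma Ssum_tail (n : ℕ) (hn : 3 ≤ n) (K y : ℕ) :
    |∑ q ∈ Finset.Ioc K y, psi n q * ((y / q : ℕ) : ℝ)| ≤
      2 * (4 * ((n ^ 2 - 4 : ℕ) : ℝ)) * (y / (K + 1)) := by
  refine (abel_gen (psi n) _ (psi_prefix n hn) (fun q => ((y / q : ℕ) : ℝ)) ?_ ?_ K y).trans ?_
  · intro m hm
    exact_mod_cast Nat.div_le_div_left (Nat.le_succ m) hm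
  · intro m; positivity
  · gcongr
    have := @Nat.cast_div_le ℝ _ _ _ y (K + 1)
    simpa using this

lemma Ssum_bound (n : ℕ) (hn : 3 ≤ n) (y : ℕ) :
    |Ssum n y| ≤ 2 * (4 * ((n ^ 2 - 4 : ℕ) : ℝ)) * y := by
  have := Ssum_tail n hn 0 y
  simpa [Ssum] using this

lemma nat_div_tendsto (q : ℕ) (hq : 0 < q) :
    Tendsto (fun y : ℕ => ((y / q : ℕ) : ℝ) / y) atTop (nhds (1 / q)) := by
  have h1 := (tendsto_nat_floor_mul_div_atTop (R := ℝ) (a := 1 / q) (by positivity)).comp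
    (tendsto_natCast_atTop_atTop (R := ℝ))
  refine h1.congr fun y => ?_
  simp only [Function.comp]
  congr 2
  rw [one_div, inv_mul_eq_div, Nat.floor_div_natCast, Nat.floor_natCast]

lemma Ssum_tendsto (n : ℕ) (hn : 3 ≤ n) :
    Tendsto (fun y : ℕ => Ssum n y / y) atTop (nhds (Lval n)) := by
  set B : ℝ := 2 * (4 * ((n ^ 2 - 4 : ℕ) : ℝ)) with hB
  have hB0 : 0 ≤ B := by positivity
  rw [Metric.tendsto_atTop]
  intro ε hε
  obtain ⟨K, hK⟩ := exists_nat_gt (3 * (B + 1) / ε)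
  have hBK : B / (K + 1) < ε / 3 := by
    rw [div_lt_iff₀ hε] at hK
    rw [div_lt_iff₀ (by positivity)]
    nlinarith
  have h1 : Tendsto (fun y : ℕ => ∑ q ∈ Finset.Ioc 0 K, psi n q * (((y / q : ℕ) : ℝ) / y)) atTop
      (nhds (∑ q ∈ Finset.Ioc 0 K, psi n q * (1 / q))) := by
    apply tendsto_finsetSum
    intro q hq
    exact (nat_div_tendsto q (Finset.mem_Ioc.1 hq).1).const_mul _
  rw [Metric.tendsto_atTop] at h1
  obtain ⟨N, hN⟩ := h1 (ε / 3) (by positivity)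
  refine ⟨max N (K + 1), fun y hy => ?_⟩
  have hyN := hN y (le_of_max_le_left hy)
  have hyK : K + 1 ≤ y := le_of_max_le_right hy
  have hy0 : (0 : ℝ) < y := by exact_mod_cast (by omega : 0 < y)
  rw [Real.dist_eq] at hyN ⊢
  have h2 := Lval_spec n hn K
  rw [← hB] at h2
  have h3 := Ssum_tail n hn K y
  rw [← hB] at h3
  have h4 : Ssum n y / y = ∑ q ∈ Finset.Ioc 0 K, psi n q * (((y / q : ℕ) : ℝ) / y) +
      (∑ q ∈ Finset.Ioc K y, psi n q * ((y / q : ℕ) : ℝ)) / y := by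
    rw [Ssum, ← Finset.sum_Ioc_consecutive _ (Nat.zero_le K) (by omega : K ≤ y), add_div, Finset.sum_div]
    congr 1
    apply Finset.sum_congr rfl; intros; rw [mul_div_assoc]
  have h5 : |(∑ q ∈ Finset.Ioc K y, psi n q * ((y / q : ℕ) : ℝ)) / y| ≤ B / (K + 1) := by
    rw [abs_div, abs_of_pos hy0, div_le_iff₀ hy0]
    refine h3.trans (le_of_eq ?_); ring
  have h6 : ∑ q ∈ Finset.Ioc 0 K, psi n q * (1 / (q : ℝ)) = ∑ q ∈ Finset.Ioc 0 K, psi n q / q := by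
    apply Finset.sum_congr rfl; intros; rw [mul_one_div]
  rw [h6] at hyN
  rw [h4]
  rw [abs_lt] at hyN ⊢
  rw [abs_le] at h2 h5
  constructor <;> linarith [hyN.1, hyN.2, h2.1, h2.2, h5.1, h5.2]

lemma mean_R (n : ℕ) (hn : 3 ≤ n) :
    Tendsto (fun X : ℕ => ((∑ m ∈ Finset.Ioc 0 X, (sqA * rhoA n) m : ℤ) : ℝ) / X) atTop
      (nhds (Fval n * Lval n)) := by
  set B : ℝ := 2 * (4 * ((n ^ 2 - 4 : ℕ) : ℝ)) with hB
  have hfun : ∀ X : ℕ, ((∑ m ∈ Finset.Ioc 0 X, (sqA * rhoA n) m : ℤ) : ℝ) / X =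
      ∑' q : ℕ, (lam1 n q : ℝ) * (Ssum n (X / q) / X) := by
    intro X
    rw [tsum_eq_sum (s := Finset.Ioc 0 X)]
    · rw [← zeta_lam, lam_eq n (by omega), mul_comm (ArithmeticFunction.zeta : ArithmeticFunction ℤ), mul_assoc,
        ArithmeticFunction.sum_Ioc_mul_eq_sum_sum]
      simp_rw [ArithmeticFunction.sum_Ioc_mul_zeta_eq_sum]
      push_cast
      rw [Finset.sum_div]
      apply Finset.sum_congr rfl
      intro q _
      rw [mul_div_assoc]
      rfl
    · intro q hq
      rw [Finset.mem_Ioc] at hq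
      rcases Nat.eq_zero_or_pos q with rfl | h0
      · simp
      · have : X / q = 0 := Nat.div_eq_of_lt (by by_contra h; exact hq ⟨h0, by omega⟩)
        rw [this]; simp [Ssum]
  simp_rw [hfun]
  have hlim : Fval n * Lval n = ∑' q : ℕ, (lam1 n q : ℝ) * (Lval n * (1 / q)) := by
    rw [Fval, ← tsum_mul_right]
    congr 1; ext q; ring
  rw [hlim]
  refine tendsto_tsum_of_dominated_convergence (bound := fun q => |(lam1 n q : ℝ)| / q * B)
    ((lam1_div_summable n hn).mul_right B) ?_ ?_
  · intro q
    rcases Nat.eq_zero_or_pos q with rfl | h0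
    · simp
    refine Tendsto.const_mul _ ?_
    have h1 := (Ssum_tendsto n hn).comp (Nat.tendsto_div_const_atTop h0.ne')
    have h2 := h1.mul (nat_div_tendsto q h0)
    refine h2.congr fun X => ?_
    simp only [Function.comp]
    rcases Nat.eq_zero_or_pos (X / q) with h | h
    · simp [h, Ssum]
    · have : ((X / q : ℕ) : ℝ) ≠ 0 := by exact_mod_cast h.ne'
      field_simp
  · filter_upwards [eventually_gt_atTop 0] with X hX q
    rcases Nat.eq_zero_or_pos q with rfl | h0
    · simp
    have hX0 : (0 : ℝ) < X := by exact_mod_cast hX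
    have hq0 : (0 : ℝ) < q := by exact_mod_cast h0
    rw [Real.norm_eq_abs, abs_mul, abs_div, abs_of_pos hX0, div_mul_eq_mul_div, mul_div_assoc]
    apply mul_le_mul_of_nonneg_left _ (abs_nonneg _)
    rw [div_le_div_iff₀ hX0 hq0]
    have h1 := Ssum_bound n hn (X / q)
    have h2 : ((X / q : ℕ) : ℝ) * q ≤ X := by exact_mod_cast Nat.div_mul_le_self X q
    calc _ ≤ (B * ((X / q : ℕ) : ℝ)) * q := by gcongr
      _ = B * (((X / q : ℕ) : ℝ) * q) := by ring
      _ ≤ _ := by gcongr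

end PF

namespace PF

/-- average over a period -/
noncomputable def avg (f : ℕ → ℝ) (P : ℕ) : ℝ := (∑ n ∈ Finset.range P, f n) / P

lemma sum_range_mul_period (f : ℕ → ℝ) (P k : ℕ) (hf : ∀ n, f (n + P) = f n) :
    ∑ n ∈ Finset.range (P * k), f n = k * ∑ n ∈ Finset.range P, f n := by
  have hf' : ∀ j n, f (P * j + n) = f n := by
    intro j; induction j with
    | zero => simp
    | succ j ih => intro n; rw [show P * (j + 1) + n = (P * j + n) + P by ring, hf, ih]
  induction k with
  | zero => simp
  | succ k ih =>
    rw [Nat.mul_succ, Finset.sum_range_add, ih, Finset.sum_congr rfl (fun n _ => hf' k n)]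
    push_cast; ring

lemma avg_mul (f : ℕ → ℝ) (P k : ℕ) (hk : 0 < k) (hf : ∀ n, f (n + P) = f n) :
    avg f (P * k) = avg f P := by
  rw [avg, sum_range_mul_period f P k hf, avg]
  have : (k : ℝ) ≠ 0 := by exact_mod_cast hk.ne'
  push_cast
  rw [mul_comm, mul_div_mul_right _ _ this]

lemma avg_dvd (f : ℕ → ℝ) (P Q : ℕ) (hQ : 0 < Q) (h : P ∣ Q) (hf : ∀ n, f (n + P) = f n) :
    avg f Q = avg f P := by
  obtain ⟨k, rfl⟩ := h
  exact avg_mul f P k (Nat.pos_of_mul_pos_left hQ) hf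

lemma sum_range_crt (f g : ℕ → ℝ) (a b : ℕ) (ha : 0 < a) (hb : 0 < b) (h : a.Coprime b)
    (hf : ∀ n m, n ≡ m [MOD a] → f n = f m) (hg : ∀ n m, n ≡ m [MOD b] → g n = g m) :
    ∑ n ∈ Finset.range (a * b), f n * g n =
      (∑ n ∈ Finset.range a, f n) * ∑ n ∈ Finset.range b, g n := by
  rw [Finset.sum_mul_sum, ← Finset.sum_product']
  symm
  apply Finset.sum_bij (fun x _ => (Nat.chineseRemainder h x.1 x.2 : ℕ))
  · intro x _
    exact Finset.mem_range.2 (Nat.chineseRemainder_lt_mul h _ _ ha.ne' hb.ne')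
  · intro x hx y hy hxy
    simp only [Finset.mem_product, Finset.mem_range] at hx hy
    have h1 := (Nat.chineseRemainder h x.1 x.2).2
    have h2 := (Nat.chineseRemainder h y.1 y.2).2
    rw [hxy] at h1
    have e1 : x.1 ≡ y.1 [MOD a] := h1.1.symm.trans h2.1
    have e2 : x.2 ≡ y.2 [MOD b] := h1.2.symm.trans h2.2
    exact Prod.ext (e1.eq_of_lt_of_lt hx.1 hy.1) (e2.eq_of_lt_of_lt hx.2 hy.2)
  · intro n hn
    rw [Finset.mem_range] at hn
    refine ⟨(n % a, n % b), by simp [Nat.mod_lt _ ha, Nat.mod_lt _ hb], ?_⟩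
    have h1 := (Nat.chineseRemainder h (n % a) (n % b)).2
    have h2 := Nat.chineseRemainder_lt_mul h (n % a) (n % b) ha.ne' hb.ne'
    refine Nat.ModEq.eq_of_lt_of_lt ?_ h2 hn
    rw [← Nat.modEq_and_modEq_iff_modEq_mul h]
    exact ⟨h1.1.trans (Nat.mod_modEq _ _), h1.2.trans (Nat.mod_modEq _ _)⟩
  · intro x _
    have h1 := (Nat.chineseRemainder h x.1 x.2).2
    rw [hf _ _ h1.1, hg _ _ h1.2]

lemma sum_Icc_avg (f : ℕ → ℝ) (P : ℕ) (hP : 0 < P) (hf : ∀ n, f (n + P) = f n) (C : ℝ)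
    (hC : ∀ n, |f n| ≤ C) (N : ℕ) :
    |∑ n ∈ Finset.Icc 3 N, f n - N * avg f P| ≤ (2 * P + 4) * C := by
  have hC0 : 0 ≤ C := (abs_nonneg _).trans (hC 0)
  have hf' : ∀ j n, f (P * j + n) = f n := by
    intro j; induction j with
    | zero => simp
    | succ j ih => intro n; rw [show P * (j + 1) + n = (P * j + n) + P by ring, hf, ih]
  have hr : ∀ k, |∑ n ∈ Finset.range k, f n| ≤ k * C := by
    intro k
    refine (Finset.abs_sum_le_sum_abs _ _).trans ((Finset.sum_le_sum fun n _ => hC n).trans ?_)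
    simp
  have hP0 : (0 : ℝ) < P := by exact_mod_cast hP
  set S := ∑ n ∈ Finset.range P, f n with hS
  have hSP : |S| ≤ P * C := hr P
  have h1 : |∑ n ∈ Finset.Icc 3 N, f n - ∑ n ∈ Finset.range N, f n| ≤ 4 * C := by
    rcases Nat.lt_or_ge N 3 with h | h
    · rw [Finset.Icc_eq_empty (by omega)]
      simp only [Finset.sum_empty, zero_sub, abs_neg]
      refine (hr N).trans ?_
      have : (N : ℝ) ≤ 4 := by exact_mod_cast (by omega : N ≤ 4)
      gcongr
    · have e : Finset.Icc 3 N = Finset.Ico 3 (N + 1) := rfl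
      rw [e, Finset.sum_Ico_eq_sub _ (by omega), Finset.sum_range_succ]
      have := hr 3
      have h2 := hC N
      push_cast at this
      rw [abs_le] at *
      constructor <;> linarith [this.1, this.2, h2.1, h2.2]
  have h2 : ∑ n ∈ Finset.range N, f n = (N / P : ℕ) * S + ∑ n ∈ Finset.range (N % P), f n := by
    conv_lhs => rw [← Nat.div_add_mod N P]
    rw [Finset.sum_range_add, sum_range_mul_period f P _ hf, Finset.sum_congr rfl (fun n _ => hf' _ n)]
  have h3 : |∑ n ∈ Finset.range (N % P), f n| ≤ P * C := by
    refine (hr _).trans ?_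
    have : ((N % P : ℕ) : ℝ) ≤ P := by exact_mod_cast (Nat.mod_lt N hP).le
    gcongr
  have h4 : |((N / P : ℕ) : ℝ) * S - N * avg f P| ≤ P * C := by
    have e : (N : ℝ) = P * (N / P : ℕ) + (N % P : ℕ) := by exact_mod_cast (Nat.div_add_mod N P).symm
    have e2 : ((N / P : ℕ) : ℝ) * S - N * avg f P = - (S * ((N % P : ℕ) / P)) := by
      rw [avg, ← hS]
      conv_lhs => rw [e]
      field_simp; ring
    rw [e2, abs_neg, abs_mul]
    refine (mul_le_of_le_one_right (abs_nonneg _) ?_).trans hSP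
    rw [abs_of_nonneg (by positivity), div_le_one hP0]
    exact_mod_cast (Nat.mod_lt N hP).le
  rw [h2] at h1
  rw [abs_le] at *
  constructor <;> linarith [h1.1, h1.2, h3.1, h3.2, h4.1, h4.2]

lemma sum_range_zmod (P : ℕ) [NeZero P] (g : ZMod P → ℝ) :
    ∑ n ∈ Finset.range P, g (n : ZMod P) = ∑ z : ZMod P, g z := by
  refine Finset.sum_bij (fun (n : ℕ) _ => (n : ZMod P)) ?_ ?_ ?_ ?_
  · intros; simp
  · intro n hn m hm h
    rw [Finset.mem_range] at hn hm
    exact Nat.ModEq.eq_of_lt_of_lt ((ZMod.natCast_eq_natCast_iff n m P).1 h) hn hm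
  · intro z _
    exact ⟨z.val, Finset.mem_range.2 (ZMod.val_lt z), by simp⟩
  · intros; rfl

/-- mean of `λ_q λ_r` -/
noncomputable def Mv (q r : ℕ) : ℝ := avg (fun n => (lam n q : ℝ) * lam n r) (q * r)

lemma Mv_mul (q1 r1 q2 r2 : ℕ) (h : (q1 * r1).Coprime (q2 * r2)) (hq1 : 0 < q1) (hr1 : 0 < r1)
    (hq2 : 0 < q2) (hr2 : 0 < r2) : Mv (q1 * q2) (r1 * r2) = Mv q1 r1 * Mv q2 r2 := by
  have hq : q1.Coprime q2 := (h.coprime_dvd_left (dvd_mul_right _ _)).coprime_dvd_right (dvd_mul_right _ _)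
  have hr : r1.Coprime r2 := (h.coprime_dvd_left (dvd_mul_left _ _)).coprime_dvd_right (dvd_mul_left _ _)
  unfold Mv avg
  rw [show q1 * q2 * (r1 * r2) = (q1 * r1) * (q2 * r2) by ring, div_mul_div_comm,
    ← sum_range_crt _ _ _ _ (by positivity) (by positivity) h]
  · congr 1
    · apply Finset.sum_congr rfl
      intro n _
      dsimp only
      rw [(lam_mult n).map_mul_of_coprime hq, (lam_mult n).map_mul_of_coprime hr]
      push_cast; ring
    · push_cast; rfl
  · intro n m hnm
    rw [lam_congr n m q1 (hnm.of_dvd (dvd_mul_right _ _)), lam_congr n m r1 (hnm.of_dvd (dvd_mul_left _ _))]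
  · intro n m hnm
    rw [lam_congr n m q2 (hnm.of_dvd (dvd_mul_right _ _)), lam_congr n m r2 (hnm.of_dvd (dvd_mul_left _ _))]

/-- double divisor sum -/
noncomputable def DS (F : ℕ → ℕ → ℝ) (l : ℕ) : ℝ := ∑ q ∈ l.divisors, ∑ r ∈ l.divisors, F q r

lemma sum_divisors_coprime (f : ℕ → ℝ) (a b : ℕ) (h : a.Coprime b) :
    ∑ d ∈ (a * b).divisors, f d = ∑ x ∈ a.divisors, ∑ y ∈ b.divisors, f (x * y) := by
  rw [← Finset.sum_product', Nat.divisors_mul, Finset.mul_def, Finset.sum_image]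
  · intro x hx y hy hxy
    simp only [Finset.coe_product, Set.mem_prod, Finset.mem_coe, Nat.mem_divisors] at hx hy
    have key : ∀ x y : ℕ × ℕ, x.1 ∣ a → x.2 ∣ b → y.1 ∣ a → y.2 ∣ b → x.1 * x.2 = y.1 * y.2 → x.1 ∣ y.1 ∧ x.2 ∣ y.2 := by
      intro x y h1 h2 h3 h4 h5
      constructor
      · exact ((h.coprime_dvd_left h1).coprime_dvd_right h4).dvd_of_dvd_mul_right (⟨x.2, h5.symm⟩ : x.1 ∣ y.1 * y.2)
      · exact ((h.symm.coprime_dvd_left h2).coprime_dvd_right h3).dvd_of_dvd_mul_left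
          (⟨x.1, by rw [← h5]; ring⟩ : x.2 ∣ y.1 * y.2)
    have k1 := key x y hx.1.1 hx.2.1 hy.1.1 hy.2.1 hxy
    have k2 := key y x hy.1.1 hy.2.1 hx.1.1 hx.2.1 hxy.symm
    exact Prod.ext (Nat.dvd_antisymm k1.1 k2.1) (Nat.dvd_antisymm k1.2 k2.2)

lemma DS_mul (F : ℕ → ℕ → ℝ) (hF : ∀ q1 r1 q2 r2 : ℕ, (q1 * r1).Coprime (q2 * r2) → 0 < q1 → 0 < r1 →
    0 < q2 → 0 < r2 → F (q1 * q2) (r1 * r2) = F q1 r1 * F q2 r2) (a b : ℕ) (h : a.Coprime b) :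
    DS F (a * b) = DS F a * DS F b := by
  unfold DS
  rw [sum_divisors_coprime _ a b h]
  simp_rw [sum_divisors_coprime _ a b h]
  rw [Finset.sum_mul_sum]
  apply Finset.sum_congr rfl; intro q1 hq1
  apply Finset.sum_congr rfl; intro q2 hq2
  rw [Finset.sum_mul_sum]
  apply Finset.sum_congr rfl; intro r1 hr1
  apply Finset.sum_congr rfl; intro r2 hr2
  have d1 := Nat.dvd_of_mem_divisors hq1
  have d2 := Nat.dvd_of_mem_divisors hq2
  have d3 := Nat.dvd_of_mem_divisors hr1
  have d4 := Nat.dvd_of_mem_divisors hr2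
  refine hF _ _ _ _ ?_ (Nat.pos_of_mem_divisors hq1) (Nat.pos_of_mem_divisors hr1)
    (Nat.pos_of_mem_divisors hq2) (Nat.pos_of_mem_divisors hr2)
  refine Nat.Coprime.mul_left (Nat.Coprime.mul_right ?_ ?_) (Nat.Coprime.mul_right ?_ ?_)
  · exact (h.coprime_dvd_left d1).coprime_dvd_right d2
  · exact (h.coprime_dvd_left d1).coprime_dvd_right d4
  · exact (h.coprime_dvd_left d3).coprime_dvd_right d2
  · exact (h.coprime_dvd_left d3).coprime_dvd_right d4

lemma DS_prod (F : ℕ → ℕ → ℝ) (hF : ∀ q1 r1 q2 r2 : ℕ, (q1 * r1).Coprime (q2 * r2) → 0 < q1 → 0 < r1 →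
    0 < q2 → 0 < r2 → F (q1 * q2) (r1 * r2) = F q1 r1 * F q2 r2) (h1 : F 1 1 = 1) (k : ℕ) (s : Finset ℕ)
    (hs : ∀ p ∈ s, p.Prime) : DS F (∏ p ∈ s, p ^ k) = ∏ p ∈ s, DS F (p ^ k) := by
  induction s using Finset.induction_on with
  | empty => simp [DS, h1]
  | insert p s hp ih =>
    rw [Finset.prod_insert hp, Finset.prod_insert hp, DS_mul F hF, ih (fun q hq => hs q (Finset.mem_insert_of_mem hq))]
    apply Nat.Coprime.prod_right
    intro q hq
    apply Nat.Coprime.pow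
    rw [Nat.coprime_primes (hs p (Finset.mem_insert_self _ _)) (hs q (Finset.mem_insert_of_mem hq))]
    rintro rfl; exact hp hq

/-- exhausting sequence -/
noncomputable def ell (k : ℕ) : ℕ := ∏ p ∈ k.primesBelow, p ^ k

lemma dvd_ell (q k : ℕ) (hq : 0 < q) (hk : q < k) : q ∣ ell k := by
  have h : ∏ p ∈ q.primeFactors, p ^ (q.factorization p) ∣ ∏ p ∈ k.primesBelow, p ^ k := by
    have h1 : ∏ p ∈ q.primeFactors, p ^ (q.factorization p) ∣ ∏ p ∈ q.primeFactors, p ^ k := by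
      apply Finset.prod_dvd_prod_of_dvd
      intro p hp
      apply pow_dvd_pow
      exact ((Nat.factorization_lt p hq.ne').trans hk).le
    refine h1.trans (Finset.prod_dvd_prod_of_subset _ _ _ ?_)
    intro p hp
    rw [Nat.mem_primesBelow]
    exact ⟨(Nat.le_of_mem_primeFactors hp).trans_lt hk, Nat.prime_of_mem_primeFactors hp⟩
  rwa [show ∏ p ∈ q.primeFactors, p ^ (q.factorization p) = q from Nat.prod_factorization_pow_eq_self hq.ne'] at h

lemma ell_pos (k : ℕ) : 0 < ell k :=
  Finset.prod_pos fun p hp => pow_pos (Nat.prime_of_mem_primesBelow hp).pos _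

lemma ell_dvd (j k : ℕ) (h : j ≤ k) : ell j ∣ ell k := by
  unfold ell
  have h1 : ∏ p ∈ j.primesBelow, p ^ j ∣ ∏ p ∈ j.primesBelow, p ^ k :=
    Finset.prod_dvd_prod_of_dvd _ _ fun p _ => pow_dvd_pow _ h
  refine h1.trans (Finset.prod_dvd_prod_of_subset _ _ _ ?_)
  intro p hp
  rw [Nat.mem_primesBelow] at *
  exact ⟨by omega, hp.2⟩

end PF

namespace PF

lemma sum_rho (q : ℕ) [NeZero q] (g : ZMod q → ℝ) :
    ∑ n ∈ Finset.range q, g n * rho n q =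
      ∑ y : ZMod q, (if IsUnit y then g (y + y⁻¹) else 0) := by
  have h1 : ∀ n ∈ Finset.range q, g n * rho n q =
      (fun z : ZMod q => ∑ y : ZMod q, if y ^ 2 - z * y + 1 = 0 then g z else 0) (n : ZMod q) := by
    intro n _
    dsimp only
    rw [rho_eq_card, Finset.card_filter]
    push_cast
    rw [Finset.mul_sum]
    apply Finset.sum_congr rfl
    intro y _
    split_ifs <;> simp
  rw [Finset.sum_congr rfl h1, sum_range_zmod q (fun z : ZMod q => ∑ y : ZMod q, if y ^ 2 - z * y + 1 = 0 then g z else 0),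
    Finset.sum_comm]
  apply Finset.sum_congr rfl
  intro y _
  split_ifs with hy
  · have hy1 := ZMod.mul_inv_of_unit y hy
    rw [Finset.sum_eq_single (y + y⁻¹)]
    · rw [if_pos]
      linear_combination -hy1
    · intro z _ hz
      rw [if_neg]
      intro h
      apply hz
      linear_combination (-y⁻¹) * h + (y - z) * hy1
    · simp
  · apply Finset.sum_eq_zero
    intro z _
    rw [if_neg]
    intro h
    exact hy (IsUnit.of_mul_eq_one (z - y) (by linear_combination -h))

lemma isUnit_cast (p j k : ℕ) (hj : 1 ≤ j) (hjk : j ≤ k) (hp : p.Prime) (y : ZMod (p ^ k)) :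
    IsUnit (ZMod.castHom (pow_dvd_pow p hjk) (ZMod (p ^ j)) y) ↔ IsUnit y := by
  have : NeZero p := ⟨hp.ne_zero⟩
  obtain ⟨m, rfl⟩ := ZMod.natCast_zmod_surjective y
  rw [map_natCast, ZMod.isUnit_iff_coprime, ZMod.isUnit_iff_coprime, Nat.coprime_pow_right_iff (by omega),
    Nat.coprime_pow_right_iff (by omega)]

/-- count of pairs -/
noncomputable def Nn (q : ℕ) [NeZero q] : ℕ :=
  (Finset.univ.filter (fun z : ZMod q × ZMod q => IsUnit z.2 ∧ (z.1 - z.2) * (z.1 * z.2 - 1) = 0)).card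

lemma Nn_eq (q : ℕ) [NeZero q] : (Nn q : ℝ) = ∑ y : ZMod q, (if IsUnit y then
    ((Finset.univ.filter (fun x : ZMod q => x ^ 2 - (y + y⁻¹) * x + 1 = 0)).card : ℝ) else 0) := by
  rw [Nn, Finset.card_filter, Fintype.sum_prod_type_right]
  push_cast
  apply Finset.sum_congr rfl
  intro y _
  split_ifs with hy
  · rw [Finset.card_filter]
    push_cast
    apply Finset.sum_congr rfl
    intro x _
    have hy1 := ZMod.mul_inv_of_unit y hy
    congr 1
    rw [eq_iff_iff]
    constructor
    · rintro ⟨_, h⟩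
      linear_combination (y⁻¹) * h + (-x ^ 2 + x * y) * hy1 - hy1
    · intro h
      exact ⟨hy, by linear_combination y * h + x * hy1⟩
  · simp [hy]

lemma sum_zmod_cast (q d : ℕ) [NeZero q] [NeZero d] (h : d ∣ q) (g : ZMod d → ℝ) :
    ∑ y : ZMod q, g (ZMod.castHom h (ZMod d) y) = (q / d : ℕ) * ∑ z : ZMod d, g z := by
  rw [← Finset.sum_fiberwise_of_maps_to (s := Finset.univ) (t := Finset.univ) (g := fun y : ZMod q => ZMod.castHom h (ZMod d) y)
    (by intros; simp), Finset.mul_sum]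
  apply Finset.sum_congr rfl
  intro z _
  rw [← fiber_card q d h z, Finset.card_filter]
  push_cast
  rw [Finset.sum_mul, Finset.sum_filter]
  apply Finset.sum_congr rfl
  intro y _
  split_ifs with h1
  · rw [h1, one_mul]
  · simp

lemma map_inv_unit (p j k : ℕ) (hj : 1 ≤ j) (hjk : j ≤ k) (hp : p.Prime) (y : ZMod (p ^ k)) (hy : IsUnit y) :
    ZMod.castHom (pow_dvd_pow p hjk) (ZMod (p ^ j)) y⁻¹ = (ZMod.castHom (pow_dvd_pow p hjk) (ZMod (p ^ j)) y)⁻¹ := by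
  have h1 := congrArg (ZMod.castHom (pow_dvd_pow p hjk) (ZMod (p ^ j))) (ZMod.mul_inv_of_unit y hy)
  rw [map_mul, map_one] at h1
  have h2 := ZMod.mul_inv_of_unit _ ((isUnit_cast p j k hj hjk hp y).2 hy)
  set a := ZMod.castHom (pow_dvd_pow p hjk) (ZMod (p ^ j)) y
  linear_combination a⁻¹ * h1 - (ZMod.castHom (pow_dvd_pow p hjk) (ZMod (p ^ j)) y⁻¹) * h2

lemma rho_add (n q p k : ℕ) (h : p ^ k ∣ q) : rho (n + q) (p ^ k) = rho n (p ^ k) := by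
  apply rho_congr
  rw [Nat.ModEq, Nat.add_mod, Nat.mod_eq_zero_of_dvd h]; simp

lemma avg_rr (p j k K : ℕ) (hj : 1 ≤ j) (hjk : j ≤ k) (hkK : k ≤ K) (hp : p.Prime) [NeZero (p ^ j)] :
    avg (fun n => (rho n (p ^ j) : ℝ) * rho n (p ^ k)) (p ^ K) = Nn (p ^ j) / p ^ j := by
  have : NeZero p := ⟨hp.ne_zero⟩
  rw [avg_dvd _ (p ^ k) (p ^ K) (pow_pos hp.pos _) (pow_dvd_pow p hkK)
    (fun n => by rw [rho_add n _ p j (pow_dvd_pow p hjk), rho_add n _ p k dvd_rfl])]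
  unfold avg
  have h1 : ∀ n ∈ Finset.range (p ^ k), (rho n (p ^ j) : ℝ) * rho n (p ^ k) =
    (fun z : ZMod (p ^ k) => ((Finset.univ.filter (fun x : ZMod (p ^ j) => x ^ 2 - (ZMod.castHom (pow_dvd_pow p hjk) (ZMod (p ^ j)) z) * x + 1 = 0)).card : ℝ)) (n : ZMod (p ^ k)) * rho n (p ^ k) := by
    intro n _
    dsimp only
    rw [rho_eq_card n (p ^ j), map_natCast]
  rw [Finset.sum_congr rfl h1, sum_rho (p ^ k) (fun z : ZMod (p ^ k) => ((Finset.univ.filter (fun x : ZMod (p ^ j) => x ^ 2 - (ZMod.castHom (pow_dvd_pow p hjk) (ZMod (p ^ j)) z) * x + 1 = 0)).card : ℝ))]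
  have h2 : ∀ y ∈ (Finset.univ : Finset (ZMod (p ^ k))),
    (if IsUnit y then ((Finset.univ.filter (fun x : ZMod (p ^ j) => x ^ 2 - (ZMod.castHom (pow_dvd_pow p hjk) (ZMod (p ^ j)) (y + y⁻¹)) * x + 1 = 0)).card : ℝ) else 0) =
    (fun y : ZMod (p ^ j) => (if IsUnit y then
    ((Finset.univ.filter (fun x : ZMod (p ^ j) => x ^ 2 - (y + y⁻¹) * x + 1 = 0)).card : ℝ) else 0)) (ZMod.castHom (pow_dvd_pow p hjk) (ZMod (p ^ j)) y) := by
    intro y _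
    dsimp only
    by_cases hy : IsUnit y
    · rw [if_pos hy, if_pos ((isUnit_cast p j k hj hjk hp y).2 hy), map_add, map_inv_unit p j k hj hjk hp y hy]
    · rw [if_neg hy, if_neg (mt (isUnit_cast p j k hj hjk hp y).1 hy)]
  rw [Finset.sum_congr rfl h2, sum_zmod_cast (p ^ k) (p ^ j) (pow_dvd_pow p hjk) (fun y : ZMod (p ^ j) => (if IsUnit y then
    ((Finset.univ.filter (fun x : ZMod (p ^ j) => x ^ 2 - (y + y⁻¹) * x + 1 = 0)).card : ℝ) else 0)), ← Nn_eq,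
    Nat.pow_div hjk hp.pos]
  have hp0 : (p : ℝ) ≠ 0 := by exact_mod_cast hp.ne_zero
  push_cast
  rw [div_eq_div_iff (by positivity) (by positivity), mul_right_comm, ← pow_add, Nat.sub_add_cancel hjk, mul_comm]

lemma avg_r (p k K : ℕ) (hk : 1 ≤ k) (hkK : k ≤ K) (hp : p.Prime) :
    avg (fun n => (rho n (p ^ k) : ℝ)) (p ^ K) = 1 - 1 / p := by
  have : NeZero p := ⟨hp.ne_zero⟩
  rw [avg_dvd _ (p ^ k) (p ^ K) (pow_pos hp.pos _) (pow_dvd_pow p hkK)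
    (fun n => by rw [rho_add n _ p k dvd_rfl])]
  unfold avg
  have h1 := sum_rho (p ^ k) (fun _ => 1)
  simp only [one_mul] at h1
  rw [h1, ← sum_range_zmod (p ^ k) (fun y => if IsUnit y then (1 : ℝ) else 0)]
  have h2 : ∑ n ∈ Finset.range (p ^ k), (if IsUnit (n : ZMod (p ^ k)) then (1 : ℝ) else 0) = ((p ^ k).totient : ℝ) := by
    rw [Nat.totient_eq_card_coprime, Finset.card_filter]
    push_cast
    apply Finset.sum_congr rfl
    intro n _
    simp only [ZMod.isUnit_iff_coprime, Nat.coprime_comm]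
  rw [h2, Nat.totient_prime_pow hp hk]
  have hp0 : (p : ℝ) ≠ 0 := by exact_mod_cast hp.ne_zero
  obtain ⟨k, rfl⟩ := Nat.exists_eq_add_of_le' hk
  push_cast [Nat.cast_sub hp.pos, pow_succ]
  field_simp

lemma avg_add (f g : ℕ → ℝ) (P : ℕ) : avg (fun n => f n + g n) P = avg f P + avg g P := by
  simp [avg, Finset.sum_add_distrib, add_div]

lemma avg_smul (c : ℝ) (f : ℕ → ℝ) (P : ℕ) : avg (fun n => c * f n) P = c * avg f P := by
  simp [avg, ← Finset.mul_sum, mul_div_assoc]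

lemma avg_sum {ι : Type*} (s : Finset ι) (f : ι → ℕ → ℝ) (P : ℕ) :
    avg (fun n => ∑ i ∈ s, f i n) P = ∑ i ∈ s, avg (f i) P := by
  simp only [avg]
  rw [Finset.sum_comm, Finset.sum_div]

lemma avg_const (c : ℝ) (P : ℕ) (hP : 0 < P) : avg (fun _ => c) P = c := by
  have : (P : ℝ) ≠ 0 := by exact_mod_cast hP.ne'
  simp [avg]; field_simp

lemma avg_mono (f g : ℕ → ℝ) (P : ℕ) (h : ∀ n, f n ≤ g n) : avg f P ≤ avg g P := by
  unfold avg
  gcongr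
  exact h _

lemma avg_abs (f : ℕ → ℝ) (P : ℕ) : |avg f P| ≤ avg (fun n => |f n|) P := by
  unfold avg
  rw [abs_div, abs_of_nonneg (Nat.cast_nonneg P : (0:ℝ) ≤ P)]
  gcongr
  exact Finset.abs_sum_le_sum_abs _ _

lemma lam_add (n q r : ℕ) (h : r ∣ q) : lam (n + q) r = lam n r := by
  apply lam_congr
  rw [Nat.ModEq, Nat.add_mod, Nat.mod_eq_zero_of_dvd h]; simp

lemma Mv_eq (q r P : ℕ) (hP : 0 < P) (hq : q ∣ P) (hr : r ∣ P) :
    Mv q r = avg (fun n => (lam n q : ℝ) * lam n r) P := by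
  have hq0 := Nat.pos_of_dvd_of_pos hq hP
  have hr0 := Nat.pos_of_dvd_of_pos hr hP
  have e1 : Mv q r = avg (fun n => (lam n q : ℝ) * lam n r) (q * r * P) :=
    (avg_dvd _ (q * r) _ (by positivity) (dvd_mul_right _ _)
      (fun n => by rw [lam_add n _ q (dvd_mul_right _ _), lam_add n _ r (dvd_mul_left _ _)])).symm
  rw [e1]
  exact avg_dvd _ P _ (by positivity) (dvd_mul_left _ _) (fun n => by rw [lam_add n _ q hq, lam_add n _ r hr])

lemma Mv_comm (q r : ℕ) : Mv q r = Mv r q := by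
  unfold Mv; simp only [mul_comm]

lemma Mv_one_one : Mv 1 1 = 1 := by
  simp [Mv, avg, lam_one]

lemma Mv_one_p (p : ℕ) (hp : p.Prime) : Mv 1 p = - (1 / p) := by
  rw [Mv_eq 1 p (p ^ 1) (by simp [hp.pos]) (one_dvd _) (by simp)]
  have : ∀ n, (lam n 1 : ℝ) * lam n p = (rho n (p ^ 1) : ℝ) + (-1) := by
    intro n
    have := lam_succ n p 0 hp
    simp only [zero_add, pow_zero, lam_one, pow_one] at this ⊢
    rw [this]; push_cast; ring
  simp_rw [this]
  rw [avg_add (fun n => (rho n (p ^ 1) : ℝ)) (fun _ => -1), avg_const _ _ (by simp [hp.pos]), avg_r p 1 1 le_rfl le_rfl hp]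
  ring

lemma avg_lam_abs (p k K : ℕ) (hkK : k ≤ K) (hp : p.Prime) :
    avg (fun n => |(lam n (p ^ k) : ℝ)|) (p ^ K) ≤ k + 1 := by
  have h1 : avg (fun n => |(lam n (p ^ k) : ℝ)|) (p ^ K) ≤
      avg (fun n => ∑ i ∈ Finset.range (k + 1), (rho n (p ^ i) : ℝ)) (p ^ K) := by
    apply avg_mono
    intro n
    rw [lam_prime_pow n p k hp]
    push_cast
    refine (Finset.abs_sum_le_sum_abs _ _).trans (Finset.sum_le_sum fun i _ => ?_)
    rw [abs_mul, abs_pow, abs_neg, abs_one, one_pow, one_mul, Nat.abs_cast]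
  refine h1.trans ?_
  rw [avg_sum]
  have h2 : ∀ i ∈ Finset.range (k + 1), avg (fun n => (rho n (p ^ i) : ℝ)) (p ^ K) ≤ 1 := by
    intro i hi
    rw [Finset.mem_range] at hi
    rcases Nat.eq_zero_or_pos i with rfl | h
    · simp only [pow_zero, rho_one, Nat.cast_one]
      rw [avg_const _ _ (pow_pos hp.pos _)]
    · rw [avg_r p i K h (by omega) hp]
      have : (0:ℝ) ≤ 1 / p := by positivity
      linarith
  refine (Finset.sum_le_sum h2).trans ?_
  simp

lemma Mv_pow_le (p j k : ℕ) (hjk : j ≤ k) (hp : p.Prime) :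
    |Mv (p ^ j) (p ^ k)| ≤ 2 * (j + 1) * (k + 1) * (p : ℝ) ^ (((j : ℝ) + k) / 4) := by
  have hp1 : (1 : ℝ) ≤ p := by exact_mod_cast hp.one_lt.le
  rw [Mv_eq _ _ (p ^ k) (pow_pos hp.pos _) (pow_dvd_pow p hjk) dvd_rfl]
  refine (avg_abs _ _).trans ?_
  have h1 : avg (fun n => |(lam n (p ^ j) : ℝ) * lam n (p ^ k)|) (p ^ k) ≤
      avg (fun n => ((j + 1) * (2 * (p : ℝ) ^ (((j : ℝ) + k) / 4))) * |(lam n (p ^ k) : ℝ)|) (p ^ k) := by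
    apply avg_mono
    intro n
    rw [abs_mul]
    gcongr
    have := lam_pow_abs_le n p j hp
    have h2 : |(lam n (p ^ j) : ℝ)| ≤ (j + 1) * (2 * (p : ℝ) ^ (j / 2)) := by exact_mod_cast this
    refine h2.trans ?_
    gcongr
    rw [← Real.rpow_natCast]
    apply Real.rpow_le_rpow_of_exponent_le hp1
    have h3 : ((j / 2 : ℕ) : ℝ) ≤ (j : ℝ) / 2 := Nat.cast_div_le
    have h4 : (j : ℝ) ≤ k := by exact_mod_cast hjk
    linarith
  refine h1.trans ?_
  rw [avg_smul]
  have := avg_lam_abs p k k le_rfl hp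
  calc _ ≤ ((j + 1) * (2 * (p : ℝ) ^ (((j : ℝ) + k) / 4))) * (k + 1) := by gcongr
    _ = _ := by ring

end PF

namespace PF

noncomputable def FF (q r : ℕ) : ℝ := Mv q r / (q * r)

lemma FF_mul (q1 r1 q2 r2 : ℕ) (h : (q1 * r1).Coprime (q2 * r2)) (hq1 : 0 < q1) (hr1 : 0 < r1)
    (hq2 : 0 < q2) (hr2 : 0 < r2) : FF (q1 * q2) (r1 * r2) = FF q1 r1 * FF q2 r2 := by
  unfold FF
  rw [Mv_mul q1 r1 q2 r2 h hq1 hr1 hq2 hr2]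
  push_cast
  rw [div_mul_div_comm]
  congr 1; ring

lemma FF_one : FF 1 1 = 1 := by simp [FF, Mv_one_one]

noncomputable def ww : ℝ := (2 : ℝ) ^ (-(3 / 4 : ℝ))

lemma ww_pos : 0 < ww := by unfold ww; positivity

lemma ww_lt : ww < 1 := Real.rpow_lt_one_of_one_lt_of_neg (by norm_num) (by norm_num)

lemma ww_ge : 1 / 2 ≤ ww := by
  unfold ww
  rw [show (1 / 2 : ℝ) = (2 : ℝ) ^ (-1 : ℝ) by rw [Real.rpow_neg_one]; norm_num]
  exact Real.rpow_le_rpow_of_exponent_le (by norm_num) (by norm_num)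

noncomputable def bb (z : ℕ × ℕ) : ℝ := 8 * (((z.1 + 1 : ℝ) * ww ^ z.1) * ((z.2 + 1 : ℝ) * ww ^ z.2))

lemma bb_nonneg (z : ℕ × ℕ) : 0 ≤ bb z := by
  have := ww_pos
  unfold bb; positivity

lemma bb_summable : Summable bb := by
  have h1 : Summable (fun j : ℕ => (j + 1 : ℝ) * ww ^ j) := by
    have hw : ‖ww‖ < 1 := by rw [Real.norm_eq_abs, abs_of_pos ww_pos]; exact ww_lt
    have h2 := summable_pow_mul_geometric_of_norm_lt_one 1 hw
    have h3 := summable_geometric_of_norm_lt_one hw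
    refine (h2.add h3).congr fun j => ?_
    ring
  exact (Summable.mul_of_nonneg h1 h1 (fun j => by have := ww_pos; positivity)
    (fun j => by have := ww_pos; positivity)).mul_left 8

lemma local_bound' (p j k : ℕ) (hp : p.Prime) (hjk : j ≤ k) (h : 0 < k) :
    |FF (p ^ j) (p ^ k)| ≤ (p : ℝ) ^ (-(3 / 2 : ℝ)) * bb (j, k) := by
  have hp2 : (2 : ℝ) ≤ p := by exact_mod_cast hp.two_le
  have hp0 : (0 : ℝ) < p := by linarith
  have hw := ww_pos
  have hw2 := ww_ge
  unfold FF
  rcases Nat.lt_or_ge (j + k) 2 with h2 | h2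
  · have hj : j = 0 := by omega
    have hk : k = 1 := by omega
    subst hj hk
    rw [pow_zero, pow_one, Mv_one_p p hp]
    push_cast
    rw [one_mul, abs_div, abs_neg, abs_of_pos (by positivity), abs_of_pos hp0]
    have e : 1 / (p : ℝ) / p = (p : ℝ) ^ (-(2 : ℝ)) := by
      rw [Real.rpow_neg hp0.le]; norm_cast; field_simp; push_cast; rfl
    rw [e]
    have h3 : (p : ℝ) ^ (-(2 : ℝ)) ≤ (p : ℝ) ^ (-(3 / 2 : ℝ)) :=
      Real.rpow_le_rpow_of_exponent_le (by linarith) (by norm_num)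
    refine h3.trans (le_mul_of_one_le_right (by positivity) ?_)
    simp [bb]; linarith
  · have h1 := Mv_pow_le p j k hjk hp
    rw [abs_div, abs_of_pos (show (0 : ℝ) < ((p ^ j : ℕ) : ℝ) * ((p ^ k : ℕ) : ℝ) by push_cast; positivity)]
    have e : ((p ^ j : ℕ) : ℝ) * ((p ^ k : ℕ) : ℝ) = (p : ℝ) ^ ((j : ℝ) + k) := by
      rw [Real.rpow_add hp0, Real.rpow_natCast, Real.rpow_natCast]; push_cast; ring
    rw [e, div_le_iff₀ (by positivity)]
    refine h1.trans ?_
    have h3 : (p : ℝ) ^ (((j : ℝ) + k) / 4) =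
        (p : ℝ) ^ (-(3 / 2 : ℝ)) * (p : ℝ) ^ (-(3 / 4 : ℝ) * ((j + k - 2 : ℕ) : ℝ)) * (p : ℝ) ^ ((j : ℝ) + k) := by
      rw [← Real.rpow_add hp0, ← Real.rpow_add hp0]
      congr 1
      push_cast [Nat.cast_sub h2]
      ring
    have h4 : (p : ℝ) ^ (-(3 / 4 : ℝ) * ((j + k - 2 : ℕ) : ℝ)) ≤ 4 * ww ^ (j + k) := by
      rw [Real.rpow_mul hp0.le, Real.rpow_natCast]
      have h5 : (p : ℝ) ^ (-(3 / 4 : ℝ)) ≤ ww :=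
        Real.rpow_le_rpow_of_nonpos (by norm_num) hp2 (by norm_num)
      calc ((p : ℝ) ^ (-(3 / 4 : ℝ))) ^ (j + k - 2) ≤ ww ^ (j + k - 2) := by gcongr
        _ ≤ ww ^ (j + k - 2) * (4 * ww ^ 2) := le_mul_of_one_le_right (by positivity) (by nlinarith)
        _ = 4 * (ww ^ (j + k - 2) * ww ^ 2) := by ring
        _ = _ := by rw [← pow_add, Nat.sub_add_cancel h2]
    rw [h3]
    calc 2 * ((j : ℝ) + 1) * (k + 1) * ((p : ℝ) ^ (-(3 / 2 : ℝ)) * (p : ℝ) ^ (-(3 / 4 : ℝ) * ((j + k - 2 : ℕ) : ℝ)) * (p : ℝ) ^ ((j : ℝ) + k))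
        ≤ 2 * ((j : ℝ) + 1) * (k + 1) * ((p : ℝ) ^ (-(3 / 2 : ℝ)) * (4 * ww ^ (j + k)) * (p : ℝ) ^ ((j : ℝ) + k)) := by
          gcongr
      _ = _ := by unfold bb; dsimp only; ring

lemma FF_comm (q r : ℕ) : FF q r = FF r q := by
  unfold FF; rw [Mv_comm, mul_comm (q : ℝ)]

lemma local_bound (p j k : ℕ) (hp : p.Prime) (h : (j, k) ≠ (0, 0)) :
    |FF (p ^ j) (p ^ k)| ≤ (p : ℝ) ^ (-(3 / 2 : ℝ)) * bb (j, k) := by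
  have h' : ¬ (j = 0 ∧ k = 0) := by rintro ⟨rfl, rfl⟩; exact h rfl
  rcases le_total j k with hjk | hjk
  · exact local_bound' p j k hp hjk (by omega)
  · rw [FF_comm, show bb (j, k) = bb (k, j) by unfold bb; dsimp only; ring]
    exact local_bound' p k j hp hjk (by omega)

lemma DS_pow (F : ℕ → ℕ → ℝ) (p K : ℕ) (hp : p.Prime) :
    DS F (p ^ K) = ∑ z ∈ Finset.range (K + 1) ×ˢ Finset.range (K + 1), F (p ^ z.1) (p ^ z.2) := by
  unfold DS
  rw [Nat.sum_divisors_prime_pow hp, Finset.sum_product]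
  apply Finset.sum_congr rfl; intro j _
  rw [Nat.sum_divisors_prime_pow hp]

lemma DS_abs_le (p K : ℕ) (hp : p.Prime) :
    DS (fun q r => |FF q r|) (p ^ K) ≤ 1 + (p : ℝ) ^ (-(3 / 2 : ℝ)) * ∑' z, bb z := by
  rw [DS_pow _ p K hp, ← Finset.add_sum_erase _ _ (show ((0, 0) : ℕ × ℕ) ∈ _ by simp)]
  dsimp only
  rw [pow_zero, FF_one, abs_one]
  gcongr
  calc _ ≤ ∑ z ∈ (Finset.range (K + 1) ×ˢ Finset.range (K + 1)).erase (0, 0), (p : ℝ) ^ (-(3 / 2 : ℝ)) * bb z :=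
        Finset.sum_le_sum fun z hz => local_bound p z.1 z.2 hp (Finset.ne_of_mem_erase hz)
    _ ≤ _ := by
        rw [← Finset.mul_sum]
        gcongr
        exact bb_summable.sum_le_tsum _ (fun z _ => bb_nonneg z)

lemma DS_ell_le : ∃ C : ℝ, ∀ k, DS (fun q r => |FF q r|) (ell k) ≤ C := by
  have hs : Summable (fun p : ℕ => (p : ℝ) ^ (-(3 / 2 : ℝ)) * ∑' z, bb z) :=
    (Real.summable_nat_rpow.2 (by norm_num)).mul_right _
  have hB : 0 ≤ ∑' z, bb z := tsum_nonneg bb_nonneg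
  refine ⟨Real.exp (∑' p : ℕ, (p : ℝ) ^ (-(3 / 2 : ℝ)) * ∑' z, bb z), fun k => ?_⟩
  unfold ell
  rw [DS_prod]
  · calc _ ≤ ∏ p ∈ k.primesBelow, Real.exp ((p : ℝ) ^ (-(3 / 2 : ℝ)) * ∑' z, bb z) := by
          apply Finset.prod_le_prod
          · intro p _
            exact Finset.sum_nonneg fun _ _ => Finset.sum_nonneg fun _ _ => abs_nonneg _
          · intro p hp
            refine (DS_abs_le p k (Nat.prime_of_mem_primesBelow hp)).trans ?_
            rw [add_comm]; exact Real.add_one_le_exp _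
      _ ≤ _ := by
          rw [← Real.exp_sum]
          apply Real.exp_le_exp.2
          exact hs.sum_le_tsum _ (fun p _ => by positivity)
  · intro q1 r1 q2 r2 h h1 h2 h3 h4
    rw [FF_mul q1 r1 q2 r2 h h1 h2 h3 h4, abs_mul]
  · simp [FF_one]
  · intro p hp; exact Nat.prime_of_mem_primesBelow hp

lemma DS_eq_prod (F : ℕ → ℕ → ℝ) (l : ℕ) : DS F l = ∑ z ∈ l.divisors ×ˢ l.divisors, F z.1 z.2 := by
  rw [DS, Finset.sum_product]

lemma FF_zero (z : ℕ × ℕ) (h : ¬ (0 < z.1 ∧ 0 < z.2)) : FF z.1 z.2 = 0 := by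
  unfold FF
  have : z.1 = 0 ∨ z.2 = 0 := by omega
  rcases this with h | h <;> simp [h]

lemma subset_ell (u : Finset (ℕ × ℕ)) : ∃ k0, ∀ l, ell k0 ∣ l → 0 < l →
    u.filter (fun z => 0 < z.1 ∧ 0 < z.2) ⊆ l.divisors ×ˢ l.divisors := by
  refine ⟨u.sup (fun z => z.1 + z.2) + 1, fun l hl hl0 z hz => ?_⟩
  rw [Finset.mem_filter] at hz
  have h1 : z.1 + z.2 ≤ u.sup (fun z => z.1 + z.2) := Finset.le_sup (f := fun z : ℕ × ℕ => z.1 + z.2) hz.1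
  rw [Finset.mem_product, Nat.mem_divisors, Nat.mem_divisors]
  exact ⟨⟨(dvd_ell _ _ hz.2.1 (by omega)).trans hl, hl0.ne'⟩, ⟨(dvd_ell _ _ hz.2.2 (by omega)).trans hl, hl0.ne'⟩⟩

lemma FF_summable : Summable (fun z : ℕ × ℕ => FF z.1 z.2) := by
  obtain ⟨C, hC⟩ := DS_ell_le
  apply Summable.of_abs
  apply summable_of_sum_le (c := C) (fun z => abs_nonneg _)
  intro u
  obtain ⟨k, hk⟩ := subset_ell u
  refine le_trans ?_ (hC k)
  rw [DS_eq_prod]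
  calc ∑ z ∈ u, |FF z.1 z.2| = ∑ z ∈ u.filter (fun z => 0 < z.1 ∧ 0 < z.2), |FF z.1 z.2| := by
        symm
        apply Finset.sum_filter_of_ne
        intro z _ h
        by_contra h0
        exact h (by rw [FF_zero z h0, abs_zero])
    _ ≤ _ := Finset.sum_le_sum_of_subset_of_nonneg (hk _ dvd_rfl (ell_pos k)) (fun _ _ _ => abs_nonneg _)

lemma tot_tendsto (E : ℕ → ℝ)
    (hE : ∀ p : ℕ, p.Prime → Tendsto (fun K => DS FF (p ^ K)) atTop (nhds (E p))) :
    Tendsto (fun P : ℕ => ∏ p ∈ P.primesBelow, E p) atTop (nhds (∑' z : ℕ × ℕ, FF z.1 z.2)) := by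
  have hs := FF_summable.hasSum
  rw [Metric.tendsto_atTop]
  intro ε hε
  have h1 := (Metric.tendsto_nhds.1 hs) (ε / 2) (by linarith)
  simp only [SummationFilter.unconditional_filter, eventually_atTop] at h1
  obtain ⟨u, hu⟩ := h1
  obtain ⟨k, hk⟩ := subset_ell u
  refine ⟨k, fun P hP => ?_⟩
  have h2 : ∀ K, k ≤ K → dist (∏ p ∈ P.primesBelow, DS FF (p ^ K)) (∑' z : ℕ × ℕ, FF z.1 z.2) ≤ ε / 2 := by
    intro K hK
    rw [← DS_prod FF FF_mul FF_one K _ (fun p hp => Nat.prime_of_mem_primesBelow hp)]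
    set l := ∏ p ∈ P.primesBelow, p ^ K with hl
    have hl0 : 0 < l := Finset.prod_pos fun p hp => pow_pos (Nat.prime_of_mem_primesBelow hp).pos _
    have hd : ell k ∣ l := by
      have h1 : ell k ∣ ∏ p ∈ k.primesBelow, p ^ K :=
        Finset.prod_dvd_prod_of_dvd _ _ fun p _ => pow_dvd_pow _ hK
      refine h1.trans (Finset.prod_dvd_prod_of_subset _ _ _ ?_)
      intro p hp
      rw [Nat.mem_primesBelow] at *
      exact ⟨by omega, hp.2⟩
    have h3 := hk l hd hl0
    have h4 := hu (u ∪ (l.divisors ×ˢ l.divisors)) Finset.subset_union_left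
    have h5 : ∑ z ∈ u ∪ (l.divisors ×ˢ l.divisors), FF z.1 z.2 = DS FF l := by
      rw [DS_eq_prod]
      symm
      apply Finset.sum_subset Finset.subset_union_right
      intro z hz hz2
      apply FF_zero
      intro h0
      rcases Finset.mem_union.1 hz with h | h
      · exact hz2 (h3 (Finset.mem_filter.2 ⟨h, h0⟩))
      · exact hz2 h
    rw [h5] at h4
    exact h4.le
  have h6 : Tendsto (fun K => dist (∏ p ∈ P.primesBelow, DS FF (p ^ K)) (∑' z : ℕ × ℕ, FF z.1 z.2)) atTop
      (nhds (dist (∏ p ∈ P.primesBelow, E p) (∑' z : ℕ × ℕ, FF z.1 z.2))) :=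
    (tendsto_finsetProd _ fun p hp => hE p (Nat.prime_of_mem_primesBelow hp)).dist tendsto_const_nhds
  have h7 := le_of_tendsto h6 (eventually_atTop.2 ⟨k, h2⟩)
  linarith

end PF

namespace PF

lemma cast_eq_iff (p i j : ℕ) (h : i ≤ j) (A B : ℤ) :
    ZMod.castHom (pow_dvd_pow p h) (ZMod (p ^ i)) (A : ZMod (p ^ j)) = (B : ZMod (p ^ i)) ↔ (p : ℤ) ^ i ∣ A - B := by
  rw [map_intCast, ← sub_eq_zero, ← Int.cast_sub, ZMod.intCast_zmod_eq_zero_iff_dvd]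
  push_cast; rfl

lemma zero_iff (p j : ℕ) (A : ℤ) : (A : ZMod (p ^ j)) = 0 ↔ (p : ℤ) ^ j ∣ A := by
  rw [ZMod.intCast_zmod_eq_zero_iff_dvd]; push_cast; rfl

/-- number of `a` with `(a-b)(ab-1)=0` -/
noncomputable def cnt (q : ℕ) [NeZero q] (b : ZMod q) : ℕ :=
  (Finset.univ.filter (fun a : ZMod q => (a - b) * (a * b - 1) = 0)).card

lemma cnt_big (p j : ℕ) (hp : p.Prime) [NeZero (p ^ j)] (B : ℤ) (hB : IsCoprime (p : ℤ) B)
    (hD : (p : ℤ) ^ ((j + 1) / 2) ∣ B ^ 2 - 1) : cnt (p ^ j) (B : ZMod (p ^ j)) = p ^ (j / 2) := by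
  have : NeZero p := ⟨hp.ne_zero⟩
  have hmj : (j + 1) / 2 ≤ j := by omega
  have h1 := fiber_card (p ^ j) (p ^ ((j + 1) / 2)) (pow_dvd_pow p hmj) (B : ZMod (p ^ ((j + 1) / 2)))
  rw [Nat.pow_div hmj hp.pos, show j - (j + 1) / 2 = j / 2 by omega] at h1
  rw [← h1, cnt]
  congr 1
  apply Finset.filter_congr
  intro a _
  obtain ⟨A, rfl⟩ := ZMod.intCast_surjective a
  rw [cast_eq_iff p _ j hmj, ← Int.cast_sub, ← Int.cast_mul, ← Int.cast_one, ← Int.cast_sub, ← Int.cast_mul, zero_iff]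
  constructor
  · intro h
    rcases pow_dvd_or p j _ _ hp h with h | h
    · exact h
    · have h2 : (p : ℤ) ^ ((j + 1) / 2) ∣ B * (A - B) := by
        have := dvd_sub h hD
        rwa [show A * B - 1 - (B ^ 2 - 1) = B * (A - B) by ring] at this
      exact (hB.pow_left).dvd_of_dvd_mul_left h2
  · intro h
    have h2 : (p : ℤ) ^ ((j + 1) / 2) ∣ A * B - 1 := by
      have := dvd_add (h.mul_left B) hD
      rwa [show B * (A - B) + (B ^ 2 - 1) = A * B - 1 by ring] at this
    refine (pow_dvd_pow (p : ℤ) (show j ≤ (j + 1) / 2 + (j + 1) / 2 by omega)).trans ?_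
    rw [pow_add]
    exact mul_dvd_mul h h2

lemma dvd_prod_aux (p j w : ℕ) (hp : p.Prime) (X Y : ℤ) (hw : 2 * w < j) (h : (p : ℤ) ^ j ∣ X * Y)
    (hX : ¬ (p : ℤ) ^ (w + 1) ∣ X) : (p : ℤ) ^ (j - w) ∣ Y := by
  have hpp : Prime (p : ℤ) := Nat.prime_iff_prime_int.1 hp
  have hX0 : X ≠ 0 := by rintro rfl; exact hX (dvd_zero _)
  obtain ⟨v, X', hX', rfl⟩ : ∃ v X', ¬ (p : ℤ) ∣ X' ∧ X = (p : ℤ) ^ v * X' := by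
    have hf : FiniteMultiplicity (p : ℤ) X := Int.finiteMultiplicity_iff.2 ⟨by simpa using hp.one_lt.ne', hX0⟩
    obtain ⟨c, hc, hc2⟩ := hf.exists_eq_pow_mul_and_not_dvd
    exact ⟨_, c, hc2, hc⟩
  have hv : v ≤ w := by
    by_contra hv
    exact hX ((pow_dvd_pow _ (by omega)).mul_right _)
  have h1 : (p : ℤ) ^ (j - v) ∣ X' * Y := by
    have : (p : ℤ) ^ v * (p : ℤ) ^ (j - v) ∣ (p : ℤ) ^ v * (X' * Y) := by
      rw [← pow_add, ← mul_assoc, show v + (j - v) = j by omega]; exact h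
    exact (mul_dvd_mul_iff_left (pow_ne_zero _ hpp.ne_zero)).1 this
  have h2 : IsCoprime ((p : ℤ) ^ (j - v)) X' := ((Prime.coprime_iff_not_dvd hpp).2 hX').pow_left
  exact (pow_dvd_pow _ (by omega)).trans (h2.dvd_of_dvd_mul_left h1)

lemma cnt_small (p j w : ℕ) (hp : p.Prime) [NeZero (p ^ j)] (B : ℤ) (hB : IsCoprime (p : ℤ) B) (hw : 2 * w < j)
    (hD : (p : ℤ) ^ w ∣ B ^ 2 - 1) (hD2 : ¬ (p : ℤ) ^ (w + 1) ∣ B ^ 2 - 1) :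
    cnt (p ^ j) (B : ZMod (p ^ j)) = 2 * p ^ w := by
  have : NeZero p := ⟨hp.ne_zero⟩
  have hmj : j - w ≤ j := by omega
  obtain ⟨u, v, huv⟩ := hB.pow_left (m := j - w)
  have h1 := fiber_card (p ^ j) (p ^ (j - w)) (pow_dvd_pow p hmj) ((B : ℤ) : ZMod (p ^ (j - w)))
  have h2 := fiber_card (p ^ j) (p ^ (j - w)) (pow_dvd_pow p hmj) ((v : ℤ) : ZMod (p ^ (j - w)))
  rw [Nat.pow_div hmj hp.pos, show j - (j - w) = w by omega] at h1 h2
  rw [two_mul, cnt]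
  nth_rewrite 1 [← h1]
  rw [← h2, ← Finset.card_union_of_disjoint]
  · congr 1
    rw [← Finset.filter_or]
    apply Finset.filter_congr
    intro a _
    obtain ⟨A, rfl⟩ := ZMod.intCast_surjective a
    rw [cast_eq_iff p _ j hmj, cast_eq_iff p _ j hmj, ← Int.cast_sub, ← Int.cast_mul, ← Int.cast_one, ← Int.cast_sub, ← Int.cast_mul, zero_iff]
    have hv : (p : ℤ) ^ (j - w) ∣ A - v ↔ (p : ℤ) ^ (j - w) ∣ A * B - 1 := by
      have e1 : A * B - 1 = B * (A - v) + (-u) * (p : ℤ) ^ (j - w) := by linear_combination huv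
      rw [e1, dvd_add_left (dvd_mul_left _ _)]
      constructor
      · intro h; exact h.mul_left _
      · intro h; exact (hB.pow_left).dvd_of_dvd_mul_left h
    rw [hv]
    have e2 : A * B - 1 = B * (A - B) + (B ^ 2 - 1) := by ring
    constructor
    · intro h
      by_cases h3 : (p : ℤ) ^ (w + 1) ∣ A - B
      · left
        rw [mul_comm] at h
        apply dvd_prod_aux p j w hp _ _ hw h
        rw [e2, dvd_add_right (h3.mul_left B)]
        exact hD2
      · right
        exact dvd_prod_aux p j w hp _ _ hw h h3
    · have hww : (p : ℤ) ^ w ∣ (p : ℤ) ^ (j - w) := pow_dvd_pow _ (by omega)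
      have e3 : (p : ℤ) ^ j = (p : ℤ) ^ (j - w) * (p : ℤ) ^ w := by rw [← pow_add]; congr 1; omega
      rintro (h | h)
      · rw [e3]
        refine mul_dvd_mul h ?_
        rw [e2]
        exact dvd_add ((hww.trans h).mul_left B) hD
      · rw [e3, mul_comm]
        refine mul_dvd_mul ?_ h
        have : (p : ℤ) ^ w ∣ B * (A - B) := by
          have := dvd_sub (hww.trans h) hD
          rwa [show A * B - 1 - (B ^ 2 - 1) = B * (A - B) by ring] at this
        exact (hB.pow_left).dvd_of_dvd_mul_left this
  · rw [Finset.disjoint_filter]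
    intro a _ ha hb
    rw [ha, ← sub_eq_zero, ← Int.cast_sub, zero_iff] at hb
    apply hD2
    have e4 : B ^ 2 - 1 = B * (B - v) + (-u) * (p : ℤ) ^ (j - w) := by linear_combination huv
    have : (p : ℤ) ^ (j - w) ∣ B ^ 2 - 1 := by
      rw [e4]; exact dvd_add (hb.mul_left _) (dvd_mul_left _ _)
    exact (pow_dvd_pow _ (by omega)).trans this

lemma cnt_formula (p j : ℕ) (hp : p.Prime) [NeZero (p ^ j)] (hj : 1 ≤ j) (B : ℤ) (hB : IsCoprime (p : ℤ) B) :
    (cnt (p ^ j) (B : ZMod (p ^ j)) : ℝ) =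
      2 + ∑ i ∈ Finset.Ico 1 ((j + 1) / 2), (if (p : ℤ) ^ i ∣ B ^ 2 - 1 then 2 * ((p : ℝ) ^ i - (p : ℝ) ^ (i - 1)) else 0)
       + (if (p : ℤ) ^ ((j + 1) / 2) ∣ B ^ 2 - 1 then (p : ℝ) ^ (j / 2) - 2 * (p : ℝ) ^ ((j + 1) / 2 - 1) else 0) := by
  have tele : ∀ w : ℕ, ∑ i ∈ Finset.Ico 1 (w + 1), (2 * ((p : ℝ) ^ i - (p : ℝ) ^ (i - 1))) = 2 * (p : ℝ) ^ w - 2 := by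
    intro w
    induction w with
    | zero => simp
    | succ w ih => rw [Finset.sum_Ico_succ_top (by omega), ih]; simp; ring
  by_cases hD : (p : ℤ) ^ ((j + 1) / 2) ∣ B ^ 2 - 1
  · rw [cnt_big p j hp B hB hD, if_pos hD]
    have h1 : ∀ i ∈ Finset.Ico 1 ((j + 1) / 2), (if (p : ℤ) ^ i ∣ B ^ 2 - 1 then 2 * ((p : ℝ) ^ i - (p : ℝ) ^ (i - 1)) else 0)
        = 2 * ((p : ℝ) ^ i - (p : ℝ) ^ (i - 1)) := by
      intro i hi
      rw [Finset.mem_Ico] at hi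
      exact if_pos ((pow_dvd_pow _ hi.2.le).trans hD)
    rw [Finset.sum_congr rfl h1]
    have := tele ((j + 1) / 2 - 1)
    rw [Nat.sub_add_cancel (by omega)] at this
    rw [this]
    push_cast; ring
  · have hex : ∃ w, ¬ (p : ℤ) ^ (w + 1) ∣ B ^ 2 - 1 := ⟨(j + 1) / 2 - 1, by rwa [Nat.sub_add_cancel (by omega)]⟩
    classical
    set w := Nat.find hex with hw
    have hw1 : ¬ (p : ℤ) ^ (w + 1) ∣ B ^ 2 - 1 := Nat.find_spec hex
    have hw2 : (p : ℤ) ^ w ∣ B ^ 2 - 1 := by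
      rcases Nat.eq_zero_or_pos w with h | h
      · rw [h]; simp
      · have := Nat.find_min hex (show w - 1 < Nat.find hex by omega)
        rw [not_not, Nat.sub_add_cancel h] at this
        exact this
    have hwj : w + 1 ≤ (j + 1) / 2 := by
      by_contra hc
      exact hD ((pow_dvd_pow _ (by omega)).trans hw2)
    rw [cnt_small p j w hp B hB (by omega) hw2 hw1, if_neg hD, ← Finset.sum_Ico_consecutive _ (show 1 ≤ w + 1 by omega) hwj]
    have h1 : ∀ i ∈ Finset.Ico 1 (w + 1), (if (p : ℤ) ^ i ∣ B ^ 2 - 1 then 2 * ((p : ℝ) ^ i - (p : ℝ) ^ (i - 1)) else 0)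
        = 2 * ((p : ℝ) ^ i - (p : ℝ) ^ (i - 1)) := by
      intro i hi
      rw [Finset.mem_Ico] at hi
      exact if_pos ((pow_dvd_pow _ (by omega)).trans hw2)
    have h2 : ∀ i ∈ Finset.Ico (w + 1) ((j + 1) / 2), (if (p : ℤ) ^ i ∣ B ^ 2 - 1 then 2 * ((p : ℝ) ^ i - (p : ℝ) ^ (i - 1)) else 0)
        = 0 := by
      intro i hi
      rw [Finset.mem_Ico] at hi
      exact if_neg (fun h => hw1 ((pow_dvd_pow _ hi.1).trans h))
    rw [Finset.sum_congr rfl h1, Finset.sum_congr rfl h2, tele]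
    push_cast; simp

/-- number of square roots of one -/
noncomputable def sq1 (q : ℕ) : ℕ := Nat.card {c : ZMod q // c ^ 2 = 1}

lemma sq1_eq (q : ℕ) [NeZero q] : sq1 q = (Finset.univ.filter (fun c : ZMod q => c ^ 2 = 1)).card := by
  rw [sq1, Nat.card_eq_fintype_card, Fintype.card_subtype]

lemma Nn_formula (p j : ℕ) (hp : p.Prime) [NeZero (p ^ j)] (hj : 1 ≤ j) :
    (Nn (p ^ j) : ℝ) / p ^ j = 2 * (1 - 1 / p) +
      ∑ i ∈ Finset.Ico 1 ((j + 1) / 2), 2 * (1 - 1 / (p : ℝ)) * (sq1 (p ^ i) : ℝ)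
       + ((p : ℝ) ^ (j / 2) - 2 * (p : ℝ) ^ ((j + 1) / 2 - 1)) / p ^ ((j + 1) / 2) * sq1 (p ^ ((j + 1) / 2)) := by
  have : NeZero p := ⟨hp.ne_zero⟩
  have hp0 : (p : ℝ) ≠ 0 := by exact_mod_cast hp.ne_zero
  have h0 : (Nn (p ^ j) : ℝ) = ∑ b : ZMod (p ^ j), (if IsUnit b then (cnt (p ^ j) b : ℝ) else 0) := by
    rw [Nn, Finset.card_filter, Fintype.sum_prod_type_right]
    push_cast
    apply Finset.sum_congr rfl
    intro b _
    split_ifs with hb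
    · rw [cnt, Finset.card_filter]; push_cast
      apply Finset.sum_congr rfl; intro a _
      simp [hb]
    · simp [hb]
  -- auxiliary indicator
  let I : ℕ → ZMod (p ^ j) → ℝ := fun i b => if h : i ≤ j then (if (ZMod.castHom (pow_dvd_pow p h) (ZMod (p ^ i)) b) ^ 2 = 1 then 1 else 0) else 0
  have hI : ∀ i, i ≤ j → ∑ b : ZMod (p ^ j), I i b = (p : ℝ) ^ (j - i) * sq1 (p ^ i) := by
    intro i hi
    have := sum_zmod_cast (p ^ j) (p ^ i) (pow_dvd_pow p hi) (fun c => if c ^ 2 = 1 then (1 : ℝ) else 0)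
    simp only [I, dif_pos hi]
    rw [this, Nat.pow_div hi hp.pos, sq1_eq, Finset.card_filter]
    push_cast; rfl
  have hIB : ∀ i, i ≤ j → ∀ B : ℤ, I i (B : ZMod (p ^ j)) = if (p : ℤ) ^ i ∣ B ^ 2 - 1 then 1 else 0 := by
    intro i hi B
    simp only [I, dif_pos hi]
    congr 1
    rw [eq_iff_iff, map_intCast, ← sub_eq_zero, ← zero_iff]; push_cast; rfl
  have h1 : ∀ b : ZMod (p ^ j), (if IsUnit b then (cnt (p ^ j) b : ℝ) else 0) =
     2 * (if IsUnit b then 1 else 0) + ∑ i ∈ Finset.Ico 1 ((j + 1) / 2), (2 * ((p : ℝ) ^ i - (p : ℝ) ^ (i - 1))) * I i b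
       + ((p : ℝ) ^ (j / 2) - 2 * (p : ℝ) ^ ((j + 1) / 2 - 1)) * I ((j + 1) / 2) b := by
    intro b
    obtain ⟨B, rfl⟩ := ZMod.intCast_surjective b
    have hu : IsUnit (B : ZMod (p ^ j)) ↔ IsCoprime (p : ℤ) B := by
      rw [ZMod.coe_int_isUnit_iff_isCoprime]
      push_cast
      exact IsCoprime.pow_left_iff hj
    by_cases hB : IsCoprime (p : ℤ) B
    · rw [if_pos (hu.2 hB), if_pos (hu.2 hB), cnt_formula p j hp hj B hB, hIB _ (by omega)]
      rw [mul_one]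
      congr 1
      · congr 1
        apply Finset.sum_congr rfl
        intro i hi
        rw [Finset.mem_Ico] at hi
        rw [hIB i (by omega)]
        split_ifs <;> simp
      · split_ifs <;> simp
    · have hz : ∀ i, 1 ≤ i → i ≤ j → I i (B : ZMod (p ^ j)) = 0 := by
        intro i hi1 hij
        rw [hIB i hij, if_neg]
        intro hd
        apply hB
        have : (p : ℤ) ∣ B ^ 2 - 1 := (dvd_pow_self _ (by omega)).trans hd
        obtain ⟨c, hc⟩ := this
        exact ⟨-c, B, by linear_combination hc⟩
      rw [if_neg (mt hu.1 hB), if_neg (mt hu.1 hB), hz _ (by omega) (by omega)]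
      rw [Finset.sum_eq_zero]
      · simp
      · intro i hi
        rw [Finset.mem_Ico] at hi
        rw [hz i hi.1 (by omega), mul_zero]
  have hun : ∑ b : ZMod (p ^ j), (if IsUnit b then (1 : ℝ) else 0) = (p : ℝ) ^ j * (1 - 1 / p) := by
    have h2 := avg_r p j j hj le_rfl hp
    have h3 := sum_rho (p ^ j) (fun _ => 1)
    simp only [one_mul] at h3
    rw [avg, h3] at h2
    rw [← h2]; push_cast; field_simp
  rw [h0, Finset.sum_congr rfl (fun b _ => h1 b), Finset.sum_add_distrib, Finset.sum_add_distrib, ← Finset.mul_sum,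
    hun, Finset.sum_comm, ← Finset.mul_sum, hI _ (by omega), add_div, add_div, Finset.sum_div]
  congr 1
  · congr 1
    · field_simp
    · apply Finset.sum_congr rfl
      intro i hi
      rw [Finset.mem_Ico] at hi
      rw [← Finset.mul_sum, hI i (by omega)]
      obtain ⟨i, rfl⟩ := Nat.exists_eq_add_of_le' hi.1
      have e : (p : ℝ) ^ j = (p : ℝ) ^ (j - (i + 1)) * (p : ℝ) ^ i * p := by
        rw [mul_assoc, ← pow_succ, ← pow_add]; congr 1; omega
      rw [e, Nat.add_sub_cancel]
      field_simp
      ring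
  · have e : (p : ℝ) ^ j = (p : ℝ) ^ (j - (j + 1) / 2) * (p : ℝ) ^ ((j + 1) / 2) := by
      rw [← pow_add]; congr 1; omega
    rw [e]
    field_simp

lemma sq1_odd (p i : ℕ) (hp : p.Prime) (h2 : p ≠ 2) (hi : 1 ≤ i) : sq1 (p ^ i) = 2 := by
  have : NeZero p := ⟨hp.ne_zero⟩
  have hp3 : 3 ≤ p := by have := hp.two_le; omega
  have hpp : Prime (p : ℤ) := Nat.prime_iff_prime_int.1 hp
  have hn2 : ¬ (p : ℤ) ∣ 2 := by
    intro h
    have := Int.le_of_dvd (by norm_num) h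
    omega
  rw [sq1_eq]
  have : (Finset.univ.filter (fun c : ZMod (p ^ i) => c ^ 2 = 1)) = {1, -1} := by
    ext c
    simp only [Finset.mem_filter, Finset.mem_univ, true_and, Finset.mem_insert, Finset.mem_singleton]
    constructor
    · obtain ⟨C, rfl⟩ := ZMod.intCast_surjective c
      intro h
      have hd : (p : ℤ) ^ i ∣ (C - 1) * (C + 1) := by
        rw [← zero_iff]; push_cast; linear_combination h
      by_cases h1 : (p : ℤ) ∣ C - 1
      · left
        have h3 : ¬ (p : ℤ) ∣ C + 1 := fun h3 => hn2 (by have := dvd_sub h3 h1; rwa [show C + 1 - (C - 1) = 2 by ring] at this)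
        have := (((Prime.coprime_iff_not_dvd hpp).2 h3).pow_left (m := i)).dvd_of_dvd_mul_right hd
        rw [← zero_iff] at this
        push_cast at this
        linear_combination this
      · right
        have := (((Prime.coprime_iff_not_dvd hpp).2 h1).pow_left (m := i)).dvd_of_dvd_mul_left hd
        rw [← zero_iff] at this
        push_cast at this
        linear_combination this
    · rintro (rfl | rfl) <;> ring
  rw [this, Finset.card_pair]
  intro h
  have : ((2 : ℤ) : ZMod (p ^ i)) = 0 := by push_cast; linear_combination h
  rw [zero_iff] at this
  exact hn2 ((dvd_pow_self _ (by omega)).trans this)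

lemma sq1_two (i : ℕ) (hi : 3 ≤ i) : sq1 (2 ^ i) = 4 := by
  rw [sq1_eq]
  have hd : (2 : ℕ) ^ (i - 1) ∣ 2 ^ i := pow_dvd_pow 2 (by omega)
  have h1 := fiber_card (2 ^ i) (2 ^ (i - 1)) hd (((1 : ℤ)) : ZMod (2 ^ (i - 1)))
  have h2 := fiber_card (2 ^ i) (2 ^ (i - 1)) hd (((-1 : ℤ)) : ZMod (2 ^ (i - 1)))
  rw [Nat.pow_div (by omega) (by norm_num), show i - (i - 1) = 1 by omega] at h1 h2
  rw [show 4 = 2 ^ 1 + 2 ^ 1 by norm_num]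
  nth_rewrite 1 [← h1]
  rw [← h2, ← Finset.card_union_of_disjoint]
  · congr 1
    rw [← Finset.filter_or]
    apply Finset.filter_congr
    intro c _
    obtain ⟨C, rfl⟩ := ZMod.intCast_surjective c
    rw [cast_eq_iff 2 (i - 1) i (by omega), cast_eq_iff 2 (i - 1) i (by omega), sub_neg_eq_add]
    have : ((C : ZMod (2 ^ i)) ^ 2 = 1) ↔ ((2 : ℕ) : ℤ) ^ i ∣ (C - 1) * (C + 1) := by
      rw [← zero_iff, ← sub_eq_zero]; push_cast
      rw [show ((C : ZMod (2 ^ i)) - 1) * (C + 1) = C ^ 2 - 1 by ring]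
    rw [this]
    push_cast
    have e : (2 : ℤ) ^ i = 2 ^ (i - 1) * 2 := by rw [← pow_succ]; congr 1; omega
    constructor
    · intro h
      have h2 : (2 : ℤ) ∣ (C - 1) * (C + 1) := (dvd_pow_self _ (by omega)).trans h
      have hodd : (2 : ℤ) ∣ C - 1 := by
        rcases Int.prime_two.dvd_or_dvd h2 with h | h <;> omega
      obtain ⟨D, hD⟩ := hodd
      have hC : C = 2 * D + 1 := by omega
      subst hC
      have e2 : (2 : ℤ) ^ i = 2 ^ (i - 2) * 4 := by rw [show (4 : ℤ) = 2 ^ 2 by norm_num, ← pow_add]; congr 1; omega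
      have e3 : (2 : ℤ) ^ (i - 1) = 2 ^ (i - 2) * 2 := by rw [← pow_succ]; congr 1; omega
      have h3 : (2 : ℤ) ^ (i - 2) ∣ D * (D + 1) := by
        rw [e2, show (2 * D + 1 - 1) * (2 * D + 1 + 1) = (D * (D + 1)) * 4 by ring] at h
        exact (mul_dvd_mul_iff_right (by norm_num)).1 h
      rw [e3]
      rcases Int.even_or_odd D with hE | hO
      · left
        have hc : IsCoprime ((2 : ℤ) ^ (i - 2)) (D + 1) := by
          apply IsCoprime.pow_left
          obtain ⟨k, hk⟩ := hE
          exact ⟨-k, 1, by rw [hk]; ring⟩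
        have := hc.dvd_of_dvd_mul_right h3
        rw [show 2 * D + 1 - 1 = D * 2 by ring]
        exact mul_dvd_mul this dvd_rfl
      · right
        have hc : IsCoprime ((2 : ℤ) ^ (i - 2)) D := by
          apply IsCoprime.pow_left
          obtain ⟨k, hk⟩ := hO
          exact ⟨-k, 1, by rw [hk]; ring⟩
        have := hc.dvd_of_dvd_mul_left h3
        rw [show 2 * D + 1 + 1 = (D + 1) * 2 by ring]
        exact mul_dvd_mul this dvd_rfl
    · have h22 : (2 : ℤ) ∣ 2 ^ (i - 1) := dvd_pow_self _ (by omega)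
      rintro (h | h)
      · rw [e]
        refine mul_dvd_mul h ?_
        have := h22.trans h
        omega
      · rw [e, mul_comm]
        refine mul_dvd_mul ?_ h
        have := h22.trans h
        omega
  · rw [Finset.disjoint_filter]
    intro c _ ha hb
    rw [ha, ← sub_eq_zero, ← Int.cast_sub, zero_iff] at hb
    have h4 : (4 : ℤ) ∣ ((2 : ℕ) : ℤ) ^ (i - 1) := by
      rw [show (4 : ℤ) = ((2 : ℕ) : ℤ) ^ 2 by norm_num]
      exact pow_dvd_pow _ (by omega)
    have := h4.trans hb
    norm_num at this

lemma sq1_2 : sq1 (2 ^ 1) = 1 ∧ sq1 (2 ^ 2) = 2 := by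
  constructor
  · rw [sq1_eq]; decide
  · rw [sq1_eq]; decide

lemma f_odd (p j : ℕ) (hp : p.Prime) (h2 : p ≠ 2) (hj : 1 ≤ j) [NeZero (p ^ j)] :
    (Nn (p ^ j) : ℝ) / p ^ j = 2 * j * (1 - 1 / p) - 2 / p := by
  have hp0 : (p : ℝ) ≠ 0 := by exact_mod_cast hp.ne_zero
  rw [Nn_formula p j hp hj, sq1_odd p _ hp h2 (by omega)]
  have h1 : ∀ i ∈ Finset.Ico 1 ((j + 1) / 2), 2 * (1 - 1 / (p : ℝ)) * (sq1 (p ^ i) : ℝ) = 4 * (1 - 1 / p) := by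
    intro i hi
    rw [Finset.mem_Ico] at hi
    rw [sq1_odd p i hp h2 hi.1]; push_cast; ring
  rw [Finset.sum_congr rfl h1, Finset.sum_const, Nat.card_Ico, nsmul_eq_mul]
  rcases Nat.even_or_odd' j with ⟨m, rfl | rfl⟩
  · obtain ⟨m, rfl⟩ := Nat.exists_eq_add_of_le' (show 1 ≤ m by omega)
    rw [show (2 * (m + 1) + 1) / 2 = m + 1 by omega, show 2 * (m + 1) / 2 = m + 1 by omega]
    push_cast [Nat.add_sub_cancel, pow_succ]
    field_simp
    ring
  · rw [show (2 * m + 1 + 1) / 2 = m + 1 by omega, show (2 * m + 1) / 2 = m by omega]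
    push_cast [Nat.add_sub_cancel, pow_succ]
    field_simp
    ring

lemma f_two (j : ℕ) (hj : 5 ≤ j) [NeZero (2 ^ j)] :
    (Nn (2 ^ j) : ℝ) / 2 ^ j = 2 * j - 8 := by
  have h0 := Nn_formula 2 j Nat.prime_two (by omega)
  push_cast at h0
  rw [h0, sq1_two _ (by omega)]
  have h1 : ∀ m : ℕ, 3 ≤ m → ∑ i ∈ Finset.Ico 1 m, 2 * (1 - 1 / (2 : ℝ)) * (sq1 (2 ^ i) : ℝ) = 3 + 4 * (m - 3) := by
    intro m hm
    induction m, hm using Nat.le_induction with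
    | base =>
      rw [show Finset.Ico 1 3 = {1, 2} by decide, Finset.sum_pair (by norm_num), sq1_2.1, sq1_2.2]; norm_num
    | succ m hm ih =>
      rw [Finset.sum_Ico_succ_top (by omega), ih, sq1_two m hm]; push_cast; ring
  rw [h1 _ (by omega)]
  rcases Nat.even_or_odd' j with ⟨m, rfl | rfl⟩
  · obtain ⟨m, rfl⟩ := Nat.exists_eq_add_of_le' (show 1 ≤ m by omega)
    rw [show (2 * (m + 1) + 1) / 2 = m + 1 by omega, show 2 * (m + 1) / 2 = m + 1 by omega]
    push_cast [Nat.add_sub_cancel, pow_succ]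
    field_simp
    ring
  · rw [show (2 * m + 1 + 1) / 2 = m + 1 by omega, show (2 * m + 1) / 2 = m by omega]
    push_cast [Nat.add_sub_cancel, pow_succ]
    field_simp
    ring

lemma f_two_small : (Nn (2 ^ 1) : ℝ) / 2 ^ 1 = 1 / 2 ∧ (Nn (2 ^ 2) : ℝ) / 2 ^ 2 = 1 ∧
    (Nn (2 ^ 3) : ℝ) / 2 ^ 3 = 1 ∧ (Nn (2 ^ 4) : ℝ) / 2 ^ 4 = 2 := by
  have h1 := Nn_formula 2 1 Nat.prime_two (by norm_num)
  have h2 := Nn_formula 2 2 Nat.prime_two (by norm_num)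
  have h3 := Nn_formula 2 3 Nat.prime_two (by norm_num)
  have h4 := Nn_formula 2 4 Nat.prime_two (by norm_num)
  have hs := sq1_2
  simp only [show (1 + 1) / 2 = 1 by norm_num, show (2 + 1) / 2 = 1 by norm_num, show (3 + 1) / 2 = 2 by norm_num,
    show (4 + 1) / 2 = 2 by norm_num, show Finset.Ico 1 2 = {1} by decide, Finset.Ico_self, Finset.sum_singleton,
    Finset.sum_empty, hs.1, hs.2] at h1 h2 h3 h4
  push_cast at h1 h2 h3 h4
  exact ⟨h1.trans (by norm_num), h2.trans (by norm_num), h3.trans (by norm_num), h4.trans (by norm_num)⟩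

end PF

namespace PF

noncomputable def RK (p K n : ℕ) : ℝ := ∑ i ∈ Finset.range K, (rho n (p ^ i) : ℝ) * (1 / p : ℝ) ^ i
noncomputable def GK (p K n : ℕ) : ℝ := ∑ i ∈ Finset.range K, (lam n (p ^ i) : ℝ) * (1 / p : ℝ) ^ i

lemma RK_eq (p K n : ℕ) (hp : p.Prime) : RK p (K + 1) n = GK p (K + 1) n + 1 / p * GK p K n := by
  induction K with
  | zero => simp [RK, GK, rho_one, lam_one]
  | succ K ih =>
    rw [RK, Finset.sum_range_succ, ← RK, ih]
    conv_rhs => rw [GK, Finset.sum_range_succ, ← GK]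
    have h : GK p (K + 1) n = GK p K n + (lam n (p ^ K) : ℝ) * (1 / p : ℝ) ^ K := by
      rw [GK, Finset.sum_range_succ, ← GK]
    have h2 := lam_succ n p K hp
    have h3 : (rho n (p ^ (K + 1)) : ℝ) = (lam n (p ^ (K + 1)) : ℝ) + lam n (p ^ K) := by
      rw [h2]; push_cast; ring
    rw [h3]
    nth_rewrite 3 [h]
    ring

lemma avg_GK (p a b L : ℕ) (hp : p.Prime) (ha : a ≤ L + 1) (hb : b ≤ L + 1) :
    avg (fun n => GK p a n * GK p b n) (p ^ L) =
      ∑ z ∈ Finset.range a ×ˢ Finset.range b, FF (p ^ z.1) (p ^ z.2) := by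
  have hp0 : (p : ℝ) ≠ 0 := by exact_mod_cast hp.ne_zero
  simp only [GK, Finset.sum_mul_sum]
  rw [avg_sum, Finset.sum_product]
  apply Finset.sum_congr rfl; intro j hj
  rw [avg_sum]
  apply Finset.sum_congr rfl; intro k hk
  rw [Finset.mem_range] at hj hk
  rw [FF, Mv_eq (p ^ j) (p ^ k) (p ^ L) (pow_pos hp.pos _) (pow_dvd_pow p (by omega)) (pow_dvd_pow p (by omega))]
  rw [show (fun n => (lam n (p ^ j) : ℝ) * (1 / p : ℝ) ^ j * ((lam n (p ^ k) : ℝ) * (1 / p : ℝ) ^ k)) =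
    fun n => ((1 / p : ℝ) ^ j * (1 / p : ℝ) ^ k) * ((lam n (p ^ j) : ℝ) * lam n (p ^ k)) by ext n; ring, avg_smul]
  push_cast
  rw [one_div, inv_pow, inv_pow]
  field_simp

lemma FFp_summable (p : ℕ) (hp : p.Prime) : Summable (fun z : ℕ × ℕ => FF (p ^ z.1) (p ^ z.2)) := by
  have h1 : Summable (fun z : ℕ × ℕ => (p : ℝ) ^ (-(3 / 2 : ℝ)) * bb z) := bb_summable.mul_left _
  refine Summable.of_norm_bounded_eventually h1 ?_
  rw [Filter.eventually_cofinite]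
  refine (Set.finite_singleton ((0, 0) : ℕ × ℕ)).subset ?_
  intro z hz
  by_contra h
  exact hz (local_bound p z.1 z.2 hp h)

lemma rect_tendsto (p : ℕ) (hp : p.Prime) (a b : ℕ → ℕ) (ha : Tendsto a atTop atTop) (hb : Tendsto b atTop atTop) :
    Tendsto (fun K => ∑ z ∈ Finset.range (a K) ×ˢ Finset.range (b K), FF (p ^ z.1) (p ^ z.2)) atTop
      (nhds (∑' z : ℕ × ℕ, FF (p ^ z.1) (p ^ z.2))) := by
  have h := (FFp_summable p hp).hasSum
  have hab : Tendsto (fun K => Finset.range (a K) ×ˢ Finset.range (b K)) atTop atTop := by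
    rw [tendsto_atTop]
    intro u
    filter_upwards [ha.eventually_gt_atTop (u.sup Prod.fst), hb.eventually_gt_atTop (u.sup Prod.snd)] with K h1 h2
    intro z hz
    rw [Finset.mem_product, Finset.mem_range, Finset.mem_range]
    exact ⟨(Finset.le_sup (f := Prod.fst) hz).trans_lt h1, (Finset.le_sup (f := Prod.snd) hz).trans_lt h2⟩
  rw [HasSum, SummationFilter.unconditional_filter] at h
  exact h.comp hab

lemma avg_RK_tendsto (p : ℕ) (hp : p.Prime) :
    Tendsto (fun K => avg (fun n => RK p (K + 1) n ^ 2) (p ^ K)) atTop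
      (nhds ((1 + 1 / p) ^ 2 * ∑' z : ℕ × ℕ, FF (p ^ z.1) (p ^ z.2))) := by
  have hs : Tendsto (fun K : ℕ => K + 1) atTop atTop := tendsto_add_atTop_nat 1
  have h1 := rect_tendsto p hp (fun K => K + 1) (fun K => K + 1) hs hs
  have h2 := rect_tendsto p hp (fun K => K) (fun K => K + 1) tendsto_id hs
  have h3 := rect_tendsto p hp (fun K => K) (fun K => K) tendsto_id tendsto_id
  have h4 := (h1.add (h2.const_mul (2 * (1 / p : ℝ)))).add (h3.const_mul ((1 / p : ℝ) ^ 2))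
  rw [show ∀ S : ℝ, (1 + 1 / (p : ℝ)) ^ 2 * S = S + 2 * (1 / p : ℝ) * S + (1 / p : ℝ) ^ 2 * S by intro S; ring]
  refine h4.congr fun K => ?_
  rw [← avg_GK p _ _ K hp le_rfl le_rfl, ← avg_GK p _ _ K hp (by omega) le_rfl, ← avg_GK p _ _ K hp (by omega) (by omega),
    ← avg_smul, ← avg_smul, ← avg_add, ← avg_add]
  congr 1
  ext n
  rw [RK_eq p K n hp]; ring

lemma RK_add (p K n q : ℕ) (h : p ^ K ∣ q) : RK p (K + 1) (n + q) = RK p (K + 1) n := by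
  unfold RK
  apply Finset.sum_congr rfl
  intro i hi
  rw [Finset.mem_range] at hi
  rw [rho_add n q p i ((pow_dvd_pow p (by omega)).trans h)]

lemma avg_RK (p : ℕ) (hp : p.Prime) (f : ℕ → ℝ)
    (hf : ∀ j, 1 ≤ j → ∀ _ : NeZero (p ^ j), (Nn (p ^ j) : ℝ) / p ^ j = f j) (K : ℕ) :
    avg (fun n => RK p (K + 1) n ^ 2) (p ^ K) = 1 + 2 * (1 / p : ℝ)
      + (1 + 2 * (1 / p : ℝ) / (1 - 1 / p)) * ∑ i ∈ Finset.range K, f (i + 1) * ((1 / p : ℝ) ^ 2) ^ (i + 1)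
      - 2 / (1 - 1 / p) * (1 / p : ℝ) ^ (K + 1) * ((1 - 1 / p) + ∑ i ∈ Finset.range K, f (i + 1) * (1 / p : ℝ) ^ (i + 1)) := by
  have hp1 : (1 : ℝ) < p := by exact_mod_cast hp.one_lt
  have hx : (1 : ℝ) - 1 / p ≠ 0 := by
    rw [sub_ne_zero]; intro h; rw [eq_comm, div_eq_one_iff_eq (by linarith)] at h; linarith
  have : NeZero p := ⟨hp.ne_zero⟩
  induction K with
  | zero =>
    simp only [RK, zero_add, Finset.sum_range_one, pow_zero, rho_one, Finset.range_zero, Finset.sum_empty]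
    rw [avg_const _ _ one_pos]
    generalize (1 / p : ℝ) = x at *
    push_cast
    field_simp
    ring
  | succ K ih =>
    have e1 : (fun n => RK p (K + 1 + 1) n ^ 2) = fun n => (RK p (K + 1) n ^ 2 +
       2 * (1 / p : ℝ) ^ (K + 1) * ∑ i ∈ Finset.range (K + 1), (1 / p : ℝ) ^ i * ((rho n (p ^ i) : ℝ) * rho n (p ^ (K + 1))))
       + ((1 / p : ℝ) ^ 2) ^ (K + 1) * ((rho n (p ^ (K + 1)) : ℝ) * rho n (p ^ (K + 1))) := by
      ext n
      have : ∑ i ∈ Finset.range (K + 1), (1 / p : ℝ) ^ i * ((rho n (p ^ i) : ℝ) * rho n (p ^ (K + 1))) =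
          RK p (K + 1) n * rho n (p ^ (K + 1)) := by
        rw [RK, Finset.sum_mul]
        apply Finset.sum_congr rfl; intro i _; ring
      rw [this]
      conv_lhs => rw [RK, Finset.sum_range_succ, ← RK]
      rw [← pow_mul]
      ring
    rw [e1, avg_add, avg_add, avg_smul, avg_smul, avg_sum,
      avg_dvd (fun n => RK p (K + 1) n ^ 2) (p ^ K) (p ^ (K + 1)) (pow_pos hp.pos _) (pow_dvd_pow p (by omega))
        (fun n => by rw [RK_add p K n _ dvd_rfl]), ih,
      avg_rr p (K + 1) (K + 1) (K + 1) (by omega) le_rfl le_rfl hp, hf _ (by omega), Finset.sum_range_succ' _ K]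
    have e2 : ∀ i ∈ Finset.range K, avg (fun n => (1 / p : ℝ) ^ (i + 1) * ((rho n (p ^ (i + 1)) : ℝ) * rho n (p ^ (K + 1)))) (p ^ (K + 1))
        = f (i + 1) * (1 / p : ℝ) ^ (i + 1) := by
      intro i hi
      rw [Finset.mem_range] at hi
      rw [avg_smul, avg_rr p (i + 1) (K + 1) (K + 1) (by omega) (by omega) le_rfl hp, hf _ (by omega), mul_comm]
    have e3 : avg (fun n => (1 / p : ℝ) ^ 0 * ((rho n (p ^ 0) : ℝ) * rho n (p ^ (K + 1)))) (p ^ (K + 1)) = 1 - 1 / p := by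
      simp only [pow_zero, rho_one, Nat.cast_one, one_mul]
      exact avg_r p (K + 1) (K + 1) (by omega) le_rfl hp
    rw [Finset.sum_congr rfl e2, e3, Finset.sum_range_succ _ K, Finset.sum_range_succ _ K]
    generalize ∑ i ∈ Finset.range K, f (i + 1) * (1 / p : ℝ) ^ (i + 1) = S1
    generalize ∑ i ∈ Finset.range K, f (i + 1) * ((1 / p : ℝ) ^ 2) ^ (i + 1) = S2
    generalize f (K + 1) = F
    generalize (1 / p : ℝ) = x at *
    rw [← pow_mul, pow_succ x (K + 1), show x ^ (2 * (K + 1)) = (x ^ (K + 1)) ^ 2 by rw [← pow_mul, mul_comm]]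
    generalize x ^ (K + 1) = y
    field_simp
    ring

lemma local_value (p : ℕ) (hp : p.Prime) (f : ℕ → ℝ)
    (hf : ∀ j, 1 ≤ j → ∀ _ : NeZero (p ^ j), (Nn (p ^ j) : ℝ) / p ^ j = f j) (S : ℝ)
    (hS : HasSum (fun i => f (i + 1) * ((1 / p : ℝ) ^ 2) ^ (i + 1)) S)
    (hS1 : Summable (fun i => f (i + 1) * (1 / p : ℝ) ^ (i + 1))) :
    (1 + 1 / p) ^ 2 * ∑' z : ℕ × ℕ, FF (p ^ z.1) (p ^ z.2) =
      1 + 2 * (1 / p : ℝ) + (1 + 2 * (1 / p : ℝ) / (1 - 1 / p)) * S := by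
  have h1 := avg_RK_tendsto p hp
  simp only [avg_RK p hp f hf] at h1
  have hp1 : (1 : ℝ) < p := by exact_mod_cast hp.one_lt
  have hx : Tendsto (fun K : ℕ => (1 / p : ℝ) ^ (K + 1)) atTop (nhds 0) :=
    (tendsto_pow_atTop_nhds_zero_of_lt_one (by positivity) (by rw [div_lt_one (by linarith)]; exact hp1)).comp (tendsto_add_atTop_nat 1)
  have h2 := (hS.tendsto_sum_nat.const_mul (1 + 2 * (1 / p : ℝ) / (1 - 1 / p))).const_add (1 + 2 * (1 / p : ℝ))
  have h3 := (hx.const_mul (2 / (1 - 1 / p : ℝ))).mul ((hS1.hasSum.tendsto_sum_nat).const_add (1 - 1 / p : ℝ))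
  have h4 := h2.sub h3
  rw [mul_zero, zero_mul, sub_zero] at h4
  exact tendsto_nhds_unique h1 h4

noncomputable def Ep (p : ℕ) : ℝ := ∑' z : ℕ × ℕ, FF (p ^ z.1) (p ^ z.2)

lemma Ep_tendsto (p : ℕ) (hp : p.Prime) : Tendsto (fun K => DS FF (p ^ K)) atTop (nhds (Ep p)) := by
  have hs : Tendsto (fun K : ℕ => K + 1) atTop atTop := tendsto_add_atTop_nat 1
  refine (rect_tendsto p hp (fun K => K + 1) (fun K => K + 1) hs hs).congr fun K => ?_
  rw [DS_pow FF p K hp]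

lemma hasSum_lin (y a b : ℝ) (h0 : 0 ≤ y) (h1 : y < 1) :
    HasSum (fun i : ℕ => (a * ((i + 1 : ℕ) : ℝ) + b) * y ^ (i + 1)) (a * (y / (1 - y) ^ 2) + b * (y / (1 - y))) := by
  have hy : ‖y‖ < 1 := by rw [Real.norm_eq_abs, abs_of_nonneg h0]; exact h1
  have hg := hasSum_geometric_of_lt_one h0 h1
  have hc := hasSum_coe_mul_geometric_of_norm_lt_one hy
  have hy1 : 1 - y ≠ 0 := by linarith
  have h := ((hc.mul_left (a * y)).add (hg.mul_left ((a + b) * y)))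
  convert h using 1
  · rfl
  · funext i
    rw [Nat.cast_add_one]
    ring
  · rw [← one_div]
    field_simp
    ring

lemma Ep_odd (p : ℕ) (hp : p.Prime) (h2 : p ≠ 2) :
    Ep p = 1 + ((p : ℝ) ^ 4 - 2 * (p : ℝ) ^ 3 + 1) / ((p : ℝ) ^ 2 - 1) ^ 3 := by
  have hp1 : (1 : ℝ) < p := by exact_mod_cast hp.one_lt
  have hx1 : (1 / p : ℝ) < 1 := by rw [div_lt_one (by linarith)]; exact hp1
  have hx0 : (0 : ℝ) ≤ 1 / p := by positivity
  have hS := hasSum_lin ((1 / p : ℝ) ^ 2) (2 * (1 - 1 / p)) (-(2 / p)) (by positivity) (by nlinarith)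
  have hS1 := hasSum_lin (1 / p : ℝ) (2 * (1 - 1 / p)) (-(2 / p)) (by positivity) hx1
  have h := local_value p hp (fun j => 2 * (1 - 1 / p) * (j : ℝ) + -(2 / p)) (fun j hj _ => by
    rw [f_odd p j hp h2 hj]; ring) _ hS hS1.summable
  rw [← Ep] at h
  have hq : (p : ℝ) ^ 2 - 1 ≠ 0 := by nlinarith
  have hq1 : (p : ℝ) - 1 ≠ 0 := by linarith
  have hq2 : (p : ℝ) + 1 ≠ 0 := by linarith
  have e : Ep p = ((1 + 1 / p : ℝ) ^ 2)⁻¹ * ((1 + 1 / p) ^ 2 * Ep p) := by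
    field_simp
  rw [e, h]
  generalize (p : ℝ) = P at *
  have hP : P ≠ 0 := by linarith
  have e1 : (1 : ℝ) - (1 / P) ^ 2 = (P ^ 2 - 1) / P ^ 2 := by field_simp
  have e2 : (1 : ℝ) - (1 / P) = (P - 1) / P := by field_simp
  have e3 : (1 : ℝ) + (1 / P) = (P + 1) / P := by field_simp
  rw [e1, e2, e3, show P ^ 2 - 1 = (P - 1) * (P + 1) by ring]
  field_simp
  ring

lemma Ep_two : Ep 2 = 1015 / 864 := by
  let f : ℕ → ℝ := fun j => if j = 1 then 1 / 2 else if j = 2 then 1 else if j = 3 then 1 else if j = 4 then 2 else 2 * j - 8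
  have hsm : ∀ y : ℝ, 0 ≤ y → y < 1 → HasSum (fun i => f (i + 1) * y ^ (i + 1))
      ((2 * (y / (1 - y) ^ 2) + (-8) * (y / (1 - y))) + (13 / 2 * y + 5 * y ^ 2 + 3 * y ^ 3 + 2 * y ^ 4)) := by
    intro y h0 h1
    have h := hasSum_lin y 2 (-8) h0 h1
    have h' : HasSum (fun i : ℕ => (f (i + 1) - (2 * ((i + 1 : ℕ) : ℝ) + (-8))) * y ^ (i + 1))
        (∑ i ∈ Finset.range 4, (f (i + 1) - (2 * ((i + 1 : ℕ) : ℝ) + (-8))) * y ^ (i + 1)) := by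
      apply hasSum_sum_of_ne_finset_zero
      intro i hi
      rw [Finset.mem_range] at hi
      simp only [f]
      rw [if_neg (by omega), if_neg (by omega), if_neg (by omega), if_neg (by omega)]
      ring
    convert h.add h' using 1
    · ext i; ring
    · simp [Finset.sum_range_succ, f]; ring
  have hS := hsm (((1 / (2 : ℕ) : ℝ)) ^ 2) (by positivity) (by norm_num)
  have hS1 := hsm (1 / (2 : ℕ) : ℝ) (by positivity) (by norm_num)
  have h := local_value 2 Nat.prime_two f (fun j hj hi => by
    obtain ⟨a1, a2, a3, a4⟩ := f_two_small
    simp only [f]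
    split_ifs with c1 c2 c3 c4
    · subst c1; exact_mod_cast a1
    · subst c2; exact_mod_cast a2
    · subst c3; exact_mod_cast a3
    · subst c4; exact_mod_cast a4
    · have := f_two j (by omega)
      exact_mod_cast this) _ hS hS1.summable
  rw [← Ep] at h
  norm_num at h
  linarith

end PF

namespace PF

lemma kfac_bounds (p : ℕ) (hp : p.Prime) :
    0 ≤ ((p : ℝ) ^ 4 - 2 * (p : ℝ) ^ 3 + 1) / ((p : ℝ) ^ 2 - 1) ^ 3 ∧
    ((p : ℝ) ^ 4 - 2 * (p : ℝ) ^ 3 + 1) / ((p : ℝ) ^ 2 - 1) ^ 3 ≤ 8 * (1 / (p : ℝ) ^ 2) := by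
  have h2 : (2 : ℝ) ≤ p := by exact_mod_cast hp.two_le
  generalize (p : ℝ) = x at *
  have h3 : x ^ 2 / 2 ≤ x ^ 2 - 1 := by nlinarith
  have h4 : (x ^ 2 / 2) ^ 3 ≤ (x ^ 2 - 1) ^ 3 := pow_le_pow_left₀ (by positivity) h3 3
  have h5 : 0 < (x ^ 2 - 1) ^ 3 := lt_of_lt_of_le (by positivity) h4
  have h6 : 1 ≤ x ^ 3 := one_le_pow₀ (by linarith)
  have h7 : x ^ 4 - 2 * x ^ 3 = x ^ 3 * (x - 2) := by ring
  have h8 : 0 ≤ x ^ 3 * (x - 2) := mul_nonneg (by positivity) (by linarith)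
  refine ⟨div_nonneg (by linarith) h5.le, ?_⟩
  have h9 : 0 < x ^ 2 := by positivity
  rw [div_le_iff₀ h5]
  calc x ^ 4 - 2 * x ^ 3 + 1 ≤ x ^ 4 := by linarith
    _ = 8 * (1 / x ^ 2) * (x ^ 2 / 2) ^ 3 := by field_simp; norm_num
    _ ≤ _ := mul_le_mul_of_nonneg_left h4 (by positivity)

lemma kfac_summable : Summable (fun p : {p : ℕ // p.Prime ∧ p ≠ 2} =>
    ((p.1 : ℝ) ^ 4 - 2 * (p.1 : ℝ) ^ 3 + 1) / ((p.1 : ℝ) ^ 2 - 1) ^ 3) := by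
  have h : Summable (fun n : ℕ => 8 * (1 / (n : ℝ) ^ 2)) :=
    (Real.summable_one_div_nat_pow.2 (by norm_num)).mul_left 8
  exact Summable.of_nonneg_of_le (fun p => (kfac_bounds p.1 p.2.1).1) (fun p => (kfac_bounds p.1 p.2.1).2)
    (h.comp_injective Subtype.val_injective)

lemma prodE_tendsto : Tendsto (fun P : ℕ => ∏ p ∈ P.primesBelow, Ep p) atTop (nhds kappa) := by
  have hm := (Real.multipliable_one_add_of_summable kfac_summable).hasProd
  rw [HasProd, SummationFilter.unconditional_filter] at hm
  have ht : Tendsto (fun P : ℕ => (Finset.range P).subtype (fun p : ℕ => p.Prime ∧ p ≠ 2)) atTop atTop := by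
    rw [tendsto_atTop]
    intro u
    filter_upwards [eventually_gt_atTop (u.sup Subtype.val)] with K h1
    intro z hz
    rw [Finset.mem_subtype, Finset.mem_range]
    exact (Finset.le_sup (f := Subtype.val) hz).trans_lt h1
  have h := (hm.comp ht).const_mul (1015 / 864 : ℝ)
  rw [← kappa] at h
  refine h.congr' ?_
  filter_upwards [eventually_ge_atTop 3] with P hP
  have e1 : P.primesBelow = insert 2 ((Finset.range P).filter (fun p => p.Prime ∧ p ≠ 2)) := by
    ext p
    simp only [Nat.mem_primesBelow, Finset.mem_insert, Finset.mem_filter, Finset.mem_range]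
    constructor
    · rintro ⟨a, b⟩; by_cases c : p = 2 <;> simp [*]
    · rintro (rfl | ⟨a, b, c⟩)
      · exact ⟨by omega, Nat.prime_two⟩
      · exact ⟨a, b⟩
  rw [e1, Finset.prod_insert (by simp), Ep_two]
  congr 1
  simp only [Function.comp]
  rw [Finset.prod_subtype_eq_prod_filter (s := Finset.range P) (p := fun p : ℕ => p.Prime ∧ p ≠ 2)
    (fun p : ℕ => 1 + ((p : ℝ) ^ 4 - 2 * (p : ℝ) ^ 3 + 1) / ((p : ℝ) ^ 2 - 1) ^ 3)]
  apply Finset.prod_congr rfl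
  intro p hp
  rw [Finset.mem_filter] at hp
  rw [Ep_odd p hp.2.1 hp.2.2]

lemma tot_eq : ∑' z : ℕ × ℕ, FF z.1 z.2 = kappa :=
  tendsto_nhds_unique (tot_tendsto Ep Ep_tendsto) prodE_tendsto

lemma kappa_pos : 0 < kappa := by
  have hm := (Real.multipliable_one_add_of_summable kfac_summable).hasProd
  have h1 : (1 : ℝ) ≤ ∏' p : {p : ℕ // p.Prime ∧ p ≠ 2},
    (1 + ((p.1 : ℝ) ^ 4 - 2 * (p.1 : ℝ) ^ 3 + 1) / ((p.1 : ℝ) ^ 2 - 1) ^ 3) := by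
    rw [HasProd, SummationFilter.unconditional_filter] at hm
    refine ge_of_tendsto' hm fun s => ?_
    have := Finset.prod_le_prod (s := s) (f := fun _ => (1 : ℝ)) (g := fun p => (1 + ((p.1 : ℝ) ^ 4 - 2 * (p.1 : ℝ) ^ 3 + 1) / ((p.1 : ℝ) ^ 2 - 1) ^ 3))
      (fun _ _ => zero_le_one) (fun p _ => by have := (kfac_bounds p.1 p.2.1).1; linarith)
    simpa using this
  rw [kappa]
  positivity

/-- truncated sum -/
noncomputable def SY (Y n : ℕ) : ℝ := ∑ q ∈ Finset.Ioc 0 Y, (lam n q : ℝ) / q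

lemma second_moment (N Y : ℕ) :
    |∑ n ∈ Finset.Icc 3 N, SY Y n ^ 2 - N * ∑ z ∈ Finset.Ioc 0 Y ×ˢ Finset.Ioc 0 Y, FF z.1 z.2| ≤ 6 * (Y : ℝ) ^ 6 := by
  have e : ∑ n ∈ Finset.Icc 3 N, SY Y n ^ 2 = ∑ z ∈ Finset.Ioc 0 Y ×ˢ Finset.Ioc 0 Y,
      (1 / ((z.1 : ℝ) * z.2)) * ∑ n ∈ Finset.Icc 3 N, (lam n z.1 : ℝ) * lam n z.2 := by
    simp only [Finset.mul_sum]
    rw [Finset.sum_comm]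
    apply Finset.sum_congr rfl
    intro n _
    rw [sq, SY, Finset.sum_mul_sum, Finset.sum_product]
    apply Finset.sum_congr rfl; intro q _
    apply Finset.sum_congr rfl; intro r _
    rw [div_mul_div_comm]; ring
  rw [e, Finset.mul_sum, ← Finset.sum_sub_distrib]
  refine (Finset.abs_sum_le_sum_abs _ _).trans ?_
  have hb : ∀ z ∈ Finset.Ioc 0 Y ×ˢ Finset.Ioc 0 Y,
      |(1 / ((z.1 : ℝ) * z.2)) * ∑ n ∈ Finset.Icc 3 N, (lam n z.1 : ℝ) * lam n z.2 - N * FF z.1 z.2| ≤ 6 * (Y : ℝ) ^ 4 := by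
    rintro ⟨q, r⟩ hz
    simp only [Finset.mem_product, Finset.mem_Ioc] at hz
    obtain ⟨⟨hq, hqY⟩, hr, hrY⟩ := hz
    have hqr : 0 < q * r := Nat.mul_pos hq hr
    have hq' : (1 : ℝ) ≤ q := by exact_mod_cast hq
    have hr' : (1 : ℝ) ≤ r := by exact_mod_cast hr
    have hqY' : (q : ℝ) ≤ Y := by exact_mod_cast hqY
    have hrY' : (r : ℝ) ≤ Y := by exact_mod_cast hrY
    have hb1 : ∀ (n q : ℕ), |(lam n q : ℝ)| ≤ (q : ℝ) ^ 2 := fun n q => by exact_mod_cast lam_abs_le n q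
    have h := sum_Icc_avg (fun n => (lam n q : ℝ) * lam n r) (q * r) hqr
      (fun n => by
        rw [← lam_add n (q * r) q (dvd_mul_right q r), ← lam_add n (q * r) r (dvd_mul_left r q)])
      ((q : ℝ) ^ 2 * (r : ℝ) ^ 2) (fun n => by
        rw [abs_mul]
        exact mul_le_mul (hb1 n q) (hb1 n r) (abs_nonneg _) (by positivity)) N
    have e2 : (1 / ((q : ℝ) * r)) * ∑ n ∈ Finset.Icc 3 N, (lam n q : ℝ) * lam n r - N * FF q r =
      (1 / ((q : ℝ) * r)) * (∑ n ∈ Finset.Icc 3 N, (lam n q : ℝ) * lam n r - N * avg (fun n => (lam n q : ℝ) * lam n r) (q * r)) := by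
      rw [FF, Mv]; ring
    dsimp only
    rw [e2, abs_mul, abs_of_pos (by positivity : 0 < 1 / ((q : ℝ) * r))]
    calc _ ≤ 1 / ((q : ℝ) * r) * ((2 * ((q * r : ℕ) : ℝ) + 4) * ((q : ℝ) ^ 2 * (r : ℝ) ^ 2)) := by gcongr
      _ ≤ 1 / ((q : ℝ) * r) * ((6 * ((q * r : ℕ) : ℝ)) * ((q : ℝ) ^ 2 * (r : ℝ) ^ 2)) := by
          have : (1 : ℝ) ≤ ((q * r : ℕ) : ℝ) := by exact_mod_cast hqr
          gcongr; linarith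
      _ = 6 * ((q : ℝ) ^ 2 * (r : ℝ) ^ 2) := by push_cast; field_simp
      _ ≤ 6 * ((Y : ℝ) ^ 2 * (Y : ℝ) ^ 2) := by gcongr
      _ = _ := by ring
  refine (Finset.sum_le_card_nsmul _ _ _ hb).trans ?_
  rw [Finset.card_product, Nat.card_Ioc, nsmul_eq_mul]
  push_cast
  simp only [Nat.sub_zero]
  apply le_of_eq; ring

lemma FFsq_tendsto (Y : ℕ → ℕ) (hY : Tendsto Y atTop atTop) :
    Tendsto (fun N => ∑ z ∈ Finset.Ioc 0 (Y N) ×ˢ Finset.Ioc 0 (Y N), FF z.1 z.2) atTop (nhds kappa) := by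
  have h := FF_summable.hasSum
  rw [HasSum, SummationFilter.unconditional_filter, tot_eq] at h
  have hs : Tendsto (fun N => Finset.range (Y N + 1) ×ˢ Finset.range (Y N + 1)) atTop atTop := by
    rw [tendsto_atTop]
    intro u
    filter_upwards [hY.eventually_gt_atTop (u.sup Prod.fst), hY.eventually_gt_atTop (u.sup Prod.snd)] with K h1 h2
    intro z hz
    rw [Finset.mem_product, Finset.mem_range, Finset.mem_range]
    have a1 := (Finset.le_sup (f := Prod.fst) hz).trans_lt h1
    have a2 := (Finset.le_sup (f := Prod.snd) hz).trans_lt h2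
    omega
  refine (h.comp hs).congr fun N => ?_
  symm
  apply Finset.sum_subset
  · intro z; simp only [Finset.mem_product, Finset.mem_Ioc, Finset.mem_range]; omega
  · rintro ⟨q, r⟩ h1 h2
    simp only [Finset.mem_product, Finset.mem_Ioc, Finset.mem_range] at h1 h2
    have : q = 0 ∨ r = 0 := by omega
    rcases this with h | h
    · subst h; simp [FF]
    · subst h; simp [FF]

/-- second moment asymptotics -/
lemma SY_moment (Y : ℕ → ℕ) (hY : Tendsto Y atTop atTop)
    (h6 : Tendsto (fun N : ℕ => ((Y N : ℝ)) ^ 6 / N) atTop (nhds 0)) :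
    Tendsto (fun N : ℕ => (∑ n ∈ Finset.Icc 3 N, SY (Y N) n ^ 2) / N) atTop (nhds kappa) := by
  have h1 := FFsq_tendsto Y hY
  have h2 : Tendsto (fun N : ℕ => (∑ n ∈ Finset.Icc 3 N, SY (Y N) n ^ 2) / N -
      ∑ z ∈ Finset.Ioc 0 (Y N) ×ˢ Finset.Ioc 0 (Y N), FF z.1 z.2) atTop (nhds 0) := by
    have h7 := h6.const_mul 6
    rw [mul_zero] at h7
    refine squeeze_zero_norm' ?_ h7
    filter_upwards [eventually_gt_atTop 0] with N hN
    have hN' : (0 : ℝ) < N := by exact_mod_cast hN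
    have h := second_moment N (Y N)
    rw [Real.norm_eq_abs, show (∑ n ∈ Finset.Icc 3 N, SY (Y N) n ^ 2) / N -
      ∑ z ∈ Finset.Ioc 0 (Y N) ×ˢ Finset.Ioc 0 (Y N), FF z.1 z.2 = (∑ n ∈ Finset.Icc 3 N, SY (Y N) n ^ 2 -
      N * ∑ z ∈ Finset.Ioc 0 (Y N) ×ˢ Finset.Ioc 0 (Y N), FF z.1 z.2) / N by field_simp, abs_div, abs_of_pos hN', ← mul_div_assoc]
    gcongr
  simpa using h2.add h1

end PF

namespace PF

noncomputable def LX (X n : ℕ) : ℝ := ∑ m ∈ Finset.Ioc 0 X, psi n m / m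

lemma SY_eq (Y n : ℕ) (hn : 3 ≤ n) :
    SY Y n = ∑ q ∈ Finset.Ioc 0 Y, (lam1 n q : ℝ) / q * LX (Y / q) n := by
  let f : ArithmeticFunction ℝ := ⟨fun q => (lam1 n q : ℝ) / q, by simp⟩
  let g : ArithmeticFunction ℝ := ⟨fun q => psi n q / q, by simp⟩
  have h := ArithmeticFunction.sum_Ioc_mul_eq_sum_sum f g Y
  unfold SY LX
  refine Eq.trans ?_ h
  apply Finset.sum_congr rfl
  intro q hq
  rw [ArithmeticFunction.mul_apply, lam_eq n (by omega), ArithmeticFunction.mul_apply]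
  push_cast
  rw [Finset.sum_div]
  apply Finset.sum_congr rfl
  rintro ⟨a, b⟩ hab
  rw [Nat.mem_divisorsAntidiagonal] at hab
  change (lam1 n a : ℝ) * (psiA n b : ℝ) / q = (lam1 n a : ℝ) / a * (psi n b / b)
  rw [psiA_cast, div_mul_div_comm, ← hab.1]
  push_cast
  rfl

lemma LX_abs (X M n : ℕ) (h : X ≤ M) : |LX X n| ≤ 1 + Real.log M := by
  refine le_trans ?_ (sum_inv_le M)
  unfold LX
  refine (Finset.abs_sum_le_sum_abs _ _).trans ?_
  calc ∑ m ∈ Finset.Ioc 0 X, |psi n m / m| ≤ ∑ m ∈ Finset.Ioc 0 X, (1 : ℝ) / m := by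
        apply Finset.sum_le_sum
        intro m _
        rw [abs_div, Nat.abs_cast]
        gcongr
        exact psi_abs_le n m
    _ ≤ _ := by
        apply Finset.sum_le_sum_of_subset_of_nonneg
        · intro m; rw [Finset.mem_Ioc, Finset.mem_Icc]; omega
        · intro m _ _; positivity

lemma LX_sub (W X n : ℕ) (h : W ≤ X) : LX X n - LX W n = tailT W X n := by
  unfold LX tailT
  rw [sub_eq_iff_eq_add, add_comm]
  have := Finset.sum_Ioc_consecutive (fun m : ℕ => psi n m / (m : ℝ)) (Nat.zero_le W) h
  exact this.symm

lemma lam1_big (n q Z : ℕ) (hq : Z < q) : |(lam1 n q : ℝ)| / q ≤ ((Z + 1 : ℕ) : ℝ) ^ (-(1 / 4 : ℝ)) * rw1 n q := by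
  have hq0 : (0 : ℝ) < q := by exact_mod_cast (by omega : 0 < q)
  have hZ : ((Z + 1 : ℕ) : ℝ) ≤ q := by exact_mod_cast hq
  have h1 : (q : ℝ) ^ (-(1 / 4 : ℝ)) ≤ ((Z + 1 : ℕ) : ℝ) ^ (-(1 / 4 : ℝ)) :=
    Real.rpow_le_rpow_of_nonpos (by positivity) hZ (by norm_num)
  have h2 : |(lam1 n q : ℝ)| / q = (q : ℝ) ^ (-(1 / 4 : ℝ)) * rw1 n q := by
    unfold rw1
    rw [mul_left_comm, ← Real.rpow_add hq0]
    norm_num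
    rw [Real.rpow_neg_one]
    rfl
  rw [h2]
  exact mul_le_mul_of_nonneg_right h1 (rw1_nonneg n q)

lemma lam1_small (n q Z : ℕ) (hq : q ≤ Z) : |(lam1 n q : ℝ)| / q ≤ Z := by
  rcases Nat.eq_zero_or_pos q with rfl | h0
  · simp
  have h1 : |(lam1 n q : ℝ)| ≤ (q : ℝ) ^ 2 := by exact_mod_cast (lam1_abs_le n q).trans (lam_abs_le n q)
  have hq0 : (0 : ℝ) < q := by exact_mod_cast h0
  have hq' : (q : ℝ) ≤ Z := by exact_mod_cast hq
  rw [div_le_iff₀ hq0]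
  nlinarith

lemma pointwise (n Z Y X : ℕ) (hn : 3 ≤ n) (hZY : Z ≤ Y) (hYX : Y ≤ X) (hX : 1 ≤ X) (B : ℝ) (hs : Summable (rw1 n))
    (hB : ∑' q, rw1 n q ≤ B) :
    |Fval n * Lval n - SY Y n| ≤ B * (8 * (n : ℝ) ^ 2 / (X + 1)) +
      2 * (((Z + 1 : ℕ) : ℝ) ^ (-(1 / 4 : ℝ)) * B * (1 + Real.log X)) +
      Z * ∑ q ∈ Finset.Ioc 0 Z, |tailT (Y / q) X n| := by
  set z : ℝ := ((Z + 1 : ℕ) : ℝ) ^ (-(1 / 4 : ℝ)) with hz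
  have hz0 : 0 ≤ z := by positivity
  set f : ℕ → ℝ := fun q => (lam1 n q : ℝ) / q with hf
  have hfa : ∀ q, |f q| = |(lam1 n q : ℝ)| / q := fun q => by rw [hf, abs_div, Nat.abs_cast]
  have hfs : Summable (fun q => |f q|) := by simp only [hfa]; exact lam1_div_summable n hn
  have hfs' : Summable f := hfs.of_abs
  have hF : |Fval n| ≤ B := by
    calc |Fval n| ≤ ∑' q, |f q| := by
            have := norm_tsum_le_tsum_norm (f := f) hfs
            exact this
      _ ≤ ∑' q, rw1 n q := hfs.tsum_le_tsum (fun q => by rw [hfa]; exact lam1_div_le n q) hs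
      _ ≤ B := hB
  have hB0 : 0 ≤ B := (abs_nonneg _).trans hF
  have hlog : 0 ≤ 1 + Real.log X := by
    have := Real.log_nonneg (by exact_mod_cast hX : (1 : ℝ) ≤ X); linarith
  -- tail of F
  have hFZ : |Fval n - ∑ q ∈ Finset.Ioc 0 Z, f q| ≤ z * B := by
    have e0 : ∑ q ∈ Finset.Ioc 0 Z, f q = ∑ q ∈ Finset.range (Z + 1), f q := by
      apply Finset.sum_subset
      · intro q; rw [Finset.mem_Ioc, Finset.mem_range]; omega
      · intro q h1 h2
        rw [Finset.mem_range] at h1; rw [Finset.mem_Ioc] at h2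
        have : q = 0 := by omega
        subst this; simp [hf]
    have e1 : Fval n - ∑ q ∈ Finset.Ioc 0 Z, f q = ∑' i, f (i + (Z + 1)) := by
      have := hfs'.sum_add_tsum_nat_add (Z + 1)
      rw [e0, Fval, ← this]; ring
    rw [e1]
    have hs1 : Summable (fun i => |f (i + (Z + 1))|) := (summable_nat_add_iff (f := fun q => |f q|) (Z + 1)).2 hfs
    have hs2 : Summable (fun i => rw1 n (i + (Z + 1))) := (summable_nat_add_iff (f := rw1 n) (Z + 1)).2 hs
    calc |∑' i, f (i + (Z + 1))| ≤ ∑' i, |f (i + (Z + 1))| := norm_tsum_le_tsum_norm (f := fun i => f (i + (Z + 1))) hs1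
      _ ≤ ∑' i, z * rw1 n (i + (Z + 1)) := hs1.tsum_le_tsum (fun i => by
            rw [hfa]; exact lam1_big n _ Z (by omega)) (hs2.mul_left z)
      _ = z * ∑' i, rw1 n (i + (Z + 1)) := tsum_mul_left
      _ ≤ z * B := by
          refine mul_le_mul_of_nonneg_left (le_trans ?_ hB) hz0
          rw [← hs.sum_add_tsum_nat_add (Z + 1)]
          have : 0 ≤ ∑ i ∈ Finset.range (Z + 1), rw1 n i := Finset.sum_nonneg fun i _ => rw1_nonneg n i
          linarith
  have hmid : ∑ q ∈ Finset.Ioc Z Y, |f q| ≤ z * B := by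
    calc ∑ q ∈ Finset.Ioc Z Y, |f q| ≤ ∑ q ∈ Finset.Ioc Z Y, z * rw1 n q := by
          apply Finset.sum_le_sum
          intro q hq
          rw [Finset.mem_Ioc] at hq
          rw [hfa]; exact lam1_big n q Z hq.1
      _ = z * ∑ q ∈ Finset.Ioc Z Y, rw1 n q := by rw [Finset.mul_sum]
      _ ≤ z * B := by
          refine mul_le_mul_of_nonneg_left (le_trans ?_ hB) hz0
          exact hs.sum_le_tsum _ (fun i _ => rw1_nonneg n i)
  have hL : |Lval n - LX X n| ≤ 8 * (n : ℝ) ^ 2 / (X + 1) := by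
    refine (Lval_spec n hn X).trans ?_
    have : ((n ^ 2 - 4 : ℕ) : ℝ) ≤ (n : ℝ) ^ 2 := by exact_mod_cast Nat.sub_le _ _
    apply div_le_div_of_nonneg_right _ (by positivity)
    linarith
  have key : Fval n * Lval n - SY Y n = Fval n * (Lval n - LX X n) + (Fval n - ∑ q ∈ Finset.Ioc 0 Z, f q) * LX X n
      + ∑ q ∈ Finset.Ioc 0 Z, f q * tailT (Y / q) X n - ∑ q ∈ Finset.Ioc Z Y, f q * LX (Y / q) n := by
    rw [SY_eq Y n hn, ← Finset.sum_Ioc_consecutive (fun q : ℕ => (lam1 n q : ℝ) / q * LX (Y / q) n) (Nat.zero_le Z) hZY]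
    have : ∑ q ∈ Finset.Ioc 0 Z, f q * tailT (Y / q) X n = (∑ q ∈ Finset.Ioc 0 Z, f q) * LX X n - ∑ q ∈ Finset.Ioc 0 Z, f q * LX (Y / q) n := by
      rw [Finset.sum_mul, ← Finset.sum_sub_distrib]
      apply Finset.sum_congr rfl
      intro q _
      rw [← LX_sub _ _ _ ((Nat.div_le_self Y q).trans hYX)]; ring
    rw [this]
    simp only [hf]
    ring
  have b1 : |Fval n * (Lval n - LX X n)| ≤ B * (8 * (n : ℝ) ^ 2 / (X + 1)) := by
    rw [abs_mul]; exact mul_le_mul hF hL (abs_nonneg _) hB0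
  have b2 : |(Fval n - ∑ q ∈ Finset.Ioc 0 Z, f q) * LX X n| ≤ z * B * (1 + Real.log X) := by
    rw [abs_mul]; exact mul_le_mul hFZ (LX_abs X X n le_rfl) (abs_nonneg _) (by positivity)
  have b3 : |∑ q ∈ Finset.Ioc 0 Z, f q * tailT (Y / q) X n| ≤ Z * ∑ q ∈ Finset.Ioc 0 Z, |tailT (Y / q) X n| := by
    refine (Finset.abs_sum_le_sum_abs _ _).trans ?_
    rw [Finset.mul_sum]
    apply Finset.sum_le_sum
    intro q hq
    rw [Finset.mem_Ioc] at hq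
    rw [abs_mul, hfa]
    exact mul_le_mul_of_nonneg_right (lam1_small n q Z hq.2) (abs_nonneg _)
  have b4 : |∑ q ∈ Finset.Ioc Z Y, f q * LX (Y / q) n| ≤ z * B * (1 + Real.log X) := by
    refine (Finset.abs_sum_le_sum_abs _ _).trans ?_
    calc ∑ q ∈ Finset.Ioc Z Y, |f q * LX (Y / q) n| ≤ ∑ q ∈ Finset.Ioc Z Y, |f q| * (1 + Real.log X) := by
          apply Finset.sum_le_sum
          intro q _
          rw [abs_mul]
          exact mul_le_mul_of_nonneg_left (LX_abs _ X n ((Nat.div_le_self Y q).trans hYX)) (abs_nonneg _)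
      _ = (∑ q ∈ Finset.Ioc Z Y, |f q|) * (1 + Real.log X) := by rw [Finset.sum_mul]
      _ ≤ _ := mul_le_mul_of_nonneg_right hmid hlog
  rw [key]
  refine (abs_sub _ _).trans ?_
  have := abs_add_three (Fval n * (Lval n - LX X n)) ((Fval n - ∑ q ∈ Finset.Ioc 0 Z, f q) * LX X n) (∑ q ∈ Finset.Ioc 0 Z, f q * tailT (Y / q) X n)
  linarith

lemma pow_mean (N k : ℕ) (g : ℕ → ℝ) : (∑ n ∈ Finset.Icc 3 N, g n ^ 2) ^ (k + 1) ≤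
    (N : ℝ) ^ k * ∑ n ∈ Finset.Icc 3 N, g n ^ (2 * (k + 1)) := by
  refine (pow_sum_le_card_mul_sum_pow (s := Finset.Icc 3 N) (f := fun n => g n ^ 2)
      (fun n _ => sq_nonneg _) k).trans ?_
  simp only [pow_mul]
  gcongr
  rw [Nat.card_Icc]; omega

/-- averaged square of the tail -/
lemma tail_sq (ε : ℝ) (hε : 0 < ε) : ∃ C : ℝ, 0 < C ∧ ∀ N W : ℕ, 1 ≤ N → N ^ 5 ≤ (W + 1) ^ 40 →
    ∑ n ∈ Finset.Icc 3 N, (tailT W (N ^ 3) n) ^ 2 ≤ N * (C * (N : ℝ) ^ (ε - 1 / 40)) := by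
  obtain ⟨C, hC, h⟩ := moment_bound 40 (40 * ε) (by positivity)
  refine ⟨C ^ (1 / 40 : ℝ), by positivity, fun N W hN hW => ?_⟩
  have h1 := h N W hN hW
  have hN0 : (0 : ℝ) < N := by exact_mod_cast hN
  have h3 : (∑ n ∈ Finset.Icc 3 N, (tailT W (N ^ 3) n) ^ 2) ^ 40 ≤
      (N : ℝ) ^ 39 * ∑ n ∈ Finset.Icc 3 N, (tailT W (N ^ 3) n) ^ (2 * 40) := by
    exact pow_mean N 39 (fun n => tailT W (N ^ 3) n)
  refine le_of_pow_le_pow_left₀ (n := 40) (by norm_num) (by positivity) ?_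
  refine h3.trans ?_
  have h5 : ((N : ℝ) * (C ^ (1 / 40 : ℝ) * (N : ℝ) ^ (ε - 1 / 40))) ^ 40 = (N : ℝ) ^ 39 * (C * (N : ℝ) ^ (40 * ε)) := by
    rw [mul_pow, mul_pow, ← Real.rpow_natCast (C ^ (1 / 40 : ℝ)), ← Real.rpow_mul hC.le,
      ← Real.rpow_natCast ((N : ℝ) ^ (ε - 1 / 40)), ← Real.rpow_mul hN0.le,
      show (1 / 40 : ℝ) * ((40 : ℕ) : ℝ) = 1 by norm_num, Real.rpow_one,
      show (ε - 1 / 40 : ℝ) * ((40 : ℕ) : ℝ) = 40 * ε - 1 by push_cast; ring, Real.rpow_sub_one hN0.ne']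
    field_simp
  rw [h5]
  gcongr

end PF

namespace PF

noncomputable def tN (N : ℕ) : ℕ := ⌊(N : ℝ) ^ (1 / 200 : ℝ)⌋₊

lemma tN_le (N : ℕ) : (tN N : ℝ) ≤ (N : ℝ) ^ (1 / 200 : ℝ) := Nat.floor_le (by positivity)
lemma lt_tN (N : ℕ) : (N : ℝ) ^ (1 / 200 : ℝ) < (tN N + 1 : ℕ) := by
  push_cast; exact Nat.lt_floor_add_one _

lemma nat_rpow_tendsto (a : ℝ) (ha : 0 < a) : Tendsto (fun N : ℕ => (N : ℝ) ^ a) atTop atTop :=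
  (tendsto_rpow_atTop ha).comp tendsto_natCast_atTop_atTop

lemma nat_rpow_zero (a : ℝ) (ha : a < 0) : Tendsto (fun N : ℕ => (N : ℝ) ^ a) atTop (nhds 0) := by
  have := (tendsto_rpow_neg_atTop (neg_pos.2 ha)).comp (tendsto_natCast_atTop_atTop (R := ℝ))
  simpa [Function.comp_def] using this

lemma tN_tendsto : Tendsto tN atTop atTop :=
  tendsto_nat_floor_atTop.comp (nat_rpow_tendsto _ (by norm_num))

lemma tN_pow_le (N k : ℕ) : ((tN N : ℝ)) ^ k ≤ (N : ℝ) ^ (k / 200 : ℝ) := by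
  have h : ((N : ℝ) ^ (1 / 200 : ℝ)) ^ k = (N : ℝ) ^ (k / 200 : ℝ) := by
    rw [← Real.rpow_natCast, ← Real.rpow_mul (by positivity)]
    congr 1; ring
  rw [← h]
  exact pow_le_pow_left₀ (by positivity) (tN_le N) k

lemma N_lt (N : ℕ) : N < (tN N + 1) ^ 200 := by
  have h : ((N : ℝ) ^ (1 / 200 : ℝ)) ^ 200 = N := by
    rw [← Real.rpow_natCast, ← Real.rpow_mul (by positivity)]
    norm_num
  have := pow_lt_pow_left₀ (lt_tN N) (by positivity) (n := 200) (by norm_num)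
  rw [h] at this
  exact_mod_cast this

lemma cond_W (N q : ℕ) (ht : 2 ^ 25 ≤ tN N) (hq : 0 < q) (hqt : q ≤ tN N) :
    N ^ 5 ≤ ((tN N) ^ 27 / q + 1) ^ 40 := by
  have hN := N_lt N
  generalize tN N = t at *
  have h1 : t ^ 26 ≤ t ^ 27 / q := by
    rw [Nat.le_div_iff_mul_le hq, pow_succ t 26]
    exact Nat.mul_le_mul_left _ hqt
  calc N ^ 5 ≤ ((t + 1) ^ 200) ^ 5 := Nat.pow_le_pow_left hN.le 5
    _ ≤ ((2 * t) ^ 200) ^ 5 := by gcongr; omega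
    _ = (2 ^ 25) ^ 40 * t ^ 1000 := by rw [← pow_mul, mul_pow, ← pow_mul]
    _ ≤ t ^ 40 * t ^ 1000 := by gcongr
    _ = (t ^ 26) ^ 40 := by rw [← pow_mul, ← pow_add]
    _ ≤ _ := by gcongr; omega

noncomputable def Aval (n : ℕ) : ℝ := Fval n * Lval n

lemma err_tendsto : Tendsto (fun N : ℕ => (∑ n ∈ Finset.Icc 3 N, (Aval n - SY (tN N ^ 27) n) ^ 2) / N) atTop (nhds 0) := by
  set ε : ℝ := 1 / 8000 with hε
  have hε0 : 0 < ε := by norm_num [hε]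
  obtain ⟨C1, hC1, hR⟩ := rankin ε hε0
  obtain ⟨C2, hC2, hT⟩ := tail_sq ε hε0
  have hlim : Tendsto (fun N : ℕ => 2 * (8 * C1 * (N : ℝ) ^ (ε - 1) + 2 * C1 * (1 + 1 / ε) * (N : ℝ) ^ (4 * ε - 1 / 800)) ^ 2
      + 2 * C2 * (N : ℝ) ^ (ε - 1 / 200)) atTop (nhds 0) := by
    have a1 := (nat_rpow_zero (ε - 1) (by norm_num [hε])).const_mul (8 * C1)
    have a2 := (nat_rpow_zero (4 * ε - 1 / 800) (by norm_num [hε])).const_mul (2 * C1 * (1 + 1 / ε))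
    have a3 := (nat_rpow_zero (ε - 1 / 200) (by norm_num [hε])).const_mul (2 * C2)
    have := (((a1.add a2).pow 2).const_mul 2).add a3
    simpa using this
  refine squeeze_zero' (Eventually.of_forall fun N => ?_) ?_ hlim
  · exact div_nonneg (Finset.sum_nonneg fun n _ => sq_nonneg _) (by positivity)
  filter_upwards [eventually_ge_atTop 3, tN_tendsto.eventually_ge_atTop (2 ^ 25)] with N hN ht
  set t := tN N with htdef
  have hN0 : (0 : ℝ) < N := by exact_mod_cast (by omega : 0 < N)
  have hN1 : (1 : ℝ) ≤ N := by exact_mod_cast (by omega : 1 ≤ N)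
  have ht1 : 1 ≤ t := le_trans (by norm_num) ht
  have hY : t ^ 27 ≤ N ^ 3 := by
    have h1 : ((t : ℝ)) ^ 27 ≤ (N : ℝ) ^ 3 := by
      refine (tN_pow_le N 27).trans ?_
      rw [← Real.rpow_natCast (N : ℝ) 3]
      exact Real.rpow_le_rpow_of_exponent_le hN1 (by norm_num)
    exact_mod_cast h1
  set η : ℝ := 8 * C1 * (N : ℝ) ^ (ε - 1) + 2 * C1 * (1 + 1 / ε) * (N : ℝ) ^ (4 * ε - 1 / 800) with hη
  have hpt : ∀ n ∈ Finset.Icc 3 N, (Aval n - SY (t ^ 27) n) ^ 2 ≤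
      2 * η ^ 2 + 2 * ((t : ℝ) ^ 3 * ∑ q ∈ Finset.Ioc 0 t, tailT (t ^ 27 / q) (N ^ 3) n ^ 2) := by
    intro n hn
    rw [Finset.mem_Icc] at hn
    obtain ⟨hs, hB⟩ := hR n N hn.1 hn.2
    have h := pointwise n t (t ^ 27) (N ^ 3) hn.1 (Nat.le_self_pow (by norm_num) t) hY (Nat.one_le_pow _ _ (by omega)) _ hs hB
    have hnN : (n : ℝ) ≤ N := by exact_mod_cast hn.2
    have b1 : C1 * (N : ℝ) ^ ε * (8 * (n : ℝ) ^ 2 / ((N ^ 3 : ℕ) + 1)) ≤ 8 * C1 * (N : ℝ) ^ (ε - 1) := by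
      rw [Real.rpow_sub_one hN0.ne']
      calc C1 * (N : ℝ) ^ ε * (8 * (n : ℝ) ^ 2 / ((N ^ 3 : ℕ) + 1)) ≤ C1 * (N : ℝ) ^ ε * (8 * (N : ℝ) ^ 2 / (N : ℝ) ^ 3) := by
            push_cast
            gcongr
            linarith
        _ = _ := by field_simp
    have b2 : ((t + 1 : ℕ) : ℝ) ^ (-(1 / 4 : ℝ)) * (C1 * (N : ℝ) ^ ε) * (1 + Real.log ((N ^ 3 : ℕ) : ℝ)) ≤
        C1 * (1 + 1 / ε) * (N : ℝ) ^ (4 * ε - 1 / 800) := by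
      have c1 : ((t + 1 : ℕ) : ℝ) ^ (-(1 / 4 : ℝ)) ≤ (N : ℝ) ^ (-(1 / 800) : ℝ) := by
        refine (Real.rpow_le_rpow_of_nonpos (by positivity) (lt_tN N).le (by norm_num)).trans ?_
        rw [← Real.rpow_mul hN0.le]
        norm_num
      have c2 := log_le_rpow ε hε0 ((N ^ 3 : ℕ) : ℝ) (by exact_mod_cast Nat.one_le_pow _ _ (by omega))
      have c3 : (((N ^ 3 : ℕ) : ℝ)) ^ ε = (N : ℝ) ^ (3 * ε) := by
        push_cast
        rw [← Real.rpow_natCast, ← Real.rpow_mul hN0.le]; norm_num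
      rw [c3] at c2
      have c4 : 0 ≤ 1 + Real.log ((N ^ 3 : ℕ) : ℝ) := by
        have := Real.log_nonneg (by exact_mod_cast Nat.one_le_pow 3 N (by omega) : (1 : ℝ) ≤ ((N ^ 3 : ℕ) : ℝ))
        linarith
      calc _ ≤ (N : ℝ) ^ (-(1 / 800) : ℝ) * (C1 * (N : ℝ) ^ ε) * ((1 + 1 / ε) * (N : ℝ) ^ (3 * ε)) := by
            gcongr
        _ = C1 * (1 + 1 / ε) * ((N : ℝ) ^ (-(1 / 800) : ℝ) * (N : ℝ) ^ ε * (N : ℝ) ^ (3 * ε)) := by ring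
        _ = _ := by
            rw [← Real.rpow_add hN0, ← Real.rpow_add hN0]
            congr 2; ring
    set T := ∑ q ∈ Finset.Ioc 0 t, |tailT (t ^ 27 / q) (N ^ 3) n| with hTdef
    have hT2 : T ^ 2 ≤ t * ∑ q ∈ Finset.Ioc 0 t, tailT (t ^ 27 / q) (N ^ 3) n ^ 2 := by
      have := sq_sum_le_card_mul_sum_sq (s := Finset.Ioc 0 t) (f := fun q => |tailT (t ^ 27 / q) (N ^ 3) n|)
      simpa using this
    have h5 : |Aval n - SY (t ^ 27) n| ≤ η + t * T := by
      refine h.trans ?_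
      rw [hη]
      linarith
    have h6 : (Aval n - SY (t ^ 27) n) ^ 2 ≤ (η + t * T) ^ 2 := sq_le_sq' (by have := neg_abs_le (Aval n - SY (t ^ 27) n); linarith)
      ((le_abs_self _).trans h5)
    have h7 : (η + t * T) ^ 2 ≤ 2 * η ^ 2 + 2 * ((t : ℝ) ^ 2 * T ^ 2) := by nlinarith [sq_nonneg (η - t * T)]
    have h8 : (t : ℝ) ^ 2 * T ^ 2 ≤ (t : ℝ) ^ 2 * (t * ∑ q ∈ Finset.Ioc 0 t, tailT (t ^ 27 / q) (N ^ 3) n ^ 2) := by gcongr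
    have h9 : (t : ℝ) ^ 2 * (t * ∑ q ∈ Finset.Ioc 0 t, tailT (t ^ 27 / q) (N ^ 3) n ^ 2) =
      (t : ℝ) ^ 3 * ∑ q ∈ Finset.Ioc 0 t, tailT (t ^ 27 / q) (N ^ 3) n ^ 2 := by ring
    linarith
  have hTs : ∑ n ∈ Finset.Icc 3 N, ∑ q ∈ Finset.Ioc 0 t, tailT (t ^ 27 / q) (N ^ 3) n ^ 2 ≤ t * (N * (C2 * (N : ℝ) ^ (ε - 1 / 40))) := by
    rw [Finset.sum_comm]
    have := Finset.sum_le_card_nsmul (Finset.Ioc 0 t) (fun q => ∑ n ∈ Finset.Icc 3 N, tailT (t ^ 27 / q) (N ^ 3) n ^ 2)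
      (N * (C2 * (N : ℝ) ^ (ε - 1 / 40))) (fun q hq => by
        rw [Finset.mem_Ioc] at hq
        exact hT N _ (by omega) (cond_W N q ht hq.1 hq.2))
    simpa using this
  rw [div_le_iff₀ hN0]
  refine (Finset.sum_le_sum hpt).trans ?_
  rw [Finset.sum_add_distrib, Finset.sum_const, nsmul_eq_mul, ← Finset.mul_sum, ← Finset.mul_sum]
  have hcard : (((Finset.Icc 3 N).card : ℕ) : ℝ) ≤ N := by rw [Nat.card_Icc]; exact_mod_cast (by omega : N + 1 - 3 ≤ N)
  have d1 : (((Finset.Icc 3 N).card : ℕ) : ℝ) * (2 * η ^ 2) ≤ N * (2 * η ^ 2) := by gcongr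
  have d2 : (t : ℝ) ^ 3 * ∑ n ∈ Finset.Icc 3 N, ∑ q ∈ Finset.Ioc 0 t, tailT (t ^ 27 / q) (N ^ 3) n ^ 2 ≤
      (t : ℝ) ^ 3 * (t * (N * (C2 * (N : ℝ) ^ (ε - 1 / 40)))) := by gcongr
  have d3 : (t : ℝ) ^ 3 * (t * (N * (C2 * (N : ℝ) ^ (ε - 1 / 40)))) ≤ N * (C2 * (N : ℝ) ^ (ε - 1 / 200)) := by
    have e1 : (t : ℝ) ^ 4 ≤ (N : ℝ) ^ (1 / 50 : ℝ) := by
      have := tN_pow_le N 4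
      norm_num at this ⊢
      exact this
    calc (t : ℝ) ^ 3 * (t * (N * (C2 * (N : ℝ) ^ (ε - 1 / 40)))) = (t : ℝ) ^ 4 * (N * (C2 * (N : ℝ) ^ (ε - 1 / 40))) := by ring
      _ ≤ (N : ℝ) ^ (1 / 50 : ℝ) * (N * (C2 * (N : ℝ) ^ (ε - 1 / 40))) := by gcongr
      _ = N * (C2 * ((N : ℝ) ^ (1 / 50 : ℝ) * (N : ℝ) ^ (ε - 1 / 40))) := by ring
      _ = _ := by
          rw [← Real.rpow_add hN0]
          congr 3; ring
  nlinarith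

lemma Aval_moment : Tendsto (fun N : ℕ => (∑ n ∈ Finset.Icc 3 N, Aval n ^ 2) / N) atTop (nhds kappa) := by
  have hY : Tendsto (fun N => tN N ^ 27) atTop atTop := (tendsto_pow_atTop (by norm_num)).comp tN_tendsto
  have hS := SY_moment (fun N => tN N ^ 27) hY (by
    refine squeeze_zero' (Eventually.of_forall fun N => by positivity) ?_ (nat_rpow_zero (-(38 / 200)) (by norm_num))
    filter_upwards [eventually_gt_atTop 0] with N hN
    have hN0 : (0 : ℝ) < N := by exact_mod_cast hN
    push_cast
    rw [← pow_mul, div_le_iff₀ hN0, ← Real.rpow_add_one hN0.ne']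
    refine (tN_pow_le N 162).trans (le_of_eq ?_)
    congr 1; norm_num)
  have hE := err_tendsto
  have hc : Tendsto (fun N : ℕ => (∑ n ∈ Finset.Icc 3 N, (Aval n - SY (tN N ^ 27) n) * SY (tN N ^ 27) n) / N) atTop (nhds 0) := by
    have hsq := (hE.mul hS).sqrt
    rw [zero_mul, Real.sqrt_zero] at hsq
    refine squeeze_zero_norm (fun N => ?_) hsq
    rw [Real.norm_eq_abs]
    apply Real.abs_le_sqrt
    rw [div_pow, div_mul_div_comm, ← sq]
    gcongr
    exact Finset.sum_mul_sq_le_sq_mul_sq _ _ _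
  have h := (hS.add (hc.const_mul 2)).add hE
  simp only [mul_zero, add_zero] at h
  refine h.congr fun N => ?_
  rw [← mul_div_assoc, ← add_div, ← add_div, Finset.mul_sum, ← Finset.sum_add_distrib, ← Finset.sum_add_distrib]
  congr 1
  apply Finset.sum_congr rfl
  intro n _
  ring

end PF

namespace PF
open MeasureTheory

lemma graph_null (g : ℝ → ℝ) (hg : Measurable g) : volume {z : ℝ × ℝ | z.2 = g z.1} = 0 := by
  have hm : MeasurableSet {z : ℝ × ℝ | z.2 = g z.1} := measurableSet_eq_fun measurable_snd (hg.comp measurable_fst)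
  rw [Measure.volume_eq_prod, Measure.measure_prod_null hm]
  refine Eventually.of_forall fun x => ?_
  have : (Prod.mk x ⁻¹' {z : ℝ × ℝ | z.2 = g z.1}) = {g x} := by ext y; simp
  change volume (Prod.mk x ⁻¹' {z : ℝ × ℝ | z.2 = g z.1}) = 0
  rw [this]; simp

lemma graph_null' (g : ℝ → ℝ) (hg : Measurable g) : volume {w : Fin 2 → ℝ | w 1 = g (w 0)} = 0 := by
  have hm : MeasurableSet {z : ℝ × ℝ | z.2 = g z.1} := measurableSet_eq_fun measurable_snd (hg.comp measurable_fst)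
  rw [← graph_null g hg, ← (volume_preserving_finTwoArrow ℝ).measure_preimage hm.nullMeasurableSet]
  rfl

def coneX (E : ℝ) : Set (Fin 2 → ℝ) := {w | 0 < w 0 ∧ w 0 ≤ w 1 ∧ w 1 < E * w 0}

def reg (E : ℝ) : Set (Fin 2 → ℝ) := {w ∈ coneX E | w 0 * w 1 ≤ 1}

lemma reg_frontier (E : ℝ) : volume (frontier (reg E)) = 0 := by
  have hK : volume ({w : Fin 2 → ℝ | w 1 = w 0} ∪ ({w : Fin 2 → ℝ | w 1 = E * w 0} ∪ {w : Fin 2 → ℝ | w 1 = (w 0)⁻¹})) = 0 := by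
    rw [measure_union_null_iff, measure_union_null_iff]
    exact ⟨graph_null' _ measurable_id, graph_null' _ (measurable_const_mul E), graph_null' _ measurable_inv⟩
  refine measure_mono_null ?_ hK
  have c0 : Continuous (fun w : Fin 2 → ℝ => w 0) := continuous_apply 0
  have c1 : Continuous (fun w : Fin 2 → ℝ => w 1) := continuous_apply 1
  have hcl : IsClosed {w : Fin 2 → ℝ | 0 ≤ w 0 ∧ w 0 ≤ w 1 ∧ w 1 ≤ E * w 0 ∧ w 0 * w 1 ≤ 1} :=
    (isClosed_le continuous_const c0).inter ((isClosed_le c0 c1).inter ((isClosed_le c1 (continuous_const.mul c0)).inter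
      (isClosed_le (c0.mul c1) continuous_const)))
  have hop : IsOpen {w : Fin 2 → ℝ | 0 < w 0 ∧ w 0 < w 1 ∧ w 1 < E * w 0 ∧ w 0 * w 1 < 1} :=
    (isOpen_lt continuous_const c0).inter ((isOpen_lt c0 c1).inter ((isOpen_lt c1 (continuous_const.mul c0)).inter
      (isOpen_lt (c0.mul c1) continuous_const)))
  intro w hw
  have h1 : w ∈ closure (reg E) := hw.1
  have h2 : w ∉ interior (reg E) := hw.2
  have h3 := closure_minimal (s := reg E) (fun w (h : w ∈ reg E) => (⟨h.1.1.le, h.1.2.1, h.1.2.2.le, h.2⟩ :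
    0 ≤ w 0 ∧ w 0 ≤ w 1 ∧ w 1 ≤ E * w 0 ∧ w 0 * w 1 ≤ 1)) hcl h1
  obtain ⟨a, b, c, d⟩ := h3
  by_contra hn
  simp only [Set.mem_union, Set.mem_ofPred_eq, not_or] at hn
  obtain ⟨n1, n2, n3⟩ := hn
  have hw0 : 0 < w 0 := by
    rcases a.lt_or_eq with h | h
    · exact h
    · exfalso; rw [← h, mul_zero] at c; apply n1; rw [← h]; rw [← h] at b; linarith
  apply h2
  refine interior_maximal ?_ hop ⟨hw0, lt_of_le_of_ne b (Ne.symm n1), lt_of_le_of_ne c n2, lt_of_le_of_ne d ?_⟩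
  · intro w h; exact ⟨⟨h.1, h.2.1.le, h.2.2.1⟩, h.2.2.2.le⟩
  · intro h; exact n3 (eq_inv_of_mul_eq_one_right h)

lemma reg_int (E : ℝ) (hE : 1 < E) :
    ∫ x in Set.Ioo (0 : ℝ) 1, ((fun x : ℝ => min (E * x) x⁻¹) - (id : ℝ → ℝ)) x = Real.log E / 2 := by
  set a : ℝ := (Real.sqrt E)⁻¹ with ha
  have hs : 1 < Real.sqrt E := by rw [Real.lt_sqrt (by norm_num)]; simpa using hE
  have hss : Real.sqrt E ^ 2 = E := Real.sq_sqrt (by linarith)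
  have ha0 : 0 < a := by positivity
  have ha1 : a < 1 := inv_lt_one_of_one_lt₀ hs
  have haE : E * a ^ 2 = 1 := by rw [ha, inv_pow, hss]; field_simp
  have f1 : ∀ x ∈ Set.uIcc 0 a, ((fun x : ℝ => min (E * x) x⁻¹) - (id : ℝ → ℝ)) x = (E - 1) * x := by
    intro x hx
    rw [Set.uIcc_of_le ha0.le] at hx
    simp only [Pi.sub_apply, id]
    rcases hx.1.lt_or_eq with h | h
    · have : E * x ≤ x⁻¹ := by
        rw [le_inv_comm₀ (by positivity) h, inv_eq_one_div, le_div_iff₀ (by positivity)]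
        have : x * x ≤ a * a := mul_le_mul hx.2 hx.2 h.le ha0.le
        nlinarith
      rw [min_eq_left this]; ring
    · rw [← h]; simp
  have f2 : ∀ x ∈ Set.uIcc a 1, ((fun x : ℝ => min (E * x) x⁻¹) - (id : ℝ → ℝ)) x = x⁻¹ - x := by
    intro x hx
    rw [Set.uIcc_of_le ha1.le] at hx
    have hx0 : 0 < x := ha0.trans_le hx.1
    simp only [Pi.sub_apply, id]
    have : x⁻¹ ≤ E * x := by
      rw [inv_eq_one_div, div_le_iff₀ hx0]
      have : a * a ≤ x * x := mul_le_mul hx.1 hx.1 ha0.le hx0.le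
      nlinarith
    rw [min_eq_right this]
  have hne : ∀ x ∈ Set.uIcc a 1, x ≠ 0 := by
    intro x hx; rw [Set.uIcc_of_le ha1.le] at hx; linarith [hx.1]
  have hi2 : IntervalIntegrable (fun x : ℝ => x⁻¹) volume a 1 := intervalIntegral.intervalIntegrable_inv hne continuousOn_id
  have i1 : IntervalIntegrable ((fun x : ℝ => min (E * x) x⁻¹) - (id : ℝ → ℝ)) volume 0 a :=
    IntervalIntegrable.congr (f := fun x => (E - 1) * x) (fun x hx => (f1 x (Set.uIoc_subset_uIcc hx)).symm)
      ((continuous_const.mul continuous_id).intervalIntegrable _ _)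
  have i2 : IntervalIntegrable ((fun x : ℝ => min (E * x) x⁻¹) - (id : ℝ → ℝ)) volume a 1 :=
    IntervalIntegrable.congr (f := fun x => x⁻¹ - x) (fun x hx => (f2 x (Set.uIoc_subset_uIcc hx)).symm)
      (hi2.sub (continuous_id.intervalIntegrable _ _))
  rw [← integral_Ioc_eq_integral_Ioo, ← intervalIntegral.integral_of_le zero_le_one,
    ← intervalIntegral.integral_add_adjacent_intervals i1 i2, intervalIntegral.integral_congr f1,
    intervalIntegral.integral_congr f2, intervalIntegral.integral_const_mul, integral_id,
    intervalIntegral.integral_sub hi2 (continuous_id'.intervalIntegrable _ _), integral_inv_of_pos ha0 one_pos, integral_id]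
  have hl : Real.log (1 / a) = Real.log E / 2 := by
    rw [one_div, ha, inv_inv, Real.log_sqrt (by linarith)]
  rw [hl]
  nlinarith

lemma reg_vol (E : ℝ) (hE : 1 < E) : volume.real (reg E) = Real.log E / 2 := by
  have hm : MeasurableSet {z : ℝ × ℝ | (0 < z.1 ∧ z.1 ≤ z.2 ∧ z.2 < E * z.1) ∧ z.1 * z.2 ≤ 1} := by
    apply MeasurableSet.inter
    · apply MeasurableSet.inter (measurableSet_lt measurable_const measurable_fst)
      exact (measurableSet_le measurable_fst measurable_snd).inter (measurableSet_lt measurable_snd (measurable_fst.const_mul E))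
    · exact measurableSet_le (measurable_fst.mul measurable_snd) measurable_const
  have h1 : volume (reg E) = volume {z : ℝ × ℝ | (0 < z.1 ∧ z.1 ≤ z.2 ∧ z.2 < E * z.1) ∧ z.1 * z.2 ≤ 1} := by
    rw [← (volume_preserving_finTwoArrow ℝ).measure_preimage hm.nullMeasurableSet]
    rfl
  have hK : volume ({z : ℝ × ℝ | z.2 = z.1} ∪ {z : ℝ × ℝ | z.2 = (z.1)⁻¹}) = 0 := by
    rw [measure_union_null_iff]
    exact ⟨graph_null _ measurable_id, graph_null _ measurable_inv⟩
  have h2 : volume {z : ℝ × ℝ | (0 < z.1 ∧ z.1 ≤ z.2 ∧ z.2 < E * z.1) ∧ z.1 * z.2 ≤ 1} =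
      volume (regionBetween id (fun x => min (E * x) x⁻¹) (Set.Ioo 0 1)) := by
    apply measure_congr
    have : ∀ᵐ z : ℝ × ℝ, z ∉ ({z : ℝ × ℝ | z.2 = z.1} ∪ {z : ℝ × ℝ | z.2 = (z.1)⁻¹}) := measure_eq_zero_iff_ae_notMem.1 hK
    filter_upwards [this] with z hz
    simp only [Set.mem_union, Set.mem_ofPred_eq, not_or] at hz
    obtain ⟨n1, n2⟩ := hz
    apply propext
    change ((0 < z.1 ∧ z.1 ≤ z.2 ∧ z.2 < E * z.1) ∧ z.1 * z.2 ≤ 1) ↔ ((0 < z.1 ∧ z.1 < 1) ∧ (z.1 < z.2 ∧ z.2 < min (E * z.1) z.1⁻¹))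
    constructor
    · rintro ⟨⟨a, b, c⟩, d⟩
      have b' : z.1 < z.2 := lt_of_le_of_ne b (Ne.symm n1)
      refine ⟨⟨a, by nlinarith⟩, b', lt_min c (lt_of_le_of_ne ?_ n2)⟩
      rw [inv_eq_one_div, le_div_iff₀ a]; linarith
    · rintro ⟨⟨a, b⟩, c, d⟩
      rw [lt_min_iff] at d
      refine ⟨⟨a, c.le, d.1⟩, ?_⟩
      have := d.2
      rw [inv_eq_one_div, lt_div_iff₀ a] at this; linarith
  have hg : Measurable (fun x : ℝ => min (E * x) x⁻¹) := (measurable_const_mul E).min measurable_inv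
  have h3 : volume (regionBetween id (fun x => min (E * x) x⁻¹) (Set.Ioo 0 1)) = ENNReal.ofReal (Real.log E / 2) := by
    rw [← reg_int E hE, Measure.volume_eq_prod]
    apply volume_regionBetween_eq_integral
    · exact (continuous_id.integrableOn_Icc (a := 0) (b := 1)).mono_set Set.Ioo_subset_Icc_self
    · refine Measure.integrableOn_of_bounded (M := E) (by simp) hg.aestronglyMeasurable ?_
      refine (ae_restrict_iff' measurableSet_Ioo).2 (Eventually.of_forall fun x hx => ?_)
      have hx0 : 0 < x := hx.1
      rw [Real.norm_eq_abs, abs_of_nonneg (le_min (by positivity) (by positivity))]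
      refine (min_le_left _ _).trans ?_
      nlinarith [hx.2]
    · exact measurableSet_Ioo
    · intro x hx
      have hx0 : 0 < x := hx.1
      refine le_min (by simp only [id]; nlinarith) ?_
      simp only [id]
      rw [inv_eq_one_div, le_div_iff₀ hx0]; nlinarith [hx.2]
  rw [measureReal_def, h1, h2, h3, ENNReal.toReal_ofReal]
  have := Real.log_pos hE
  linarith

lemma reg_bdd (E : ℝ) : Bornology.IsBounded (reg E) := by
  refine (Metric.isBounded_closedBall (x := (0 : Fin 2 → ℝ)) (r := max 1 E)).subset ?_
  rintro w ⟨⟨a, b, c⟩, d⟩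
  have h0 : w 0 ≤ 1 := by nlinarith
  have hE : 1 ≤ E := by
    by_contra h; push Not at h; nlinarith
  rw [mem_closedBall_zero_iff, pi_norm_le_iff_of_nonneg (by positivity)]
  intro i
  fin_cases i
  · change |w 0| ≤ _
    rw [abs_of_pos a]; exact h0.trans (le_max_left _ _)
  · change |w 1| ≤ _
    rw [abs_of_pos (by linarith)]; refine le_trans ?_ (le_max_right _ _); nlinarith

lemma reg_meas (E : ℝ) : MeasurableSet (reg E) := by
  have m0 : Measurable (fun w : Fin 2 → ℝ => w 0) := measurable_pi_apply 0
  have m1 : Measurable (fun w : Fin 2 → ℝ => w 1) := measurable_pi_apply 1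
  apply MeasurableSet.inter
  · apply MeasurableSet.inter (measurableSet_lt measurable_const m0)
    exact (measurableSet_le m0 m1).inter (measurableSet_lt m1 (m0.const_mul E))
  · exact measurableSet_le (m0.mul m1) measurable_const

end PF

namespace PF
open MeasureTheory

lemma cone_count (p1 p2 q1 q2 E : ℝ) (hD : p1 * q2 - p2 * q1 ≠ 0) (hE : 1 < E) :
    Tendsto (fun c : ℝ => (Nat.card {v : ℤ × ℤ // (0 < p1 * v.1 + p2 * v.2 ∧
      p1 * v.1 + p2 * v.2 ≤ q1 * v.1 + q2 * v.2 ∧ q1 * v.1 + q2 * v.2 < E * (p1 * v.1 + p2 * v.2)) ∧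
      (p1 * v.1 + p2 * v.2) * (q1 * v.1 + q2 * v.2) ≤ c} : ℝ) / c) atTop
      (nhds (Real.log E / 2 / |p1 * q2 - p2 * q1|)) := by
  classical
  let A : Matrix (Fin 2) (Fin 2) ℝ := !![p1, q1; p2, q2]
  have hdet : A.det ≠ 0 := by
    rw [Matrix.det_fin_two_of]; intro h; apply hD; linarith
  have hli : LinearIndependent ℝ A.row := Matrix.linearIndependent_rows_of_det_ne_zero hdet
  let b0 : Module.Basis (Fin 2) ℝ (Fin 2 → ℝ) := basisOfLinearIndependentOfCardEqFinrank hli (by simp)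
  have hb0 : ∀ i, b0 i = A i := fun i => by
    simp only [b0, coe_basisOfLinearIndependentOfCardEqFinrank]; rfl
  let L := Submodule.span ℤ (Set.range b0)
  have hcov : ZLattice.covolume L = |p1 * q2 - p2 * q1| := by
    rw [ZLattice.covolume_eq_det L (b0.restrictScalars ℤ)]
    have : Matrix.of (((↑) : L → Fin 2 → ℝ) ∘ (b0.restrictScalars ℤ)) = A := by
      ext i j
      simp [Module.Basis.restrictScalars_apply, hb0]
    rw [this, Matrix.det_fin_two_of]
    congr 1; ring
  have key := ZLattice.covolume.tendsto_card_le_div L (X := coneX E) (F := fun w => w 0 * w 1) ?_ ?_ (reg_bdd E) (reg_meas E) (reg_frontier E)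
  · rw [hcov] at key
    have hv : volume.real {x ∈ coneX E | x 0 * x 1 ≤ 1} = Real.log E / 2 := reg_vol E hE
    rw [hv] at key
    refine key.congr fun c => ?_
    congr 2
    symm
    have hw : ∀ v : ℤ × ℤ, ((v.1 : ℝ) • b0 0 + (v.2 : ℝ) • b0 1) 0 = p1 * v.1 + p2 * v.2 := by
      intro v; simp [hb0, A]; ring
    have hw' : ∀ v : ℤ × ℤ, ((v.1 : ℝ) • b0 0 + (v.2 : ℝ) • b0 1) 1 = q1 * v.1 + q2 * v.2 := by
      intro v; simp [hb0, A]; ring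
    refine Nat.card_congr (Equiv.ofBijective (fun v => ⟨(v.1.1 : ℝ) • b0 0 + (v.1.2 : ℝ) • b0 1, ?_⟩) ⟨?_, ?_⟩)
    · obtain ⟨v, h1, h2⟩ := v
      refine ⟨⟨?_, ?_⟩, ?_⟩
      · change 0 < _ ∧ _ ∧ _
        rw [hw, hw']; exact h1
      · change _ * _ ≤ _
        rw [hw, hw']; exact h2
      · change _ ∈ L
        rw [Int.cast_smul_eq_zsmul, Int.cast_smul_eq_zsmul]
        exact L.add_mem (L.smul_mem _ (Submodule.subset_span ⟨0, rfl⟩)) (L.smul_mem _ (Submodule.subset_span ⟨1, rfl⟩))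
    · rintro ⟨v, _⟩ ⟨w, _⟩ h
      have h := congrArg Subtype.val h
      simp only at h
      have e0 := congrFun h 0
      have e1 := congrFun h 1
      rw [hw, hw] at e0
      rw [hw', hw'] at e1
      have a1 : (p1 * q2 - p2 * q1) * ((v.1 : ℝ) - w.1) = 0 := by linear_combination q2 * e0 - p2 * e1
      have a2 : (p1 * q2 - p2 * q1) * ((v.2 : ℝ) - w.2) = 0 := by linear_combination p1 * e1 - q1 * e0
      have a1 := (mul_eq_zero.1 a1).resolve_left hD
      have a2 := (mul_eq_zero.1 a2).resolve_left hD
      have a1 : v.1 = w.1 := by exact_mod_cast sub_eq_zero.1 a1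
      have a2 : v.2 = w.2 := by exact_mod_cast sub_eq_zero.1 a2
      exact Subtype.ext (Prod.ext a1 a2)
    · rintro ⟨x, ⟨h1, h2⟩, h3⟩
      obtain ⟨c, hc⟩ := (Submodule.mem_span_range_iff_exists_fun ℤ).1 h3
      rw [Fin.sum_univ_two] at hc
      have hx : ((c 0 : ℤ) : ℝ) • b0 0 + ((c 1 : ℤ) : ℝ) • b0 1 = x := by
        rw [← hc, Int.cast_smul_eq_zsmul, Int.cast_smul_eq_zsmul]
      refine ⟨⟨(c 0, c 1), ?_, ?_⟩, ?_⟩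
      · have : 0 < x 0 ∧ x 0 ≤ x 1 ∧ x 1 < E * x 0 := h1
        rw [← hx] at this
        have u := hw (c 0, c 1)
        have u' := hw' (c 0, c 1)
        simp only at u u'
        rw [u, u'] at this; exact this
      · have : x 0 * x 1 ≤ _ := h2
        rw [← hx] at this
        have u := hw (c 0, c 1)
        have u' := hw' (c 0, c 1)
        simp only at u u'
        rw [u, u'] at this; exact this
      · exact Subtype.ext hx
  · rintro x r ⟨h1, h2, h3⟩ hr
    refine ⟨?_, ?_, ?_⟩
    · exact mul_pos hr h1
    · exact mul_le_mul_of_nonneg_left h2 hr.le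
    · have := mul_lt_mul_of_pos_left h3 hr
      change r * x 1 < E * (r * x 0)
      linarith
  · intro x r hr
    change (r * x 0) * (r * x 1) = _
    rw [Fintype.card_fin]; ring

end PF

namespace PF

/-- action of the substitution `(x,y) ↦ (αx+βy, γx+δy)`. -/
def act (f : ℤ × ℤ × ℤ) (α β γ δ : ℤ) : ℤ × ℤ × ℤ :=
  (f.1 * α ^ 2 + f.2.1 * α * γ + f.2.2 * γ ^ 2,
   2 * f.1 * α * β + f.2.1 * (α * δ + β * γ) + 2 * f.2.2 * γ * δ,
   f.1 * β ^ 2 + f.2.1 * β * δ + f.2.2 * δ ^ 2)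

lemma act_act (f : ℤ × ℤ × ℤ) (α β γ δ α' β' γ' δ' : ℤ) :
    act (act f α β γ δ) α' β' γ' δ' =
      act f (α * α' + β * γ') (α * β' + β * δ') (γ * α' + δ * γ') (γ * β' + δ * δ') := by
  unfold act
  refine Prod.ext ?_ (Prod.ext ?_ ?_) <;> simp only <;> ring

lemma act_one (f : ℤ × ℤ × ℤ) : act f 1 0 0 1 = f := by
  unfold act
  refine Prod.ext ?_ (Prod.ext ?_ ?_) <;> simp only <;> ring

lemma formEquiv_iff (f g : ℤ × ℤ × ℤ) :
    formEquiv f g ↔ ∃ α β γ δ : ℤ, α * δ - β * γ = 1 ∧ g = act f α β γ δ := by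
  constructor
  · rintro ⟨M, hM⟩
    refine ⟨M.1 0 0, M.1 0 1, M.1 1 0, M.1 1 1, ?_, ?_⟩
    · have := M.2; rw [Matrix.det_fin_two] at this; exact this
    · have h1 := hM 1 0
      have h2 := hM 0 1
      have h3 := hM 1 1
      unfold formVal at h1 h2 h3
      unfold act
      refine Prod.ext ?_ (Prod.ext ?_ ?_) <;> simp only
      · linear_combination h1
      · linear_combination h3 - h1 - h2
      · linear_combination h2
  · rintro ⟨α, β, γ, δ, hd, hg⟩
    refine ⟨⟨!![α, β; γ, δ], by rw [Matrix.det_fin_two_of]; exact hd⟩, fun x y => ?_⟩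
    rw [hg]
    simp [formVal, act]
    ring

lemma formEquiv_refl (f : ℤ × ℤ × ℤ) : formEquiv f f :=
  (formEquiv_iff _ _).2 ⟨1, 0, 0, 1, by norm_num, (act_one f).symm⟩

lemma act_inv (f : ℤ × ℤ × ℤ) (α β γ δ : ℤ) (h : α * δ - β * γ = 1) :
    act (act f α β γ δ) δ (-β) (-γ) α = f := by
  rw [act_act]
  have e1 : α * δ + β * -γ = 1 := by linarith
  have e2 : α * -β + β * α = 0 := by ring
  have e3 : γ * δ + δ * -γ = 0 := by ring
  have e4 : γ * -β + δ * α = 1 := by linarith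
  rw [e1, e2, e3, e4, act_one]

lemma formEquiv_symm {f g : ℤ × ℤ × ℤ} (h : formEquiv f g) : formEquiv g f := by
  rw [formEquiv_iff] at *
  obtain ⟨α, β, γ, δ, hd, hg⟩ := h
  exact ⟨δ, -β, -γ, α, by linarith, by rw [hg, act_inv _ _ _ _ _ hd]⟩

lemma formEquiv_trans {f g k : ℤ × ℤ × ℤ} (h : formEquiv f g) (h' : formEquiv g k) : formEquiv f k := by
  rw [formEquiv_iff] at *
  obtain ⟨α, β, γ, δ, hd, hg⟩ := h
  obtain ⟨α', β', γ', δ', hd', hg'⟩ := h'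
  refine ⟨_, _, _, _, ?_, by rw [hg', hg, act_act]⟩
  linear_combination (α' * δ' - β' * γ') * hd + hd'

lemma formDisc_act (f : ℤ × ℤ × ℤ) (α β γ δ : ℤ) (h : α * δ - β * γ = 1) :
    formDisc (act f α β γ δ) = formDisc f := by
  unfold formDisc act
  simp only
  linear_combination (f.2.1 ^ 2 - 4 * f.1 * f.2.2) * (α * δ - β * γ + 1) * h

lemma prim_iff (f : ℤ × ℤ × ℤ) :
    IsPrimitiveForm f ↔ ∀ k : ℤ, k ∣ f.1 → k ∣ f.2.1 → k ∣ f.2.2 → k ∣ 1 := by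
  unfold IsPrimitiveForm
  constructor
  · intro h k h1 h2 h3
    have : k ∣ (Int.gcd f.1 (Int.gcd f.2.1 f.2.2) : ℤ) := Int.dvd_coe_gcd h1 (Int.dvd_coe_gcd h2 h3)
    rw [h] at this; exact_mod_cast this
  · intro h
    have := h (Int.gcd f.1 (Int.gcd f.2.1 f.2.2)) (Int.gcd_dvd_left _ _)
      ((Int.gcd_dvd_right _ _).trans (Int.gcd_dvd_left _ _)) ((Int.gcd_dvd_right _ _).trans (Int.gcd_dvd_right _ _))
    have h2 : (Int.gcd f.1 (Int.gcd f.2.1 f.2.2)) ∣ 1 := by exact_mod_cast this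
    exact Nat.dvd_one.1 h2

lemma dvd_act (f : ℤ × ℤ × ℤ) (α β γ δ k : ℤ) (h1 : k ∣ f.1) (h2 : k ∣ f.2.1) (h3 : k ∣ f.2.2) :
    k ∣ (act f α β γ δ).1 ∧ k ∣ (act f α β γ δ).2.1 ∧ k ∣ (act f α β γ δ).2.2 := by
  obtain ⟨a, ha⟩ := h1
  obtain ⟨b, hb⟩ := h2
  obtain ⟨c, hc⟩ := h3
  unfold act
  simp only
  rw [ha, hb, hc]
  refine ⟨⟨a * α ^ 2 + b * α * γ + c * γ ^ 2, by ring⟩,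
    ⟨2 * a * α * β + b * (α * δ + β * γ) + 2 * c * γ * δ, by ring⟩, ⟨a * β ^ 2 + b * β * δ + c * δ ^ 2, by ring⟩⟩

lemma prim_act (f : ℤ × ℤ × ℤ) (α β γ δ : ℤ) (h : α * δ - β * γ = 1) (hf : IsPrimitiveForm f) :
    IsPrimitiveForm (act f α β γ δ) := by
  rw [prim_iff] at *
  intro k h1 h2 h3
  have := dvd_act (act f α β γ δ) δ (-β) (-γ) α k h1 h2 h3
  rw [act_inv _ _ _ _ _ h] at this
  exact hf k this.1 this.2.1 this.2.2

lemma automorph (f : ℤ × ℤ × ℤ) (hf : IsPrimitiveForm f) (hA : f.1 ≠ 0) (α β γ δ : ℤ)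
    (h : α * δ - β * γ = 1) (hu : act f α β γ δ = f) :
    ∃ u : ℤ, γ = f.1 * u ∧ δ - α = f.2.1 * u ∧ β = - f.2.2 * u ∧
      (α + δ) ^ 2 - formDisc f * u ^ 2 = 4 := by
  have e1 := congrArg (fun z => z.1) hu
  have e2 := congrArg (fun z => z.2.1) hu
  have e3 := congrArg (fun z => z.2.2) hu
  unfold act at e1 e2 e3
  simp only at e1 e2 e3
  have r1 : f.1 * (δ - α) = f.2.1 * γ := by
    have : 2 * (f.1 * (δ - α)) = 2 * (f.2.1 * γ) := by
      linear_combination (-2 * δ) * e1 + γ * e2 + (2 * f.1 * α + f.2.1 * γ) * h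
    linarith
  have r2 : f.1 * β = - f.2.2 * γ := by
    have : 2 * (f.1 * β) = 2 * (- f.2.2 * γ) := by
      linear_combination δ * e2 - 2 * γ * e3 - (2 * f.1 * β + f.2.1 * δ) * h
    linarith
  have hdv : f.1 ∣ γ := by
    have b1 := Int.gcd_eq_gcd_ab f.1 (Int.gcd f.2.1 f.2.2)
    have b2 := Int.gcd_eq_gcd_ab f.2.1 f.2.2
    unfold IsPrimitiveForm at hf
    rw [hf] at b1
    set x := Int.gcdA f.1 (Int.gcd f.2.1 f.2.2)
    set y := Int.gcdB f.1 (Int.gcd f.2.1 f.2.2)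
    set p := Int.gcdA f.2.1 f.2.2
    set q := Int.gcdB f.2.1 f.2.2
    push_cast at b1
    refine ⟨γ * x + y * p * (δ - α) - y * q * β, ?_⟩
    linear_combination γ * b1 + γ * y * b2 - y * p * r1 + y * q * r2
  obtain ⟨u, hu'⟩ := hdv
  refine ⟨u, hu', ?_, ?_, ?_⟩
  · apply mul_left_cancel₀ hA; rw [r1, hu']; ring
  · apply mul_left_cancel₀ hA; rw [r2, hu']; ring
  · have q1 : δ - α = f.2.1 * u := by apply mul_left_cancel₀ hA; rw [r1, hu']; ring
    have q2 : β = - f.2.2 * u := by apply mul_left_cancel₀ hA; rw [r2, hu']; ring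
    unfold formDisc
    rw [hu', q2] at h
    linear_combination 4 * h + (δ - α + f.2.1 * u) * q1

/-- the linear factor of a form -/
noncomputable def lin (f : ℤ × ℤ × ℤ) (s : ℝ) (x y : ℤ) : ℝ := 2 * f.1 * x + (f.2.1 + s) * y

lemma lin_mul (f : ℤ × ℤ × ℤ) (s : ℝ) (hs : s ^ 2 = formDisc f) (x y : ℤ) :
    lin f s x y * lin f (-s) x y = 4 * f.1 * formVal f x y := by
  unfold lin formVal
  unfold formDisc at hs
  push_cast at *
  linear_combination (-y ^ 2 : ℝ) * hs

lemma lin_auto (f : ℤ × ℤ × ℤ) (s : ℝ) (hs : s ^ 2 = formDisc f) (x y α β γ δ u : ℤ)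
    (h1 : γ = f.1 * u) (h2 : δ - α = f.2.1 * u) (h3 : β = - f.2.2 * u) :
    lin f s (α * x + β * y) (γ * x + δ * y) = ((α + δ : ℤ) + u * s) / 2 * lin f s x y := by
  have hδ : δ = α + f.2.1 * u := by linarith
  subst h1 h3 hδ
  unfold lin
  unfold formDisc at hs
  push_cast at *
  linear_combination (-u * y / 2 : ℝ) * hs

lemma exists_auto (f : ℤ × ℤ × ℤ) (t u : ℤ) (h : t ^ 2 - formDisc f * u ^ 2 = 4) :
    ∃ α β γ δ : ℤ, α * δ - β * γ = 1 ∧ act f α β γ δ = f ∧ γ = f.1 * u ∧ δ - α = f.2.1 * u ∧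
      β = - f.2.2 * u ∧ α + δ = t := by
  unfold formDisc at h
  have hpar : (2 : ℤ) ∣ t - f.2.1 * u := by
    have : (2 : ℤ) ∣ (t - f.2.1 * u) ^ 2 := by
      refine ⟨2 - 2 * f.1 * f.2.2 * u ^ 2 - t * (f.2.1 * u) + (f.2.1 * u) ^ 2, ?_⟩
      linear_combination h
    exact Int.prime_two.dvd_of_dvd_pow this
  obtain ⟨α, hα⟩ := hpar
  have ht : t = 2 * α + f.2.1 * u := by linarith
  subst ht
  have hd : α * (α + f.2.1 * u) - (- f.2.2 * u) * (f.1 * u) = 1 := by linarith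
  refine ⟨α, - f.2.2 * u, f.1 * u, α + f.2.1 * u, hd, ?_, rfl, by ring, rfl, by ring⟩
  unfold act
  refine Prod.ext ?_ (Prod.ext ?_ ?_) <;> simp only
  · linear_combination f.1 * hd
  · linear_combination f.2.1 * hd
  · linear_combination f.2.2 * hd

end PF

namespace PF

/-- norm-one units given by solutions of `t² − d u² = 4`. -/
def isQ (d : ℤ) (μ : ℝ) : Prop := ∃ t u : ℤ, t ^ 2 - d * u ^ 2 = 4 ∧ μ = (t + u * Real.sqrt d) / 2

lemma sq_s {d : ℤ} (hd : 0 < d) : Real.sqrt d ^ 2 = d := Real.sq_sqrt (by exact_mod_cast hd.le)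

lemma conj_mul {d : ℤ} (hd : 0 < d) {t u : ℤ} (h : t ^ 2 - d * u ^ 2 = 4) :
    ((t : ℝ) + u * Real.sqrt d) / 2 * ((t - u * Real.sqrt d) / 2) = 1 := by
  have h' : (t : ℝ) ^ 2 - d * u ^ 2 = 4 := by exact_mod_cast h
  linear_combination h' / 4 - (u : ℝ) ^ 2 / 4 * sq_s hd

lemma conj_inv {d : ℤ} (hd : 0 < d) {t u : ℤ} (h : t ^ 2 - d * u ^ 2 = 4) :
    ((t : ℝ) - u * Real.sqrt d) / 2 = (((t : ℝ) + u * Real.sqrt d) / 2)⁻¹ :=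
  eq_inv_of_mul_eq_one_right (conj_mul hd h)

lemma isQ_inv {d : ℤ} (hd : 0 < d) {μ : ℝ} (h : isQ d μ) : isQ d μ⁻¹ := by
  obtain ⟨t, u, h1, h2⟩ := h
  refine ⟨t, -u, by linarith, ?_⟩
  rw [h2, ← conj_inv hd h1]; push_cast; ring

lemma isQ_neg {d : ℤ} {μ : ℝ} (h : isQ d μ) : isQ d (-μ) := by
  obtain ⟨t, u, h1, h2⟩ := h
  refine ⟨-t, -u, by linarith, ?_⟩
  rw [h2]; push_cast; ring

lemma pell_par {d t u : ℤ} (h : t ^ 2 - d * u ^ 2 = 4) : t % 2 = (d * u) % 2 := by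
  have h1 : (t ^ 2 - d * u ^ 2) % 2 = 0 := by rw [h]; rfl
  rcases Int.emod_two_eq_zero_or_one t with a | a <;> rcases Int.emod_two_eq_zero_or_one d with b | b <;>
    rcases Int.emod_two_eq_zero_or_one u with c | c <;>
    simp [pow_two, Int.sub_emod, Int.mul_emod, a, b, c] at h1 ⊢

lemma isQ_mul {d : ℤ} (hd : 0 < d) {μ ν : ℝ} (h : isQ d μ) (h' : isQ d ν) : isQ d (μ * ν) := by
  obtain ⟨t, u, h1, h2⟩ := h
  obtain ⟨t', u', h1', h2'⟩ := h'
  have p := pell_par h1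
  have p' := pell_par h1'
  have e1 : (2 : ℤ) ∣ t * t' + d * u * u' := by
    apply Int.dvd_of_emod_eq_zero
    rw [Int.add_emod, Int.mul_emod t, p, p']
    rcases Int.emod_two_eq_zero_or_one d with b | b <;>
    rcases Int.emod_two_eq_zero_or_one u with c | c <;> rcases Int.emod_two_eq_zero_or_one u' with e | e <;>
    simp [Int.mul_emod, b, c, e]
  have e2 : (2 : ℤ) ∣ t * u' + t' * u := by
    apply Int.dvd_of_emod_eq_zero
    rw [Int.add_emod, Int.mul_emod t, Int.mul_emod t', p, p']
    rcases Int.emod_two_eq_zero_or_one d with b | b <;>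
    rcases Int.emod_two_eq_zero_or_one u with c | c <;> rcases Int.emod_two_eq_zero_or_one u' with e | e <;>
    simp [Int.mul_emod, b, c, e]
  obtain ⟨T, hT⟩ := e1
  obtain ⟨U, hU⟩ := e2
  refine ⟨T, U, ?_, ?_⟩
  · have : 4 * (T ^ 2 - d * U ^ 2) = 4 * 4 := by
      have : (2 * T) ^ 2 - d * (2 * U) ^ 2 = 16 := by
        rw [← hT, ← hU]
        linear_combination (t' ^ 2 - d * u' ^ 2) * h1 + 4 * h1'
      linarith
    linarith
  · have hT' : (t * t' + d * u * u' : ℝ) = 2 * T := by exact_mod_cast hT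
    have hU' : (t * u' + t' * u : ℝ) = 2 * U := by exact_mod_cast hU
    rw [h2, h2']
    linear_combination hT' / 4 + hU' / 4 * Real.sqrt d + (u * u' / 4 : ℝ) * sq_s hd

lemma isQ_one {d : ℤ} : isQ d 1 := ⟨2, 0, by norm_num, by norm_num⟩

lemma isQ_zpow {d : ℤ} (hd : 0 < d) {μ : ℝ} (h : isQ d μ) (k : ℤ) : isQ d (μ ^ k) := by
  have hn : ∀ k : ℕ, isQ d (μ ^ k) := by
    intro k
    induction k with
    | zero => rw [pow_zero]; exact isQ_one
    | succ k ih => rw [pow_succ]; exact isQ_mul hd ih h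
  rcases Int.eq_nat_or_neg k with ⟨m, rfl | rfl⟩
  · rw [zpow_natCast]; exact hn m
  · rw [zpow_neg, zpow_natCast]; exact isQ_inv hd (hn m)

/-- the Pell equation is solvable nontrivially -/
def pellOK (d : ℤ) : Prop := ∃ t u : ℕ, 0 < t ∧ 0 < u ∧ (t : ℤ) ^ 2 - d * (u : ℤ) ^ 2 = 4

lemma td_spec {d : ℤ} (h : pellOK d) : 0 < td d ∧ 0 < ud d ∧ (td d : ℤ) ^ 2 - d * (ud d : ℤ) ^ 2 = 4 := by
  have h1 : td d ∈ {t : ℕ | 0 < t ∧ ∃ u : ℕ, 0 < u ∧ (t : ℤ) ^ 2 - d * (u : ℤ) ^ 2 = 4} := by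
    apply Nat.sInf_mem
    obtain ⟨t, u, a, b, c⟩ := h
    exact ⟨t, a, u, b, c⟩
  obtain ⟨a, u, b, c⟩ := h1
  have h2 : ud d ∈ {u : ℕ | 0 < u ∧ (td d : ℤ) ^ 2 - d * (u : ℤ) ^ 2 = 4} := by
    apply Nat.sInf_mem
    exact ⟨u, b, c⟩
  exact ⟨a, h2.1, h2.2⟩

lemma isQ_eps {d : ℤ} (h : pellOK d) : isQ d (eps d) :=
  ⟨td d, ud d, (td_spec h).2.2, by unfold eps; push_cast; rfl⟩

lemma one_lt_eps {d : ℤ} (hd : 0 < d) (h : pellOK d) : 1 < eps d := by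
  obtain ⟨a, b, c⟩ := td_spec h
  have hs : 0 < Real.sqrt d := Real.sqrt_pos.2 (by exact_mod_cast hd)
  have ht : 2 ≤ (td d : ℤ) := by
    have : (0 : ℤ) ≤ d * (ud d : ℤ) ^ 2 := by positivity
    have h2 : 4 ≤ (td d : ℤ) ^ 2 := by linarith
    have h3 : (0 : ℤ) < td d := by exact_mod_cast a
    nlinarith
  have ht' : (2 : ℝ) ≤ td d := by exact_mod_cast ht
  have hb : (0 : ℝ) < ud d := by exact_mod_cast b
  have := mul_pos hb hs
  unfold eps
  linarith

lemma eps_le {d : ℤ} (hd : 0 < d) (h : pellOK d) {μ : ℝ} (hμ : isQ d μ) (h1 : 1 < μ) : eps d ≤ μ := by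
  obtain ⟨t, u, e, rfl⟩ := hμ
  have hs : 0 < Real.sqrt d := Real.sqrt_pos.2 (by exact_mod_cast hd)
  have hc := conj_inv hd e
  have hc0 : 0 < ((t : ℝ) - u * Real.sqrt d) / 2 := by rw [hc]; exact inv_pos.2 (by linarith)
  have hc1 : ((t : ℝ) - u * Real.sqrt d) / 2 < 1 := by rw [hc]; exact inv_lt_one_of_one_lt₀ h1
  have ht : (0 : ℝ) < t := by linarith
  have hu : 0 < (u : ℝ) := by
    have : 0 < (u : ℝ) * Real.sqrt d := by linarith
    exact pos_of_mul_pos_left this hs.le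
  have ht' : 0 < t := by exact_mod_cast ht
  have hu' : 0 < u := by exact_mod_cast hu
  obtain ⟨a, b, c⟩ := td_spec h
  have hle : td d ≤ t.toNat := Nat.sInf_le ⟨by omega, u.toNat, by omega, by
    rw [Int.toNat_of_nonneg ht'.le, Int.toNat_of_nonneg hu'.le]; exact e⟩
  have hle' : (td d : ℤ) ≤ t := by omega
  have hle2 : (ud d : ℤ) ≤ u := by
    have : (td d : ℤ) ^ 2 ≤ t ^ 2 := pow_le_pow_left₀ (by positivity) hle' 2
    have : d * (ud d : ℤ) ^ 2 ≤ d * u ^ 2 := by linarith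
    have := le_of_mul_le_mul_left this hd
    exact le_of_sq_le_sq this hu'.le
  have q1 : (td d : ℝ) ≤ t := by exact_mod_cast hle'
  have q2 : (ud d : ℝ) ≤ u := by exact_mod_cast hle2
  unfold eps
  have := mul_le_mul_of_nonneg_right q2 hs.le
  linarith

lemma isQ_small {d : ℤ} (hd : 0 < d) (h : pellOK d) {μ : ℝ} (hμ : isQ d μ) (h1 : (eps d)⁻¹ < μ) (h2 : μ < eps d) :
    μ = 1 := by
  have he := one_lt_eps hd h
  have h0 : 0 < μ := (inv_pos.2 (by linarith)).trans h1
  rcases lt_trichotomy μ 1 with a | a | a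
  · exfalso
    have := eps_le hd h (isQ_inv hd hμ) (one_lt_inv₀ h0 |>.2 a)
    rw [inv_lt_comm₀ (by linarith) h0] at h1
    linarith
  · exact a
  · have := eps_le hd h hμ a
    linarith

end PF

namespace PF

/-- the fundamental cone -/
def inC (f : ℤ × ℤ × ℤ) (d : ℤ) (v : ℤ × ℤ) : Prop :=
  0 < f.1 * lin f (-Real.sqrt d) v.1 v.2 ∧ f.1 * lin f (-Real.sqrt d) v.1 v.2 ≤ lin f (Real.sqrt d) v.1 v.2 ∧
    lin f (Real.sqrt d) v.1 v.2 < eps d ^ 2 * (f.1 * lin f (-Real.sqrt d) v.1 v.2)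

lemma cone_unique (f : ℤ × ℤ × ℤ) {d : ℤ} (hd : 0 < d) (hp : pellOK d) (hf : IsPrimitiveForm f) (hfd : formDisc f = d)
    (hA : f.1 ≠ 0) (α β γ δ : ℤ) (h : α * δ - β * γ = 1) (hu : act f α β γ δ = f) (v : ℤ × ℤ)
    (hv : inC f d v) (hv' : inC f d (α * v.1 + β * v.2, γ * v.1 + δ * v.2)) :
    (α * v.1 + β * v.2, γ * v.1 + δ * v.2) = v := by
  obtain ⟨u, h1, h2, h3, h4⟩ := automorph f hf hA α β γ δ h hu
  have hs0 : 0 < Real.sqrt d := Real.sqrt_pos.2 (by exact_mod_cast hd)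
  have hs : Real.sqrt d ^ 2 = formDisc f := by rw [hfd]; exact sq_s hd
  have hs' : (-Real.sqrt d) ^ 2 = formDisc f := by rw [neg_sq]; exact hs
  have L1 := lin_auto f _ hs v.1 v.2 α β γ δ u h1 h2 h3
  have L2 := lin_auto f _ hs' v.1 v.2 α β γ δ u h1 h2 h3
  rw [hfd] at h4
  have hc := conj_inv hd h4
  unfold inC at hv hv'
  simp only at hv'
  rw [mul_neg, ← sub_eq_add_neg, hc] at L2
  have hQ : isQ d (((α + δ : ℤ) + u * Real.sqrt d) / 2) := ⟨_, _, h4, rfl⟩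
  set μ : ℝ := ((α + δ : ℤ) + u * Real.sqrt d) / 2 with hμ
  rw [L1, L2] at hv'
  set η := lin f (Real.sqrt d) v.1 v.2 with hη
  set ξ := lin f (-Real.sqrt d) v.1 v.2 with hξ
  have heps := one_lt_eps hd hp
  obtain ⟨a1, a2, a3⟩ := hv
  obtain ⟨b1, b2, b3⟩ := hv'
  rw [mul_left_comm (f.1 : ℝ) μ⁻¹ ξ] at b1 b2 b3
  set p := (f.1 : ℝ) * ξ with hpd
  have hη0 : 0 < η := a1.trans_le a2
  have hμ0 : 0 < μ := pos_of_mul_pos_left (b1.trans_le b2) hη0.le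
  have c1 : μ ^ 2 < eps d ^ 2 := by
    have : μ * η < eps d ^ 2 * (μ⁻¹ * η) := b3.trans_le (by gcongr)
    have : μ * (μ * η) < μ * (eps d ^ 2 * (μ⁻¹ * η)) := mul_lt_mul_of_pos_left this hμ0
    have e : μ * (eps d ^ 2 * (μ⁻¹ * η)) = eps d ^ 2 * η := by field_simp
    rw [e, ← mul_assoc, ← pow_two] at this
    exact lt_of_mul_lt_mul_right this hη0.le
  have c2 : 1 < (μ * eps d) ^ 2 := by
    have : μ⁻¹ * p < μ * (eps d ^ 2 * p) := b2.trans_lt (by gcongr)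
    have : μ * (μ⁻¹ * p) < μ * (μ * (eps d ^ 2 * p)) := mul_lt_mul_of_pos_left this hμ0
    have e : μ * (μ⁻¹ * p) = 1 * p := by field_simp
    rw [e, show μ * (μ * (eps d ^ 2 * p)) = (μ * eps d) ^ 2 * p by ring] at this
    exact lt_of_mul_lt_mul_right this a1.le
  have d1 : μ < eps d := lt_of_pow_lt_pow_left₀ 2 (by linarith) c1
  have d2 : (eps d)⁻¹ < μ := by
    rw [inv_lt_iff_one_lt_mul₀ (by linarith)]
    rw [mul_comm] at c2
    nlinarith [mul_pos (show 0 < eps d by linarith) hμ0]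
  have d3 := isQ_small hd hp hQ d2 d1
  rw [d3, one_mul] at L1
  rw [d3, inv_one, one_mul] at L2
  unfold lin at L1 L2 hη hξ
  rw [hη] at L1
  rw [hξ] at L2
  set x' : ℤ := α * v.1 + β * v.2
  set y' : ℤ := γ * v.1 + δ * v.2
  have k1 : (2 * Real.sqrt d) * ((y' : ℝ) - v.2) = 0 := by linear_combination L1 - L2
  have k1 : (y' : ℝ) = v.2 := by
    rcases mul_eq_zero.1 k1 with h | h
    · linarith
    · linarith
  have hA' : (f.1 : ℝ) ≠ 0 := by exact_mod_cast hA
  have k2 : (2 * (f.1 : ℝ)) * ((x' : ℝ) - v.1) = 0 := by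
    rw [k1] at L1; linear_combination L1
  have k2 : (x' : ℝ) = v.1 := by
    rcases mul_eq_zero.1 k2 with h | h
    · exact absurd (by linarith) hA'
    · linarith
  exact Prod.ext (by exact_mod_cast k2) (by exact_mod_cast k1)

lemma scale_exists {d : ℤ} (hd : 0 < d) (hp : pellOK d) {p η : ℝ} (h0 : 0 < p) (h1 : 0 < η) :
    ∃ μ, isQ d μ ∧ 0 < μ⁻¹ * p ∧ μ⁻¹ * p ≤ μ * η ∧ μ * η < eps d ^ 2 * (μ⁻¹ * p) := by
  have heps := one_lt_eps hd hp
  obtain ⟨k, hk1, hk2⟩ := exists_mem_Ico_zpow (div_pos h1 h0) (show 1 < eps d ^ 2 by nlinarith)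
  have he : 0 < eps d := by linarith
  have hek : 0 < eps d ^ k := zpow_pos he k
  have e1 : (eps d ^ 2) ^ k = (eps d ^ k) ^ 2 := by
    rw [← zpow_natCast, ← zpow_natCast, ← zpow_mul, ← zpow_mul, mul_comm]
  rw [zpow_add_one₀ (by positivity), e1, div_lt_iff₀ h0] at hk2
  rw [e1, le_div_iff₀ h0] at hk1
  refine ⟨(eps d ^ k)⁻¹, isQ_inv hd (isQ_zpow hd (isQ_eps hp) k), ?_, ?_, ?_⟩
  · rw [inv_inv]; positivity
  · rw [inv_inv, inv_mul_eq_div, le_div_iff₀ hek]; linarith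
  · rw [inv_inv, inv_mul_eq_div, div_lt_iff₀ hek]; linarith

lemma cone_exists (f : ℤ × ℤ × ℤ) {d : ℤ} (hd : 0 < d) (hp : pellOK d) (hfd : formDisc f = d)
    (hA : f.1 ≠ 0) (v : ℤ × ℤ) (hv : 0 < formVal f v.1 v.2) :
    ∃ α β γ δ : ℤ, α * δ - β * γ = 1 ∧ act f α β γ δ = f ∧ inC f d (α * v.1 + β * v.2, γ * v.1 + δ * v.2) := by
  have hs : Real.sqrt d ^ 2 = formDisc f := by rw [hfd]; exact sq_s hd
  have hs' : (-Real.sqrt d) ^ 2 = formDisc f := by rw [neg_sq]; exact hs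
  have hA' : (f.1 : ℝ) ≠ 0 := by exact_mod_cast hA
  have hv' : (0 : ℝ) < formVal f v.1 v.2 := by exact_mod_cast hv
  have hm := lin_mul f _ hs v.1 v.2
  have hpos : 0 < (f.1 * lin f (-Real.sqrt d) v.1 v.2) * lin f (Real.sqrt d) v.1 v.2 := by
    have : (f.1 * lin f (-Real.sqrt d) v.1 v.2) * lin f (Real.sqrt d) v.1 v.2 = 4 * (f.1 : ℝ) ^ 2 * formVal f v.1 v.2 := by
      linear_combination (f.1 : ℝ) * hm
    rw [this]; positivity
  have key : ∃ μ, isQ d μ ∧ 0 < μ⁻¹ * (f.1 * lin f (-Real.sqrt d) v.1 v.2) ∧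
      μ⁻¹ * (f.1 * lin f (-Real.sqrt d) v.1 v.2) ≤ μ * lin f (Real.sqrt d) v.1 v.2 ∧
      μ * lin f (Real.sqrt d) v.1 v.2 < eps d ^ 2 * (μ⁻¹ * (f.1 * lin f (-Real.sqrt d) v.1 v.2)) := by
    rcases mul_pos_iff.1 hpos with ⟨a, b⟩ | ⟨a, b⟩
    · exact scale_exists hd hp a b
    · obtain ⟨μ, q, r1, r2, r3⟩ := scale_exists hd hp (neg_pos.2 a) (neg_pos.2 b)
      refine ⟨-μ, isQ_neg q, ?_, ?_, ?_⟩
      · rw [inv_neg]; linarith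
      · rw [inv_neg]; linarith
      · rw [inv_neg]; linarith
  obtain ⟨μ, ⟨t, u, e, hμ⟩, r⟩ := key
  obtain ⟨α, β, γ, δ, h1, h2, h3, h4, h5, h6⟩ := exists_auto f t u (by rw [hfd]; exact e)
  refine ⟨α, β, γ, δ, h1, h2, ?_⟩
  have L1 := lin_auto f _ hs v.1 v.2 α β γ δ u h3 h4 h5
  have L2 := lin_auto f _ hs' v.1 v.2 α β γ δ u h3 h4 h5
  rw [mul_neg, ← sub_eq_add_neg, h6, conj_inv hd e, ← hμ] at L2
  rw [h6, ← hμ] at L1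
  unfold inC
  simp only
  rw [L1, L2, mul_left_comm]
  exact r

lemma formVal_act (f : ℤ × ℤ × ℤ) (α β γ δ : ℤ) : (act f α β γ δ).1 = formVal f α γ := by
  unfold act formVal; rfl

end PF

namespace PF

/-- pairs (multiplier, normalised form) -/
def W (D : ℤ) (X : ℕ) : Set (ℕ × ℤ × ℤ × ℤ) :=
  {z | 0 < z.1 ∧ formDisc z.2 = D ∧ 0 < z.2.1 ∧ 0 ≤ z.2.2.1 ∧ z.2.2.1 < 2 * z.2.1 ∧ z.2.1 * (z.1 : ℤ) ^ 2 ≤ X}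

/-- the relation between lattice points and pairs -/
def Rel (f : ℤ × ℤ × ℤ) (v : ℤ × ℤ) (z : ℕ × ℤ × ℤ × ℤ) : Prop :=
  ∃ α β γ δ : ℤ, α * δ - β * γ = 1 ∧ z.2 = act f α β γ δ ∧ v = ((z.1 : ℤ) * α, (z.1 : ℤ) * γ)

lemma rel_val {f : ℤ × ℤ × ℤ} {v : ℤ × ℤ} {z : ℕ × ℤ × ℤ × ℤ} (h : Rel f v z) :
    formVal f v.1 v.2 = z.2.1 * (z.1 : ℤ) ^ 2 := by
  obtain ⟨α, β, γ, δ, h1, h2, h3⟩ := h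
  rw [h2, h3]
  unfold formVal act
  simp only
  ring

lemma rel_exists (f : ℤ × ℤ × ℤ) (v : ℤ × ℤ) (hv : 0 < formVal f v.1 v.2) :
    ∃ z : ℕ × ℤ × ℤ × ℤ, Rel f v z ∧ 0 < z.1 ∧ 0 < z.2.1 ∧ 0 ≤ z.2.2.1 ∧ z.2.2.1 < 2 * z.2.1 := by
  have hg : 0 < Int.gcd v.1 v.2 := by
    rw [Int.gcd_pos_iff]
    by_contra h
    push Not at h
    rw [h.1, h.2] at hv
    simp [formVal] at hv
  set g := Int.gcd v.1 v.2 with hgd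
  have hg' : (0 : ℤ) < g := by exact_mod_cast hg
  obtain ⟨a, ha⟩ := Int.gcd_dvd_left v.1 v.2
  obtain ⟨c, hc⟩ := Int.gcd_dvd_right v.1 v.2
  rw [← hgd] at ha hc
  have hb := Int.gcd_eq_gcd_ab v.1 v.2
  set x := Int.gcdA v.1 v.2
  set y := Int.gcdB v.1 v.2
  rw [← hgd] at hb
  have hdet : a * x - (-y) * c = 1 := by
    have : (g : ℤ) * (a * x - (-y) * c) = g * 1 := by
      rw [ha, hc] at hb
      linear_combination -hb
    exact mul_left_cancel₀ hg'.ne' this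
  have hval : formVal f v.1 v.2 = (g : ℤ) ^ 2 * formVal f a c := by
    rw [ha, hc]; unfold formVal; ring
  have hF : 0 < formVal f a c := by
    rw [hval] at hv
    exact pos_of_mul_pos_right hv (by positivity)
  set f1 := act f a (-y) c x with hf1
  have hA : f1.1 = formVal f a c := formVal_act _ _ _ _ _
  set k : ℤ := -(f1.2.1 / (2 * f1.1)) with hk
  have hact : act f1 1 k 0 1 = (f1.1, f1.2.1 + 2 * f1.1 * k, f1.1 * k ^ 2 + f1.2.1 * k + f1.2.2) := by
    unfold act
    refine Prod.ext ?_ (Prod.ext ?_ ?_) <;> simp only <;> ring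
  have hb' : f1.2.1 + 2 * f1.1 * k = f1.2.1 % (2 * f1.1) := by
    rw [Int.emod_def, hk]; ring
  refine ⟨(g, act f1 1 k 0 1), ⟨a * 1 + (-y) * 0, a * k + (-y) * 1, c * 1 + x * 0, c * k + x * 1, ?_, ?_, ?_⟩, hg, ?_, ?_, ?_⟩
  · linear_combination hdet
  · simp only
    rw [hf1, act_act]
  · refine Prod.ext ?_ ?_
    · simp only; rw [ha]; ring
    · simp only; rw [hc]; ring
  · rw [hact]; simp only; rw [hA]; exact hF
  · rw [hact]; simp only; rw [hb']
    exact Int.emod_nonneg _ (by rw [hA]; positivity)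
  · rw [hact]; simp only; rw [hb']
    exact Int.emod_lt_of_pos _ (by rw [hA]; positivity)

lemma rel_unique {f : ℤ × ℤ × ℤ} {v : ℤ × ℤ} {z z' : ℕ × ℤ × ℤ × ℤ} (h : Rel f v z) (h' : Rel f v z')
    (hz : 0 < z.1 ∧ 0 < z.2.1 ∧ 0 ≤ z.2.2.1 ∧ z.2.2.1 < 2 * z.2.1)
    (hz' : 0 < z'.1 ∧ 0 < z'.2.1 ∧ 0 ≤ z'.2.2.1 ∧ z'.2.2.1 < 2 * z'.2.1) : z = z' := by
  obtain ⟨α, β, γ, δ, h1, h2, h3⟩ := h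
  obtain ⟨α', β', γ', δ', h1', h2', h3'⟩ := h'
  have hgz : ∀ (g : ℕ) (α β γ δ : ℤ), α * δ - β * γ = 1 → v = ((g : ℤ) * α, (g : ℤ) * γ) → Int.gcd v.1 v.2 = g := by
    intro g α β γ δ h hv
    rw [hv]
    simp only
    rw [Int.gcd_mul_left, Int.natAbs_natCast]
    have : Int.gcd α γ = 1 := by
      rw [← Int.isCoprime_iff_gcd_eq_one]
      exact ⟨δ, -β, by linarith⟩
    rw [this, mul_one]
  have hg : z.1 = z'.1 := by rw [← hgz _ _ _ _ _ h1 h3, ← hgz _ _ _ _ _ h1' h3']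
  have hg0 : (z.1 : ℤ) ≠ 0 := by have := hz.1; omega
  rw [h3, ← hg] at h3'
  have ea : α = α' := mul_left_cancel₀ hg0 (congrArg Prod.fst h3')
  have ec : γ = γ' := mul_left_cancel₀ hg0 (congrArg Prod.snd h3')
  subst ea ec
  -- the two substitutions differ by a translation
  set k : ℤ := δ * β' - β * δ' with hk
  have e1 : β' = α * k + β := by rw [hk]; linear_combination (-β') * h1 + β * h1'
  have e2 : δ' = γ * k + δ := by rw [hk]; linear_combination (-δ') * h1 + δ * h1'
  have hact : z'.2 = act z.2 1 k 0 1 := by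
    rw [h2', h2, act_act, e1, e2]
    congr 1 <;> ring
  have hact' : act z.2 1 k 0 1 = (z.2.1, z.2.2.1 + 2 * z.2.1 * k, z.2.1 * k ^ 2 + z.2.2.1 * k + z.2.2.2) := by
    unfold act
    refine Prod.ext ?_ (Prod.ext ?_ ?_) <;> simp only <;> ring
  have hk0 : k = 0 := by
    rw [hact, hact'] at hz'
    simp only at hz'
    obtain ⟨_, a1, a2, a3⟩ := hz'
    obtain ⟨_, b1, b2, b3⟩ := hz
    by_contra hk0
    rcases lt_or_gt_of_ne hk0 with h | h
    · nlinarith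
    · nlinarith
  rw [hk0, act_one] at hact
  exact Prod.ext hg hact.symm

lemma nonsq_lead {f : ℤ × ℤ × ℤ} {d : ℤ} (hfd : formDisc f = d) (hns : ¬ IsSquare d) : f.1 ≠ 0 := by
  intro h
  apply hns
  rw [← hfd]
  unfold formDisc
  rw [h]
  exact ⟨f.2.1, by ring⟩

lemma orbit_count (f : ℤ × ℤ × ℤ) {d : ℤ} (hd : 0 < d) (hns : ¬ IsSquare d) (hp : pellOK d)
    (hf : IsPrimitiveForm f) (hfd : formDisc f = d) (X : ℕ) :
    Nat.card {v : ℤ × ℤ // inC f d v ∧ formVal f v.1 v.2 ≤ X} =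
      Nat.card {z : ℕ × ℤ × ℤ × ℤ // z ∈ W d X ∧ formEquiv f z.2} := by
  have hA : f.1 ≠ 0 := nonsq_lead hfd hns
  have hs : Real.sqrt d ^ 2 = formDisc f := by rw [hfd]; exact sq_s hd
  have hA' : (f.1 : ℝ) ≠ 0 := by exact_mod_cast hA
  have hpos : ∀ v, inC f d v → 0 < formVal f v.1 v.2 := by
    intro v hv
    have hm := lin_mul f _ hs v.1 v.2
    have h1 : 0 < (f.1 * lin f (-Real.sqrt d) v.1 v.2) * lin f (Real.sqrt d) v.1 v.2 := mul_pos hv.1 (hv.1.trans_le hv.2.1)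
    have h2 : (f.1 * lin f (-Real.sqrt d) v.1 v.2) * lin f (Real.sqrt d) v.1 v.2 = 4 * (f.1 : ℝ) ^ 2 * formVal f v.1 v.2 := by
      linear_combination (f.1 : ℝ) * hm
    rw [h2] at h1
    have : (0 : ℝ) < formVal f v.1 v.2 := pos_of_mul_pos_right h1 (by positivity)
    exact_mod_cast this
  have hex : ∀ v : {v : ℤ × ℤ // inC f d v ∧ formVal f v.1 v.2 ≤ X}, ∃ z : {z : ℕ × ℤ × ℤ × ℤ // z ∈ W d X ∧ formEquiv f z.2},
      Rel f v.1 z.1 := by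
    rintro ⟨v, hv, hX⟩
    obtain ⟨z, hR, a1, a2, a3, a4⟩ := rel_exists f v (hpos v hv)
    have hval := rel_val hR
    refine ⟨⟨z, ⟨a1, ?_, a2, a3, a4, by rw [← hval]; exact hX⟩, ?_⟩, hR⟩
    · obtain ⟨α, β, γ, δ, h1, h2, h3⟩ := hR
      rw [h2, formDisc_act _ _ _ _ _ h1, hfd]
    · obtain ⟨α, β, γ, δ, h1, h2, h3⟩ := hR
      exact (formEquiv_iff _ _).2 ⟨α, β, γ, δ, h1, h2⟩
  choose Φ hΦ using hex
  refine Nat.card_congr (Equiv.ofBijective Φ ⟨?_, ?_⟩)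
  · intro v w hvw
    have r1 := hΦ v
    have r2 := hΦ w
    rw [← hvw] at r2
    obtain ⟨α, β, γ, δ, h1, h2, h3⟩ := r1
    obtain ⟨α', β', γ', δ', h1', h2', h3'⟩ := r2
    have hU : act f (α' * δ + β' * -γ) (α' * -β + β' * α) (γ' * δ + δ' * -γ) (γ' * -β + δ' * α) = f := by
      rw [← act_act, ← h2', h2, act_inv _ _ _ _ _ h1]
    have hD : (α' * δ + β' * -γ) * (γ' * -β + δ' * α) - (α' * -β + β' * α) * (γ' * δ + δ' * -γ) = 1 := by
      linear_combination (α' * δ' - β' * γ') * h1 + h1'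
    have hw : w.1 = ((α' * δ + β' * -γ) * v.1.1 + (α' * -β + β' * α) * v.1.2,
        (γ' * δ + δ' * -γ) * v.1.1 + (γ' * -β + δ' * α) * v.1.2) := by
      rw [h3', h3]
      refine Prod.ext ?_ ?_ <;> simp only
      · linear_combination (-((Φ v).1.1 : ℤ) * α') * h1
      · linear_combination (-((Φ v).1.1 : ℤ) * γ') * h1
    have := cone_unique f hd hp hf hfd hA _ _ _ _ hD hU v.1 v.2.1 (by rw [← hw]; exact w.2.1)
    rw [← hw] at this
    exact Subtype.ext this.symm
  · rintro ⟨z, hz, he⟩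
    obtain ⟨α, β, γ, δ, h1, h2⟩ := (formEquiv_iff _ _).1 he
    have hR0 : Rel f ((z.1 : ℤ) * α, (z.1 : ℤ) * γ) z := ⟨α, β, γ, δ, h1, h2, rfl⟩
    have hv0 := rel_val hR0
    have hzp : 0 < z.2.1 * (z.1 : ℤ) ^ 2 := by
      have := hz.1
      have := hz.2.2.1
      positivity
    obtain ⟨a, b, c, e, k1, k2, k3⟩ := cone_exists f hd hp hfd hA ((z.1 : ℤ) * α, (z.1 : ℤ) * γ) (by rw [hv0]; exact hzp)
    have hR : Rel f (a * ((z.1 : ℤ) * α) + b * ((z.1 : ℤ) * γ), c * ((z.1 : ℤ) * α) + e * ((z.1 : ℤ) * γ)) z := by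
      refine ⟨a * α + b * γ, a * β + b * δ, c * α + e * γ, c * β + e * δ, ?_, ?_, ?_⟩
      · linear_combination (α * δ - β * γ) * k1 + h1
      · rw [← act_act, k2]; exact h2
      · refine Prod.ext ?_ ?_ <;> simp only <;> ring
    refine ⟨⟨_, k3, ?_⟩, ?_⟩
    · have := rel_val hR
      simp only at this ⊢
      rw [this]; exact hz.2.2.2.2.2
    · apply Subtype.ext
      have hu := (Φ ⟨_, k3, by have := rel_val hR; simp only at this ⊢; rw [this]; exact hz.2.2.2.2.2⟩).2.1
      exact rel_unique (hΦ _) hR ⟨hu.1, hu.2.2.1, hu.2.2.2.1, hu.2.2.2.2.1⟩ ⟨hz.1, hz.2.2.1, hz.2.2.2.1, hz.2.2.2.2.1⟩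

lemma class_count (f : ℤ × ℤ × ℤ) {d : ℤ} (hd : 0 < d) (hns : ¬ IsSquare d) (hp : pellOK d)
    (hf : IsPrimitiveForm f) (hfd : formDisc f = d) :
    Tendsto (fun X : ℕ => (Nat.card {z : ℕ × ℤ × ℤ × ℤ // z ∈ W d X ∧ formEquiv f z.2} : ℝ) / X) atTop
      (nhds (Real.log (eps d) / Real.sqrt d)) := by
  have hA : f.1 ≠ 0 := nonsq_lead hfd hns
  have hs : Real.sqrt d ^ 2 = formDisc f := by rw [hfd]; exact sq_s hd
  have hs0 : 0 < Real.sqrt d := Real.sqrt_pos.2 (by exact_mod_cast hd)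
  have hA' : (f.1 : ℝ) ≠ 0 := by exact_mod_cast hA
  have heps := one_lt_eps hd hp
  have hD : (2 * (f.1 : ℝ) ^ 2) * (f.2.1 + Real.sqrt d) - (f.1 * (f.2.1 - Real.sqrt d)) * (2 * f.1) =
      4 * (f.1 : ℝ) ^ 2 * Real.sqrt d := by ring
  have hD0 : 0 < 4 * (f.1 : ℝ) ^ 2 * Real.sqrt d := by positivity
  have key := cone_count (2 * (f.1 : ℝ) ^ 2) (f.1 * (f.2.1 - Real.sqrt d)) (2 * f.1) (f.2.1 + Real.sqrt d) (eps d ^ 2)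
    (by rw [hD]; exact hD0.ne') (by nlinarith)
  have hlog : Real.log (eps d ^ 2) / 2 = Real.log (eps d) := by
    rw [Real.log_pow]; push_cast; ring
  rw [hD, hlog, abs_of_pos hD0] at key
  have hlim : Tendsto (fun X : ℕ => 4 * (f.1 : ℝ) ^ 2 * (X : ℝ)) atTop atTop :=
    Tendsto.const_mul_atTop (by positivity) tendsto_natCast_atTop_atTop
  have key2 := (key.comp hlim).const_mul (4 * (f.1 : ℝ) ^ 2)
  have e : 4 * (f.1 : ℝ) ^ 2 * (Real.log (eps d) / (4 * (f.1 : ℝ) ^ 2 * Real.sqrt d)) = Real.log (eps d) / Real.sqrt d := by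
    field_simp
  rw [e] at key2
  refine key2.congr fun X => ?_
  simp only [Function.comp]
  rw [← orbit_count f hd hns hp hf hfd X]
  have hcard : Nat.card {v : ℤ × ℤ // (0 < (2 * (f.1 : ℝ) ^ 2) * v.1 + (f.1 * (f.2.1 - Real.sqrt d)) * v.2 ∧
      (2 * (f.1 : ℝ) ^ 2) * v.1 + (f.1 * (f.2.1 - Real.sqrt d)) * v.2 ≤ (2 * f.1) * v.1 + (f.2.1 + Real.sqrt d) * v.2 ∧
      (2 * f.1) * v.1 + (f.2.1 + Real.sqrt d) * v.2 < eps d ^ 2 * ((2 * (f.1 : ℝ) ^ 2) * v.1 + (f.1 * (f.2.1 - Real.sqrt d)) * v.2)) ∧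
      ((2 * (f.1 : ℝ) ^ 2) * v.1 + (f.1 * (f.2.1 - Real.sqrt d)) * v.2) * ((2 * f.1) * v.1 + (f.2.1 + Real.sqrt d) * v.2) ≤
        4 * (f.1 : ℝ) ^ 2 * (X : ℝ)} = Nat.card {v : ℤ × ℤ // inC f d v ∧ formVal f v.1 v.2 ≤ X} := by
    refine Nat.card_congr (Equiv.subtypeEquivRight fun v => ?_)
    have e1 : (2 * (f.1 : ℝ) ^ 2) * v.1 + (f.1 * (f.2.1 - Real.sqrt d)) * v.2 = f.1 * lin f (-Real.sqrt d) v.1 v.2 := by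
      unfold lin; ring
    have e2 : (2 * f.1) * v.1 + (f.2.1 + Real.sqrt d) * v.2 = lin f (Real.sqrt d) v.1 v.2 := by
      unfold lin; ring
    have h2 : (f.1 * lin f (-Real.sqrt d) v.1 v.2) * lin f (Real.sqrt d) v.1 v.2 = 4 * (f.1 : ℝ) ^ 2 * formVal f v.1 v.2 := by
      linear_combination (f.1 : ℝ) * lin_mul f _ hs v.1 v.2
    rw [e1, e2, h2]
    have : 4 * (f.1 : ℝ) ^ 2 * formVal f v.1 v.2 ≤ 4 * (f.1 : ℝ) ^ 2 * (X : ℝ) ↔ formVal f v.1 v.2 ≤ X := by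
      rw [mul_le_mul_iff_right₀ (by positivity)]; norm_cast
    rw [this]; rfl
  rw [hcard]
  field_simp

end PF

namespace PF

lemma W_finite (D : ℤ) (X : ℕ) : (W D X).Finite := by
  have hinj : Set.InjOn (fun z : ℕ × ℤ × ℤ × ℤ => (z.1, z.2.1, z.2.2.1)) (W D X) := by
    rintro ⟨g, a, b, c⟩ h ⟨g', a', b', c'⟩ h' e
    simp only [Prod.mk.injEq] at e
    obtain ⟨rfl, rfl, rfl⟩ := e
    have h1 := h.2.1
    have h2 := h'.2.1
    have h3 : 0 < a := h.2.2.1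
    unfold formDisc at h1 h2
    simp only at h1 h2
    have : a * c = a * c' := by linarith
    rw [mul_left_cancel₀ h3.ne' this]
  refine Set.Finite.of_finite_image ?_ hinj
  refine ((Set.finite_Icc 0 X).prod ((Set.finite_Icc (0 : ℤ) X).prod (Set.finite_Icc (0 : ℤ) (2 * X)))).subset ?_
  rintro _ ⟨⟨g, a, b, c⟩, h, rfl⟩
  obtain ⟨h1, h2, h3, h4, h5, h6⟩ := h
  simp only at h1 h3 h4 h5 h6
  have hg : (1 : ℤ) ≤ g := by exact_mod_cast h1
  have hgX : (g : ℤ) ≤ X := by nlinarith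
  have haX : a ≤ X := (le_mul_of_one_le_right h3.le (one_le_pow₀ hg)).trans h6
  refine ⟨⟨Nat.zero_le _, by exact_mod_cast hgX⟩, ⟨h3.le, haX⟩, ⟨h4, by simp only; linarith⟩⟩

lemma fiber_rho (n k a : ℕ) (hk : k ≠ 0) (ha : 0 < a) (S : Finset (ℕ × ℤ × ℤ × ℤ))
    (hS : ∀ z, z ∈ S ↔ (0 < z.1 ∧ formDisc z.2 = (n : ℤ) ^ 2 - 4 ∧ z.2.1 = a ∧ 0 ≤ z.2.2.1 ∧ z.2.2.1 < 2 * a ∧ z.1 ^ 2 = k)) :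
    (S.card : ℤ) = sqA k * rhoA n a := by
  classical
  rw [sqA_apply, rhoA_apply _ _ ha.ne']
  by_cases hsq : IsSquare k
  swap
  · rw [if_neg (by tauto), zero_mul]
    have : S = ∅ := by
      apply Finset.eq_empty_of_forall_notMem
      intro z hz
      apply hsq
      rw [hS] at hz
      exact ⟨z.1, by rw [← hz.2.2.2.2.2]; ring⟩
    rw [this]; rfl
  rw [if_pos ⟨hk, hsq⟩, one_mul]
  obtain ⟨g0, hg0⟩ := hsq
  have ha' : (0 : ℤ) < a := by exact_mod_cast ha
  norm_cast
  rw [← Nat.card_eq_finsetCard S]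
  unfold rho
  have hq : ∀ z ∈ S, ∃ q : ℤ, z.2.2.1 + n = 2 * q ∧ q ^ 2 - n * q + 1 = a * z.2.2.2 := by
    intro z hz
    rw [hS] at hz
    obtain ⟨h1, h2, h3, h4, h5, h6⟩ := hz
    unfold formDisc at h2
    rw [h3] at h2
    have : (2 : ℤ) ∣ (z.2.2.1 + n) ^ 2 := ⟨n ^ 2 - 2 + 2 * a * z.2.2.2 + z.2.2.1 * n, by linear_combination h2⟩
    obtain ⟨q, hq⟩ := Int.prime_two.dvd_of_dvd_pow this
    refine ⟨q, hq, ?_⟩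
    have hb : z.2.2.1 = 2 * q - n := by linarith
    rw [hb] at h2
    linarith
  refine Nat.card_congr (Equiv.ofBijective (fun z => ⟨(((z.1.2.2.1 + n) / 2 : ℤ) : ZMod a), ?_⟩) ⟨?_, ?_⟩)
  · obtain ⟨q, hq1, hq2⟩ := hq z.1 z.2
    rw [hq1, Int.mul_ediv_cancel_left _ two_ne_zero]
    have : ((q ^ 2 - n * q + 1 : ℤ) : ZMod a) = ((a * z.1.2.2.2 : ℤ) : ZMod a) := by rw [hq2]
    push_cast at this
    rw [this]; simp
  · rintro ⟨z, hz⟩ ⟨z', hz'⟩ h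
    obtain ⟨q, hq1, hq2⟩ := hq z hz
    obtain ⟨q', hq1', hq2'⟩ := hq z' hz'
    have h := congrArg Subtype.val h
    simp only at h
    rw [hq1, hq1', Int.mul_ediv_cancel_left _ two_ne_zero, Int.mul_ediv_cancel_left _ two_ne_zero,
      ZMod.intCast_eq_intCast_iff_dvd_sub] at h
    obtain ⟨r, hr⟩ := h
    have m1 := (hS _).1 hz
    have m2 := (hS _).1 hz'
    have hbb : z'.2.2.1 - z.2.2.1 = 2 * a * r := by linarith
    have hr0 : r = 0 := by
      by_contra hne
      rcases lt_or_gt_of_ne hne with h | h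
      · nlinarith
      · nlinarith
    rw [hr0, mul_zero] at hr
    have hqq : q = q' := by linarith
    apply Subtype.ext
    have e1 : z.1 = z'.1 := by
      have : z.1 ^ 2 = z'.1 ^ 2 := by rw [m1.2.2.2.2.2, m2.2.2.2.2.2]
      exact Nat.pow_left_injective two_ne_zero this
    have e4 : z.2.2.2 = z'.2.2.2 := by
      apply mul_left_cancel₀ ha'.ne'
      rw [← hq2, ← hq2', hqq]
    refine Prod.ext e1 (Prod.ext (by rw [m1.2.2.1, m2.2.2.1]) (Prod.ext ?_ e4))
    rw [hr0, mul_zero] at hbb; linarith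
  · rintro ⟨x, hx⟩
    obtain ⟨y, rfl⟩ := ZMod.intCast_surjective x
    set b : ℤ := (2 * y - n) % (2 * a) with hb
    set k' : ℤ := (2 * y - n) / (2 * a) with hk'
    have hbk : b = 2 * (y - a * k') - n := by rw [hb, Int.emod_def]; ring
    set q : ℤ := y - a * k' with hqd
    have hqy : ((q : ℤ) : ZMod a) = y := by rw [hqd]; push_cast; simp
    have hdv : (a : ℤ) ∣ q ^ 2 - n * q + 1 := by
      rw [← ZMod.intCast_zmod_eq_zero_iff_dvd]
      push_cast
      rw [hqy]; exact hx
    obtain ⟨c, hc⟩ := hdv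
    refine ⟨⟨(g0, (a : ℤ), b, c), ?_⟩, ?_⟩
    · rw [hS]
      simp only
      refine ⟨?_, ?_, trivial, Int.emod_nonneg _ (by positivity), Int.emod_lt_of_pos _ (by positivity), by rw [hg0]; ring⟩
      · rcases Nat.eq_zero_or_pos g0 with h | h
        · rw [h] at hg0; omega
        · exact h
      · unfold formDisc
        simp only
        rw [hbk]
        linear_combination 4 * hc
    · apply Subtype.ext
      simp only
      rw [hbk, sub_add_cancel, Int.mul_ediv_cancel_left _ two_ne_zero]
      exact hqy

lemma W_total (n X : ℕ) :
    (∑ m ∈ Finset.Ioc 0 X, (sqA * rhoA n) m : ℤ) = ((W_finite ((n : ℤ) ^ 2 - 4) X).toFinset.card : ℤ) := by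
  classical
  set Wf := (W_finite ((n : ℤ) ^ 2 - 4) X).toFinset with hWf
  have hmem : ∀ z, z ∈ Wf ↔ z ∈ W ((n : ℤ) ^ 2 - 4) X := fun z => Set.Finite.mem_toFinset _
  have h1 : Wf.card = ∑ m ∈ Finset.Ioc 0 X, (Wf.filter (fun z => z.1 ^ 2 * z.2.1.toNat = m)).card := by
    apply Finset.card_eq_sum_card_fiberwise
    intro z hz
    obtain ⟨h1, h2, h3, h4, h5, h6⟩ := (hmem z).1 hz
    obtain ⟨a, ha⟩ := Int.eq_ofNat_of_zero_le h3.le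
    rw [ha] at h3 h6
    simp only [Finset.coe_Ioc, Set.mem_Ioc, ha, Int.toNat_natCast]
    have h3' : 0 < a := by exact_mod_cast h3
    refine ⟨by positivity, ?_⟩
    rw [mul_comm]; exact_mod_cast h6
  rw [h1]
  push_cast
  refine Finset.sum_congr rfl fun m hm => ?_
  rw [Finset.mem_Ioc] at hm
  have h2 : (Wf.filter (fun z => z.1 ^ 2 * z.2.1.toNat = m)).card =
      ∑ p ∈ m.divisorsAntidiagonal, ((Wf.filter (fun z => z.1 ^ 2 * z.2.1.toNat = m)).filter
        (fun z => (z.1 ^ 2, z.2.1.toNat) = p)).card := by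
    apply Finset.card_eq_sum_card_fiberwise
    intro z hz
    have := (Finset.mem_filter.1 hz).2
    rw [Finset.mem_coe, Nat.mem_divisorsAntidiagonal]
    exact ⟨this, by omega⟩
  rw [h2, ArithmeticFunction.mul_apply]
  push_cast
  refine Finset.sum_congr rfl fun p hp => ?_
  obtain ⟨k, a⟩ := p
  rw [Nat.mem_divisorsAntidiagonal] at hp
  obtain ⟨hp1, hp2⟩ := hp
  simp only at hp1
  have hk : k ≠ 0 := by rintro rfl; simp at hp1; omega
  have ha : 0 < a := by rcases Nat.eq_zero_or_pos a with rfl | h; · simp at hp1; omega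
                        · exact h
  symm
  apply fiber_rho n k a hk ha
  intro z
  rw [Finset.mem_filter, Finset.mem_filter, hmem, Prod.mk.injEq]
  constructor
  · rintro ⟨⟨⟨a1, a2, a3, a4, a5, a6⟩, b⟩, c1, c2⟩
    have hz : z.2.1 = a := by rw [← c2, Int.toNat_of_nonneg a3.le]
    rw [hz] at a5
    exact ⟨a1, a2, hz, a4, a5, c1⟩
  · rintro ⟨a1, a2, a3, a4, a5, a6⟩
    have hz : z.2.1.toNat = a := by rw [a3, Int.toNat_natCast]
    refine ⟨⟨⟨a1, a2, by rw [a3]; exact_mod_cast ha, a4, by rw [a3]; exact a5, ?_⟩, by rw [a6, hz, hp1]⟩, a6, hz⟩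
    rw [a3]
    have : a * z.1 ^ 2 ≤ X := by rw [a6, mul_comm, hp1]; exact hm.2
    exact_mod_cast this

end PF

namespace PF

/-- primitive part of `W` -/
def Wp (D : ℤ) (X : ℕ) : Set (ℕ × ℤ × ℤ × ℤ) := {z | z ∈ W D X ∧ IsPrimitiveForm z.2}

lemma Wp_finite (D : ℤ) (X : ℕ) : (Wp D X).Finite := (W_finite D X).subset fun _ h => h.1

/-- the index set of the sum defining `ampA` -/
def idx (n : ℕ) : Finset (ℕ × ℕ) := (Finset.range (n ^ 2) ×ˢ Finset.range (n ^ 2)).filter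
      (fun p => 0 < p.1 ∧ 0 < p.2 ∧ (p.1 % 4 = 0 ∨ p.1 % 4 = 1) ∧ p.1 * p.2 ^ 2 = n ^ 2 - 4)

/-- content of a form -/
def content (f : ℤ × ℤ × ℤ) : ℕ := Int.gcd f.1 (Int.gcd f.2.1 f.2.2)

lemma content_smul (u : ℕ) (a b c : ℤ) : content ((u : ℤ) * a, (u : ℤ) * b, (u : ℤ) * c) = u * content (a, b, c) := by
  unfold content
  simp only
  rw [Int.gcd_mul_left, Int.natAbs_natCast]
  push_cast
  rw [Int.gcd_mul_left, Int.natAbs_natCast]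

lemma content_ex (f : ℤ × ℤ × ℤ) (h : content f ≠ 0) : ∃ a b c : ℤ,
    f = ((content f : ℤ) * a, (content f : ℤ) * b, (content f : ℤ) * c) ∧ IsPrimitiveForm (a, b, c) := by
  obtain ⟨a, ha⟩ : (content f : ℤ) ∣ f.1 := Int.gcd_dvd_left _ _
  obtain ⟨b, hb⟩ : (content f : ℤ) ∣ f.2.1 := (Int.gcd_dvd_right _ _).trans (Int.gcd_dvd_left _ _)
  obtain ⟨c, hc⟩ : (content f : ℤ) ∣ f.2.2 := (Int.gcd_dvd_right _ _).trans (Int.gcd_dvd_right _ _)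
  have hf : f = ((content f : ℤ) * a, (content f : ℤ) * b, (content f : ℤ) * c) := Prod.ext ha (Prod.ext hb hc)
  refine ⟨a, b, c, hf, ?_⟩
  have := content_smul (content f) a b c
  rw [← hf] at this
  have h2 : content f * content (a, b, c) = content f * 1 := by rw [← this, mul_one]
  exact Nat.eq_of_mul_eq_mul_left (Nat.pos_of_ne_zero h) h2

lemma W_decomp (n X : ℕ) (hn : 3 ≤ n) :
    (W_finite ((n : ℤ) ^ 2 - 4) X).toFinset.card = ∑ p ∈ idx n, (Wp_finite (p.1 : ℤ) (X / p.2)).toFinset.card := by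
  classical
  set Wf := (W_finite ((n : ℤ) ^ 2 - 4) X).toFinset with hWf
  have hmem : ∀ z, z ∈ Wf ↔ z ∈ W ((n : ℤ) ^ 2 - 4) X := fun z => Set.Finite.mem_toFinset _
  have hn9 : 9 ≤ n ^ 2 := by nlinarith
  have hD : ((n ^ 2 - 4 : ℕ) : ℤ) = (n : ℤ) ^ 2 - 4 := by
    rw [Nat.cast_sub (by omega)]; push_cast; ring
  have h1 : Wf.card = ∑ p ∈ idx n, (Wf.filter (fun z => ((n ^ 2 - 4) / content z.2 ^ 2, content z.2) = p)).card := by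
    apply Finset.card_eq_sum_card_fiberwise
    intro z hz
    obtain ⟨h1, h2, h3, h4, h5, h6⟩ := (hmem z).1 hz
    have hu : content z.2 ≠ 0 := by
      unfold content
      intro h
      rw [Int.gcd_eq_zero_iff] at h
      omega
    obtain ⟨a, b, c, hf, hprim⟩ := content_ex z.2 hu
    set u := content z.2 with hu'
    have hdisc : (u : ℤ) ^ 2 * (b ^ 2 - 4 * a * c) = (n : ℤ) ^ 2 - 4 := by
      rw [← h2, hf]; unfold formDisc; simp only; ring
    have hupos : (0 : ℤ) < (u : ℤ) ^ 2 := by positivity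
    have hdpos : 0 < b ^ 2 - 4 * a * c := by
      have : 0 < (u : ℤ) ^ 2 * (b ^ 2 - 4 * a * c) := by rw [hdisc, ← hD]; exact_mod_cast (by omega)
      exact pos_of_mul_pos_right this hupos.le
    obtain ⟨d, hd⟩ := Int.eq_ofNat_of_zero_le hdpos.le
    rw [hd, ← hD] at hdisc
    have hdisc' : u ^ 2 * d = n ^ 2 - 4 := by exact_mod_cast hdisc
    have hdd : (n ^ 2 - 4) / u ^ 2 = d := by
      rw [← hdisc']; exact Nat.mul_div_cancel_left _ (by positivity)
    have hd0 : 0 < d := by rw [hd] at hdpos; exact_mod_cast hdpos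
    rw [Finset.mem_coe, idx, Finset.mem_filter, Finset.mem_product, Finset.mem_range, Finset.mem_range]
    simp only
    rw [← hu', hdd]
    have hu1 : 1 ≤ u := Nat.pos_of_ne_zero hu
    refine ⟨⟨?_, ?_⟩, hd0, hu1, ?_, by rw [mul_comm]; exact hdisc'⟩
    · have : d ≤ u ^ 2 * d := Nat.le_mul_of_pos_left _ (by positivity)
      omega
    · have : u ^ 2 ≤ u ^ 2 * d := Nat.le_mul_of_pos_right _ hd0
      have : u ≤ u ^ 2 := Nat.le_self_pow two_ne_zero u
      omega
    · have hb : b ^ 2 % 4 = 0 ∨ b ^ 2 % 4 = 1 := by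
        rcases Int.even_or_odd' b with ⟨k, rfl | rfl⟩
        · left; ring_nf; omega
        · right; ring_nf; omega
      have : (d : ℤ) = b ^ 2 - 4 * (a * c) := by rw [← mul_assoc]; exact hd.symm
      omega
  rw [h1]
  refine Finset.sum_congr rfl fun p hp => ?_
  obtain ⟨d, u⟩ := p
  rw [idx, Finset.mem_filter] at hp
  obtain ⟨_, hd0, hu0, _, hdu⟩ := hp
  simp only at hd0 hu0 hdu
  have hu0' : (0 : ℤ) < u := by exact_mod_cast hu0
  have hduZ : (d : ℤ) * (u : ℤ) ^ 2 = (n : ℤ) ^ 2 - 4 := by rw [← hD, ← hdu]; push_cast; ring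
  have hle : ∀ (a : ℤ) (g : ℕ), 0 < a → (a * (g : ℤ) ^ 2 ≤ ((X / u : ℕ) : ℤ) ↔ (u : ℤ) * a * (g : ℤ) ^ 2 ≤ X) := by
    intro a g ha
    obtain ⟨a', rfl⟩ := Int.eq_ofNat_of_zero_le ha.le
    have : a' * g ^ 2 ≤ X / u ↔ u * a' * g ^ 2 ≤ X := by
      rw [Nat.le_div_iff_mul_le hu0]
      have : a' * g ^ 2 * u = u * a' * g ^ 2 := by ring
      rw [this]
    exact_mod_cast this
  symm
  refine Finset.card_bij (fun z _ => (z.1, (u : ℤ) * z.2.1, (u : ℤ) * z.2.2.1, (u : ℤ) * z.2.2.2)) ?_ ?_ ?_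
  · rintro ⟨g, a, b, c⟩ hz
    rw [Set.Finite.mem_toFinset] at hz
    obtain ⟨⟨h1, h2, h3, h4, h5, h6⟩, hpr⟩ := hz
    simp only at h1 h2 h3 h4 h5 h6
    rw [Finset.mem_filter, hmem]
    have hcont : content ((u : ℤ) * a, (u : ℤ) * b, (u : ℤ) * c) = u := by
      rw [content_smul]
      have : content (a, b, c) = 1 := hpr
      rw [this, mul_one]
    refine ⟨⟨h1, ?_, ?_, ?_, ?_, ?_⟩, ?_⟩
    · rw [← hduZ, ← h2]; unfold formDisc; simp only; ring
    · exact mul_pos hu0' h3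
    · exact mul_nonneg hu0'.le h4
    · simp only; nlinarith
    · simp only
      exact (hle a g h3).1 h6
    · simp only
      rw [hcont, ← hdu, Nat.mul_div_cancel _ (by positivity)]
  · rintro ⟨g, a, b, c⟩ _ ⟨g', a', b', c'⟩ _ h
    simp only [Prod.mk.injEq] at h
    obtain ⟨h1, h2, h3, h4⟩ := h
    rw [h1, mul_left_cancel₀ hu0'.ne' h2, mul_left_cancel₀ hu0'.ne' h3, mul_left_cancel₀ hu0'.ne' h4]
  · rintro ⟨g, f⟩ hz
    rw [Finset.mem_filter, hmem] at hz
    obtain ⟨⟨h1, h2, h3, h4, h5, h6⟩, hc⟩ := hz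
    simp only [Prod.mk.injEq] at h1 h2 h3 h4 h5 h6 hc
    obtain ⟨_, hc⟩ := hc
    obtain ⟨a, b, c, hf, hprim⟩ := content_ex f (by rw [hc]; exact hu0.ne')
    rw [hc] at hf
    subst hf
    simp only at h3 h4 h5 h6
    have ha : 0 < a := pos_of_mul_pos_right h3 hu0'.le
    refine ⟨(g, a, b, c), ?_, rfl⟩
    rw [Set.Finite.mem_toFinset]
    refine ⟨⟨h1, ?_, ha, ?_, ?_, ?_⟩, hprim⟩
    · have : (u : ℤ) ^ 2 * formDisc (a, b, c) = (u : ℤ) ^ 2 * d := by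
        rw [mul_comm _ (d : ℤ), hduZ, ← h2]; unfold formDisc; simp only; ring
      exact mul_left_cancel₀ (by positivity) this
    · exact nonneg_of_mul_nonneg_right h4 hu0'
    · simp only
      have : (u : ℤ) * b < u * (2 * a) := by linarith
      exact lt_of_mul_lt_mul_left this hu0'.le
    · exact (hle a g ha).2 h6

end PF

namespace PF

/-- primitive forms of discriminant `d` -/
abbrev PForm (d : ℤ) := {f : ℤ × ℤ × ℤ // IsPrimitiveForm f ∧ formDisc f = d}
/-- equivalence classes -/
abbrev Cl (d : ℤ) := Quot (fun f g : PForm d => formEquiv f.1 g.1)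

lemma Cl_eq {d : ℤ} (f g : PForm d) :
    (Quot.mk (fun f g : PForm d => formEquiv f.1 g.1) f = Quot.mk (fun f g : PForm d => formEquiv f.1 g.1) g) ↔ formEquiv f.1 g.1 := by
  have he : Equivalence (fun f g : PForm d => formEquiv f.1 g.1) :=
    ⟨fun f => formEquiv_refl _, fun h => formEquiv_symm h, fun h h' => formEquiv_trans h h'⟩
  rw [Quot.eq, he.eqvGen_iff]

open Classical in
/-- class of the form in a pair -/
noncomputable def cls (d : ℤ) (z : ℕ × ℤ × ℤ × ℤ) : Option (Cl d) :=
  if h : IsPrimitiveForm z.2 ∧ formDisc z.2 = d then some (Quot.mk _ ⟨z.2, h⟩) else none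

open Classical in
/-- number of pairs in a given class -/
noncomputable def NC (d : ℤ) (X : ℕ) (C : Cl d) : ℕ :=
  ((Wp_finite d X).toFinset.filter (fun z => cls d z = some C)).card

lemma NC_lim {d : ℤ} (hd : 0 < d) (hns : ¬ IsSquare d) (hp : pellOK d) (C : Cl d) :
    Tendsto (fun X : ℕ => (NC d X C : ℝ) / X) atTop (nhds (Real.log (eps d) / Real.sqrt d)) := by
  classical
  induction C using Quot.ind with
  | mk f =>
    refine (class_count f.1 hd hns hp f.2.1 f.2.2).congr fun X => ?_
    congr 2
    unfold NC
    rw [← Nat.card_eq_finsetCard]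
    refine Nat.card_congr (Equiv.subtypeEquivRight fun z => ?_)
    rw [Finset.mem_filter, Set.Finite.mem_toFinset]
    constructor
    · rintro ⟨h1, h2⟩
      have hpr : IsPrimitiveForm z.2 := by
        obtain ⟨α, β, γ, δ, k1, k2⟩ := (formEquiv_iff _ _).1 h2
        rw [k2]; exact prim_act _ _ _ _ _ k1 f.2.1
      refine ⟨⟨h1, hpr⟩, ?_⟩
      unfold cls
      rw [dif_pos ⟨hpr, h1.2.1⟩, Option.some_inj, Cl_eq]
      exact formEquiv_symm h2
    · rintro ⟨⟨h1, hpr⟩, h2⟩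
      unfold cls at h2
      rw [dif_pos ⟨hpr, h1.2.1⟩, Option.some_inj, Cl_eq] at h2
      exact ⟨h1, formEquiv_symm h2⟩

lemma NC_sum_le (d : ℤ) (X : ℕ) (s : Finset (Cl d)) : ∑ C ∈ s, NC d X C ≤ (Wp_finite d X).toFinset.card := by
  classical
  have := Finset.sum_card_fiberwise_eq_card_filter (Wp_finite d X).toFinset (s.map Function.Embedding.some) (cls d)
  rw [Finset.sum_map] at this
  unfold NC
  calc _ = _ := this
    _ ≤ _ := Finset.card_filter_le _ _

lemma NC_sum_eq (d : ℤ) (X : ℕ) [Fintype (Cl d)] : ∑ C : Cl d, NC d X C = (Wp_finite d X).toFinset.card := by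
  classical
  have := Finset.sum_card_fiberwise_eq_card_filter (Wp_finite d X).toFinset (Finset.univ.map Function.Embedding.some) (cls d)
  rw [Finset.sum_map] at this
  unfold NC
  refine Eq.trans this ?_
  rw [Finset.filter_true_of_mem]
  intro z hz
  rw [Set.Finite.mem_toFinset] at hz
  rw [Finset.mem_map]
  unfold cls
  rw [dif_pos ⟨hz.2, hz.1.2.1⟩]
  exact ⟨_, Finset.mem_univ _, rfl⟩

lemma W_lim (n : ℕ) (hn : 3 ≤ n) :
    Tendsto (fun X : ℕ => ((W_finite ((n : ℤ) ^ 2 - 4) X).toFinset.card : ℝ) / X) atTop (nhds (Aval n)) := by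
  refine (mean_R n hn).congr fun X => ?_
  rw [W_total]; push_cast; rfl

lemma idx_spec {n : ℕ} (hn : 3 ≤ n) {p : ℕ × ℕ} (hp : p ∈ idx n) :
    0 < p.2 ∧ 0 < (p.1 : ℤ) ∧ ¬ IsSquare (p.1 : ℤ) ∧ pellOK p.1 := by
  rw [idx, Finset.mem_filter] at hp
  obtain ⟨_, hd0, hu0, _, hdu⟩ := hp
  have hn9 : 9 ≤ n ^ 2 := by nlinarith
  refine ⟨hu0, by exact_mod_cast hd0, ?_, n, p.2, by omega, hu0, ?_⟩
  · intro h
    have h' : IsSquare p.1 := by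
      obtain ⟨r, hr⟩ := h
      refine ⟨r.natAbs, ?_⟩
      have := congrArg Int.natAbs hr
      rwa [Int.natAbs_natCast, Int.natAbs_mul] at this
    obtain ⟨r, hr⟩ := h'
    apply not_sq n hn
    rw [← hdu, hr]
    exact ⟨r * p.2, by ring⟩
  · have : n ^ 2 = p.1 * p.2 ^ 2 + 4 := by omega
    have : (n : ℤ) ^ 2 = p.1 * p.2 ^ 2 + 4 := by exact_mod_cast this
    linarith

lemma Cl_finite {n : ℕ} (hn : 3 ≤ n) {p : ℕ × ℕ} (hp : p ∈ idx n) : Finite (Cl p.1) := by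
  obtain ⟨hu, hd, hns, hpell⟩ := idx_spec hn hp
  have hc : 0 < Real.log (eps p.1) / Real.sqrt ((p.1 : ℤ) : ℝ) :=
    div_pos (Real.log_pos (one_lt_eps hd hpell)) (Real.sqrt_pos.2 (by exact_mod_cast hd))
  have hbound : ∀ s : Finset (Cl p.1), (s.card : ℝ) * (Real.log (eps p.1) / Real.sqrt ((p.1 : ℤ) : ℝ)) ≤ p.2 * Aval n := by
    intro s
    have l1 : Tendsto (fun X : ℕ => ∑ C ∈ s, (NC p.1 X C : ℝ) / X) atTop
        (nhds (∑ C ∈ s, Real.log (eps p.1) / Real.sqrt ((p.1 : ℤ) : ℝ))) :=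
      tendsto_finsetSum _ fun C _ => NC_lim hd hns hpell C
    rw [Finset.sum_const, nsmul_eq_mul] at l1
    have l2 : Tendsto (fun X : ℕ => (p.2 : ℝ) * (((W_finite ((n : ℤ) ^ 2 - 4) (p.2 * X)).toFinset.card : ℝ) / ((p.2 * X : ℕ) : ℝ)))
        atTop (nhds (p.2 * Aval n)) :=
      ((W_lim n hn).comp (tendsto_id.const_mul_atTop' hu)).const_mul _
    refine le_of_tendsto_of_tendsto' l1 l2 fun X => ?_
    have h1 := NC_sum_le p.1 X s
    have h2 := W_decomp n (p.2 * X) hn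
    have h3 : (Wp_finite (p.1 : ℤ) (p.2 * X / p.2)).toFinset.card ≤ (W_finite ((n : ℤ) ^ 2 - 4) (p.2 * X)).toFinset.card := by
      rw [h2]
      exact Finset.single_le_sum (f := fun p : ℕ × ℕ => (Wp_finite (p.1 : ℤ) (_ / p.2)).toFinset.card) (fun _ _ => Nat.zero_le _) hp
    rw [Nat.mul_div_cancel_left _ hu] at h3
    have h4 : ((∑ C ∈ s, NC p.1 X C : ℕ) : ℝ) ≤ ((W_finite ((n : ℤ) ^ 2 - 4) (p.2 * X)).toFinset.card : ℝ) := by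
      exact_mod_cast h1.trans h3
    rw [← Finset.sum_div]
    push_cast at h4 ⊢
    have hu' : (0 : ℝ) < p.2 := by exact_mod_cast hu
    rw [← mul_div_assoc, mul_div_mul_left _ _ hu'.ne']
    gcongr
  by_contra hinf
  rw [not_finite_iff_infinite] at hinf
  obtain ⟨k, hk⟩ := exists_nat_gt ((p.2 * Aval n) / (Real.log (eps p.1) / Real.sqrt ((p.1 : ℤ) : ℝ)))
  obtain ⟨s, hs⟩ := Infinite.exists_subset_card_eq (Cl p.1) k
  have := hbound s
  rw [hs, ← le_div_iff₀ hc] at this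
  linarith

lemma Wp_lim {n : ℕ} (hn : 3 ≤ n) {p : ℕ × ℕ} (hp : p ∈ idx n) :
    Tendsto (fun X : ℕ => ((Wp_finite (p.1 : ℤ) X).toFinset.card : ℝ) / X) atTop
      (nhds (classNumber p.1 * (Real.log (eps p.1) / Real.sqrt ((p.1 : ℤ) : ℝ)))) := by
  obtain ⟨hu, hd, hns, hpell⟩ := idx_spec hn hp
  have hfin := Cl_finite hn hp
  have := Fintype.ofFinite (Cl p.1)
  have hcn : classNumber p.1 = Fintype.card (Cl p.1) := by
    unfold classNumber
    exact Nat.card_eq_fintype_card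
  have l1 : Tendsto (fun X : ℕ => ∑ C : Cl p.1, (NC p.1 X C : ℝ) / X) atTop
      (nhds (∑ C : Cl p.1, Real.log (eps p.1) / Real.sqrt ((p.1 : ℤ) : ℝ))) :=
    tendsto_finsetSum _ fun C _ => NC_lim hd hns hpell C
  rw [Finset.sum_const, nsmul_eq_mul, Finset.card_univ, ← hcn] at l1
  refine l1.congr fun X => ?_
  rw [← Finset.sum_div, ← NC_sum_eq]
  push_cast; rfl

lemma natdiv_lim (u : ℕ) : Tendsto (fun X : ℕ => ((X / u : ℕ) : ℝ) / X) atTop (nhds (1 / (u : ℝ))) := by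
  have := (tendsto_nat_floor_mul_div_atTop (R := ℝ) (a := 1 / (u : ℝ)) (by positivity)).comp tendsto_natCast_atTop_atTop (α := ℕ)
  refine this.congr fun X => ?_
  simp only [Function.comp]
  rw [one_div_mul_eq_div, Nat.floor_div_eq_div]

lemma ampA_eq (n : ℕ) (hn : 3 ≤ n) : ampA n = Aval n := by
  have l : Tendsto (fun X : ℕ => ((W_finite ((n : ℤ) ^ 2 - 4) X).toFinset.card : ℝ) / X) atTop (nhds (ampA n)) := by
    have l1 : Tendsto (fun X : ℕ => ∑ p ∈ idx n, ((Wp_finite (p.1 : ℤ) (X / p.2)).toFinset.card : ℝ) / X) atTop (nhds (ampA n)) := by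
      unfold ampA
      refine tendsto_finsetSum _ fun p hp => ?_
      have hu := (idx_spec hn hp).1
      have hdiv : Tendsto (fun X : ℕ => X / p.2) atTop atTop := Nat.tendsto_div_const_atTop hu.ne'
      have l2 := ((Wp_lim hn hp).comp hdiv).mul (natdiv_lim p.2)
      have e : (classNumber (p.1 : ℤ) : ℝ) * (Real.log (eps p.1) / Real.sqrt ((p.1 : ℤ) : ℝ)) * (1 / (p.2 : ℝ)) =
          (classNumber (p.1 : ℤ) : ℝ) * Real.log (eps (p.1 : ℤ)) / ((p.2 : ℝ) * Real.sqrt (p.1 : ℝ)) := by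
        rw [Int.cast_natCast, mul_one_div, mul_div_assoc', div_div, mul_comm (Real.sqrt _)]
      rw [e] at l2
      refine l2.congr' ?_
      filter_upwards [eventually_ge_atTop p.2] with X hX
      have h1 : 0 < X / p.2 := Nat.div_pos hX hu
      have h1' : (0 : ℝ) < ((X / p.2 : ℕ) : ℝ) := by exact_mod_cast h1
      simp only [Function.comp]
      rw [div_mul_div_cancel₀ h1'.ne']
    refine l1.congr fun X => ?_
    rw [W_decomp n X hn]
    push_cast
    rw [Finset.sum_div]
  exact tendsto_nhds_unique l (W_lim n hn)

lemma main_lim : Tendsto (fun N : ℕ => (∑ n ∈ Finset.Icc 3 N, ampA n ^ 2) / (kappa * N)) atTop (nhds 1) := by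
  have h := Aval_moment.div_const kappa
  rw [div_self kappa_pos.ne'] at h
  refine h.congr fun N => ?_
  rw [div_div, mul_comm (N : ℝ)]
  congr 1
  refine Finset.sum_congr rfl fun n hn => ?_
  rw [ampA_eq n (Finset.mem_Icc.1 hn).1]

end PF

/-- **Peter's formula** (Lemma: M. Peter): `Σ_{2 < n ≤ N} A(n)² ∼ κ·N` as `N → ∞`, where
`κ = (1015/864)·∏_{p ≠ 2 prime} (1 + (p⁴ − 2p³ + 1)/(p² − 1)³)`. -/
theorem peters_formula :
    Tendsto (fun N : ℕ => (∑ n ∈ Finset.Icc 3 N, ampA n ^ 2) / (kappa * N))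
      atTop (nhds 1) := by
  exact PF.main_lim
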